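/- arXiv:1406.7559 — 9 statements merged into one kernel-verified Lean document; each statement's English description precedes it below -/
import Mathlib

section
/- Let k be a field and R a finitely generated commutative k-algebra. Then R is smooth over k if and only if R, regarded as a module over R ⊗_k R via the multiplication map, has finite projective dimension. -/
universe u v

open TensorProduct

/-- `ProjDimLE S n M` means that the `S`-module `M` admits a projective resolution
`0 → P_n → ⋯ → P_0 → M → 0` of length `n`. -/
def ProjDimLE (S : Type v) [Ring S] : ℕ → ∀ (M : Type u) [AddCommGroup M] [Module S M], Prop
  | 0, M, _, _ => Module.Projective S M
  | n + 1, M, _, _ =>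
      ∃ (P : Type u) (_ : AddCommGroup P) (_ : Module S P) (f : P →ₗ[S] M),
        Module.Projective S P ∧ Function.Surjective f ∧ ProjDimLE S n (LinearMap.ker f)

namespace SmoothPD

open CategoryTheory

section Homological

variable {S : Type u} [CommRing S]

lemma hasPD_succ_iff {P M : Type u} [AddCommGroup P] [Module S P] [AddCommGroup M] [Module S M]
    [Module.Projective S P] (f : P →ₗ[S] M) (hf : Function.Surjective f) (n : ℕ) :
    HasProjectiveDimensionLE (ModuleCat.of S M) (n + 1) ↔
      HasProjectiveDimensionLE (ModuleCat.of S (LinearMap.ker f)) n := by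
  have hex := LinearMap.shortExact_shortComplexKer hf
  have hp : Projective f.shortComplexKer.X₂ :=
    (IsProjective.iff_projective (R := S) P).mp inferInstance
  exact hex.hasProjectiveDimensionLT_X₃_iff n hp

lemma projDimLE_iff (n : ℕ) (M : Type u) [AddCommGroup M] [Module S M] :
    ProjDimLE S n M ↔ HasProjectiveDimensionLE (ModuleCat.of S M) n := by
  induction n generalizing M with
  | zero =>
    rw [ProjDimLE, IsProjective.iff_projective, projective_iff_hasProjectiveDimensionLE_zero]
  | succ n ih =>
    rw [ProjDimLE]
    constructor
    · rintro ⟨P, _, _, f, hP, hf, h⟩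
      rw [hasPD_succ_iff f hf, ← ih]
      exact h
    · intro h
      refine ⟨M →₀ S, inferInstance, inferInstance, Finsupp.linearCombination S id, inferInstance,
        Finsupp.linearCombination_id_surjective S M, ?_⟩
      rwa [ih, ← hasPD_succ_iff _ (Finsupp.linearCombination_id_surjective S M)]

variable {M N P : Type u} [AddCommGroup M] [Module S M] [AddCommGroup N] [Module S N]
  [AddCommGroup P] [Module S P] {n : ℕ}

lemma ProjDimLE.mono {m : ℕ} (h : ProjDimLE S n M) (hnm : n ≤ m) : ProjDimLE S m M := by
  rw [projDimLE_iff] at *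
  exact hasProjectiveDimensionLT_of_ge _ (n + 1) _ (by omega)

lemma ProjDimLE.of_projective [Module.Projective S M] : ProjDimLE S n M :=
  ProjDimLE.mono (n := 0) (by rw [ProjDimLE]; infer_instance) (Nat.zero_le n)

lemma ProjDimLE.of_retract (h : ProjDimLE S n M) (i : N →ₗ[S] M) (p : M →ₗ[S] N)
    (hip : p ∘ₗ i = LinearMap.id) : ProjDimLE S n N := by
  rw [projDimLE_iff] at *
  let r : Retract (ModuleCat.of S N) (ModuleCat.of S M) :=
    { i := ModuleCat.ofHom i
      r := ModuleCat.ofHom p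
      retract := by rw [← ModuleCat.ofHom_comp, hip]; rfl }
  exact r.hasProjectiveDimensionLT _

lemma ProjDimLE.of_equiv (h : ProjDimLE S n M) (e : M ≃ₗ[S] N) : ProjDimLE S n N :=
  ProjDimLE.of_retract h e.symm.toLinearMap e.toLinearMap (by ext; simp)

lemma ProjDimLE.ker [Module.Projective S P] (f : P →ₗ[S] M) (hf : Function.Surjective f)
    (h : ProjDimLE S (n + 1) M) : ProjDimLE S n (LinearMap.ker f) := by
  rw [projDimLE_iff] at *
  rwa [← hasPD_succ_iff f hf]

lemma ProjDimLE.of_ses (f : P →ₗ[S] M) (hf : Function.Surjective f)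
    (hP : ProjDimLE S (n + 1) P) (h : ProjDimLE S n (LinearMap.ker f)) :
    ProjDimLE S (n + 1) M := by
  rw [projDimLE_iff] at *
  have hex := LinearMap.shortExact_shortComplexKer hf
  exact hex.hasProjectiveDimensionLT_X₃ (n + 1) h hP

/-- base change -/
lemma ProjDimLE.baseChange (B : Type u) [CommRing B] [Algebra S B]
    (C : ∀ (M : Type u) [AddCommGroup M] [Module S M], Prop)
    (hC : ∀ (P M : Type u) [AddCommGroup P] [Module S P] [AddCommGroup M] [Module S M]
      (f : P →ₗ[S] M), Module.Projective S P → Function.Surjective f → C M →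
      C (LinearMap.ker f) ∧ Function.Injective ((LinearMap.ker f).subtype.lTensor B))
    (h : ProjDimLE S n M) (hM : C M) : ProjDimLE B n (B ⊗[S] M) := by
  induction n generalizing M with
  | zero =>
    rw [ProjDimLE] at *
    infer_instance
  | succ n ih =>
    rw [ProjDimLE] at h
    obtain ⟨P, _, _, f, hP, hf, h⟩ := h
    obtain ⟨hk, hinj⟩ := hC P M f hP hf hM
    have hK := ih h hk
    rw [ProjDimLE]
    refine ⟨B ⊗[S] P, inferInstance, inferInstance, f.baseChange B, inferInstance,
      LinearMap.lTensor_surjective B hf, ?_⟩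
    have hex : Function.Exact ((LinearMap.ker f).subtype.baseChange B) (f.baseChange B) :=
      lTensor_exact B (LinearMap.exact_subtype_ker_map f) hf
    refine ProjDimLE.of_equiv hK ((LinearEquiv.ofInjective
      ((LinearMap.ker f).subtype.baseChange B) hinj).trans (LinearEquiv.ofEq _ _ ?_))
    exact hex.linearMap_ker_eq.symm

lemma ProjDimLE.baseChange_flat (B : Type u) [CommRing B] [Algebra S B] [Module.Flat S B]
    (h : ProjDimLE S n M) : ProjDimLE B n (B ⊗[S] M) :=
  ProjDimLE.baseChange B (fun _ _ _ => True)
    (fun _ _ _ _ _ _ _ _ _ _ => ⟨trivial, Module.Flat.lTensor_preserves_injective_linearMap _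
      (Submodule.injective_subtype _)⟩) h trivial

end Homological

section Serre

open IsLocalRing

lemma mem_smul_top_of_one_tmul_eq_zero {S M : Type u} [CommRing S] [AddCommGroup M] [Module S M]
    (I : Ideal S) (v : M) (h : (1 : S ⧸ I) ⊗ₜ[S] v = 0) : v ∈ I • (⊤ : Submodule S M) := by
  have := TensorProduct.quotTensorEquivQuotSMul_mk_one_tmul (M := M) I v
  rw [h, map_zero] at this
  exact (Submodule.Quotient.mk_eq_zero _).mp this.symm

lemma one_tmul_eq_zero_of_mem {S M : Type u} [CommRing S] [AddCommGroup M] [Module S M]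
    (I : Ideal S) (v : M) (h : v ∈ I • (⊤ : Submodule S M)) : (1 : S ⧸ I) ⊗ₜ[S] v = 0 := by
  apply (TensorProduct.quotTensorEquivQuotSMul M I).injective
  rw [TensorProduct.quotTensorEquivQuotSMul_mk_one_tmul, map_zero]
  exact (Submodule.Quotient.mk_eq_zero _).mpr h

lemma exists_one_tmul {S M : Type u} [CommRing S] [AddCommGroup M] [Module S M]
    (I : Ideal S) (t : (S ⧸ I) ⊗[S] M) : ∃ v : M, t = 1 ⊗ₜ v :=
  (TensorProduct.mk_surjective S M (S ⧸ I) Ideal.Quotient.mk_surjective t).imp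
    fun _ h => h.symm

lemma exists_smul_of_mem {S M : Type u} [CommRing S] [AddCommGroup M] [Module S M] (x : S) (v : M)
    (h : v ∈ Ideal.span {x} • (⊤ : Submodule S M)) : ∃ p : M, v = x • p := by
  rw [Submodule.ideal_span_singleton_smul] at h
  obtain ⟨p, -, hp⟩ := (Submodule.mem_smul_pointwise_iff_exists _ _ _).mp h
  exact ⟨p, hp.symm⟩

lemma quot_aux {S P M : Type u} [CommRing S] [AddCommGroup M] [Module S M] [AddCommGroup P]
    [Module S P] (x : S) (hM : IsSMulRegular M x) (f : P →ₗ[S] M) :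
    Function.Injective ((LinearMap.ker f).subtype.lTensor (S ⧸ Ideal.span {x})) := by
  rw [injective_iff_map_eq_zero]
  intro t ht
  obtain ⟨v, rfl⟩ := exists_one_tmul _ t
  apply one_tmul_eq_zero_of_mem
  rw [LinearMap.lTensor_tmul] at ht
  obtain ⟨p, hp⟩ := exists_smul_of_mem _ _ (mem_smul_top_of_one_tmul_eq_zero _ _ ht)
  have hv : f v.1 = 0 := v.2
  have hp' : v.1 = x • p := hp
  have hfp : f p = 0 := by
    apply hM
    change x • f p = x • 0
    rw [← map_smul, ← hp', hv, smul_zero]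
  have : v = x • (⟨p, hfp⟩ : LinearMap.ker f) := Subtype.ext hp'
  rw [this]
  exact Submodule.smul_mem_smul (Ideal.mem_span_singleton_self x) trivial

lemma projDimLE_quot {S M : Type u} [CommRing S] [AddCommGroup M] [Module S M] {n : ℕ} (x : S)
    (hx : x ∈ nonZeroDivisors S) (hxM : IsSMulRegular M x) (h : ProjDimLE S n M) :
    ProjDimLE (S ⧸ Ideal.span {x}) n ((S ⧸ Ideal.span {x}) ⊗[S] M) := by
  refine ProjDimLE.baseChange (S ⧸ Ideal.span {x}) (fun M _ _ => IsSMulRegular M x) ?_ h hxM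
  intro P M _ _ _ _ f hP hf hM
  have hregP : IsSMulRegular P x := Module.Flat.isSMulRegular_of_nonZeroDivisors hx
  exact ⟨fun a b hab => Subtype.ext (hregP (congrArg Subtype.val hab)), quot_aux x hM f⟩

lemma projective_of_socle {R : Type u} [CommRing R] [IsLocalRing R] [IsNoetherianRing R]
    (s : R) (hs : s ≠ 0) (hsm : ∀ a ∈ maximalIdeal R, s * a = 0) (n : ℕ) (M : Type u)
    [AddCommGroup M] [Module R M] [Module.Finite R M] (h : ProjDimLE R n M) :
    Module.Projective R M := by
  induction n generalizing M with
  | zero => rwa [ProjDimLE] at h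
  | succ n ih =>
    obtain ⟨d, f, hf⟩ := Module.Finite.exists_fin' R M
    have : Small.{u} (Fin d → R) := inferInstance
    have hproj : Module.Projective R (LinearMap.ker f) := ih _ (ProjDimLE.ker f hf h)
    have hfree : Module.Free R (LinearMap.ker f) := Module.free_of_flat_of_isLocalRing
    have hinj : Function.Injective ((LinearMap.ker f).subtype.lTensor (ResidueField R)) := by
      rw [injective_iff_map_eq_zero]
      intro t ht
      obtain ⟨v, rfl⟩ : ∃ v, t = (1 : ResidueField R) ⊗ₜ v :=
        exists_one_tmul (maximalIdeal R) t
      refine one_tmul_eq_zero_of_mem (maximalIdeal R) v ?_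
      rw [LinearMap.lTensor_tmul] at ht
      have h1 := mem_smul_top_of_one_tmul_eq_zero (maximalIdeal R) _ ht
      have h2 : s • v = 0 := by
        apply Subtype.ext
        change s • v.1 = 0
        change v.1 ∈ _ at h1
        refine Submodule.smul_induction_on h1 ?_ ?_
        · intro r hr n _
          rw [smul_smul, hsm r hr, zero_smul]
        · intro a b ha hb
          rw [smul_add, ha, hb, add_zero]
      let b := Module.Free.chooseBasis R (LinearMap.ker f)
      have := Fintype.ofFinite (Module.Free.ChooseBasisIndex R (LinearMap.ker f))
      rw [← b.sum_repr v]
      refine Submodule.sum_mem _ fun i _ => Submodule.smul_mem_smul ?_ trivial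
      rw [mem_maximalIdeal, mem_nonunits_iff]
      intro hu
      have h3 : s * b.repr v i = 0 := by
        have := congrArg (fun w => b.repr w i) h2
        simpa using this
      exact hs ((hu.mul_left_eq_zero).mp h3)
    obtain ⟨l, hl⟩ := (IsLocalRing.split_injective_iff_lTensor_residueField_injective
      (LinearMap.ker f).subtype).mpr hinj
    have hex := LinearMap.exact_subtype_ker_map f
    obtain ⟨-, g, hg⟩ := ((hex.split_tfae').out 0 1 rfl rfl).mpr ⟨hf, l, hl⟩
    exact Module.Projective.of_split g f hg

end Serre

section Serre2

open IsLocalRing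

lemma exists_functional {R : Type u} [CommRing R] [IsLocalRing R] (x : R)
    (hx : x ∈ maximalIdeal R) (hx2 : x ∉ maximalIdeal R ^ 2) :
    ∃ g : maximalIdeal R →ₗ[R] ResidueField R, g ⟨x, hx⟩ = 1 := by
  have h0 : (maximalIdeal R).toCotangent ⟨x, hx⟩ ≠ 0 := by
    rwa [Ne, Ideal.toCotangent_eq_zero]
  have h1 : ¬ ∀ φ : Module.Dual (ResidueField R) (CotangentSpace R),
      φ ((maximalIdeal R).toCotangent ⟨x, hx⟩) = 0 := fun h =>
    h0 ((Module.forall_dual_apply_eq_zero_iff (ResidueField R)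
      (V := CotangentSpace R) _).mp h)
  push Not at h1
  obtain ⟨φ, hφ⟩ := h1
  refine ⟨((φ ((maximalIdeal R).toCotangent ⟨x, hx⟩))⁻¹ • φ).restrictScalars R ∘ₗ
    (maximalIdeal R).toCotangent, ?_⟩
  simp [hφ]

lemma pd_step {R : Type u} [CommRing R] [IsLocalRing R] (x : R) {n : ℕ}
    (hx : x ∈ maximalIdeal R) (hx2 : x ∉ maximalIdeal R ^ 2) (hx0 : x ∈ nonZeroDivisors R)
    (h : ProjDimLE R n (R ⧸ maximalIdeal R)) [IsLocalRing (R ⧸ Ideal.span {x})] :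
    ProjDimLE (R ⧸ Ideal.span {x}) n
      ((R ⧸ Ideal.span {x}) ⧸ maximalIdeal (R ⧸ Ideal.span {x})) := by
  have hm : ProjDimLE R n (maximalIdeal R) :=
    ProjDimLE.of_equiv (ProjDimLE.ker (maximalIdeal R).mkQ (Submodule.mkQ_surjective _)
      (ProjDimLE.mono h n.le_succ)) (LinearEquiv.ofEq _ _ (Submodule.ker_mkQ _))
  have hreg : IsSMulRegular (maximalIdeal R) x := by
    intro a b hab
    have := congrArg Subtype.val hab
    exact Subtype.ext ((mul_cancel_left_mem_nonZeroDivisors hx0).mp this)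
  have hq := projDimLE_quot x hx0 hreg hm
  obtain ⟨g, hg⟩ := exists_functional x hx hx2
  have hloc : IsLocalHom (Ideal.Quotient.mk (Ideal.span {x})) :=
    IsLocalHom.of_surjective _ Ideal.Quotient.mk_surjective
  let q : (R ⧸ maximalIdeal R) →ₗ[R]
      ((R ⧸ Ideal.span {x}) ⧸ maximalIdeal (R ⧸ Ideal.span {x})) :=
    Submodule.liftQ _ (Algebra.linearMap R _) (by
      intro a ha
      rw [LinearMap.mem_ker, Algebra.linearMap_apply]
      change Ideal.Quotient.mk _ (Ideal.Quotient.mk _ a) = 0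
      rw [Ideal.Quotient.eq_zero_iff_mem]
      exact (((local_hom_TFAE (Ideal.Quotient.mk (Ideal.span {x}))).out 0 3 rfl rfl).mp hloc) ha)
  have hq1 : q (g ⟨x, hx⟩) = 1 := by
    rw [hg]
    change q (Submodule.Quotient.mk 1) = 1
    rw [Submodule.liftQ_apply, Algebra.linearMap_apply, map_one]
  let p := LinearMap.liftBaseChange (R ⧸ Ideal.span {x}) (q ∘ₗ g)
  let i : ((R ⧸ Ideal.span {x}) ⧸ maximalIdeal (R ⧸ Ideal.span {x})) →ₗ[R ⧸ Ideal.span {x}]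
      ((R ⧸ Ideal.span {x}) ⊗[R] maximalIdeal R) :=
    Submodule.liftQ _ (LinearMap.toSpanSingleton (R ⧸ Ideal.span {x}) _
      ((1 : R ⧸ Ideal.span {x}) ⊗ₜ[R] (⟨x, hx⟩ : maximalIdeal R))) (by
      intro a ha
      obtain ⟨r, rfl⟩ := Ideal.Quotient.mk_surjective a
      have hr : r ∈ maximalIdeal R := by
        rw [mem_maximalIdeal, mem_nonunits_iff] at ha ⊢
        exact fun hu => ha (hu.map _)
      rw [LinearMap.mem_ker, LinearMap.toSpanSingleton_apply, TensorProduct.smul_tmul', smul_eq_mul,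
        mul_one]
      have h1 : (Ideal.Quotient.mk (Ideal.span {x}) r) = r • 1 := by
        rw [Algebra.smul_def, mul_one]; rfl
      have h2 : r • (⟨x, hx⟩ : maximalIdeal R) = x • ⟨r, hr⟩ := Subtype.ext (mul_comm r x)
      have h3 : x • (1 : R ⧸ Ideal.span {x}) = 0 := by
        rw [Algebra.smul_def, mul_one]
        exact Ideal.Quotient.eq_zero_iff_mem.mpr (Ideal.mem_span_singleton_self x)
      rw [h1, TensorProduct.smul_tmul, h2, ← TensorProduct.smul_tmul, h3, TensorProduct.zero_tmul])
  refine ProjDimLE.of_retract hq i p ?_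
  apply Submodule.linearMap_qext
  apply LinearMap.ext_ring
  change p (i (Submodule.Quotient.mk 1)) = _
  rw [Submodule.liftQ_apply, LinearMap.toSpanSingleton_apply, one_smul]
  have hq2 : (q ∘ₗ g) ⟨x, hx⟩ = 1 := hq1
  rw [LinearMap.liftBaseChange_tmul, hq2, one_smul]
  rfl

set_option maxHeartbeats 400000 in
lemma serre {S : Type u} [CommRing S] [IsLocalRing S] [IsNoetherianRing S] (J : Ideal S) :
    ∀ (R : Type u) [CommRing R] [IsLocalRing R] (φ : S →+* R), Function.Surjective φ →
      RingHom.ker φ = J → ∀ n, ProjDimLE R n (R ⧸ maximalIdeal R) →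
      J ⊓ maximalIdeal S ^ 2 ≤ maximalIdeal S * J := by
  induction J using (IsWellFounded.wf : WellFounded (α := Ideal S) (· > ·)).induction with
  | _ J ih =>
  intro R _ _ φ hφ hJ n h
  have : IsNoetherianRing R := isNoetherianRing_of_surjective S R φ hφ
  have hlocφ : IsLocalHom φ := IsLocalHom.of_surjective _ hφ
  have hcomap : (maximalIdeal R).comap φ = maximalIdeal S :=
    ((local_hom_TFAE φ).out 0 4 rfl rfl).mp hlocφ
  by_cases hR : maximalIdeal R = ⊥
  · have : J = maximalIdeal S := by rw [← hJ, ← hcomap, hR]; rfl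
    rw [this, pow_two]
    exact inf_le_right
  by_cases hass : IsAssociatedPrime (maximalIdeal R) R
  · exfalso
    rw [isAssociatedPrime_iff] at hass
    obtain ⟨-, s, hs⟩ := hass
    have hs0 : s ≠ 0 := by
      rintro rfl
      have : (1 : R) ∈ maximalIdeal R := by rw [hs]; simp
      exact (Ideal.ne_top_iff_one _).mp (maximalIdeal.isMaximal R).ne_top this
    have hproj := projective_of_socle s hs0 (fun a ha => by
      rw [hs] at ha
      rw [mul_comm]
      simpa using ha) n (R ⧸ maximalIdeal R) h
    have hfree : Module.Free R (R ⧸ maximalIdeal R) := Module.free_of_flat_of_isLocalRing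
    have : Nontrivial (R ⧸ maximalIdeal R) := Ideal.Quotient.nontrivial_iff.mpr
      (maximalIdeal.isMaximal R).ne_top
    apply hR
    rw [← Ideal.annihilator_quotient (I := maximalIdeal R), Module.annihilator_eq_bot]
    infer_instance
  obtain ⟨x, hx, hx2, hx0⟩ : ∃ x ∈ maximalIdeal R, x ∉ maximalIdeal R ^ 2 ∧
      x ∈ nonZeroDivisors R := by
    by_contra! hcon
    have hsub : (maximalIdeal R : Set R) ⊆
        ⋃ i ∈ insert (maximalIdeal R ^ 2) (associatedPrimes R R), ((id i : Ideal R) : Set R) := by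
      intro x hx
      rw [Set.biUnion_insert]
      by_cases hx2 : x ∈ maximalIdeal R ^ 2
      · exact Or.inl hx2
      · right
        have := hcon x hx hx2
        change x ∈ (nonZeroDivisors R : Set R)ᶜ at this
        rwa [← biUnion_associatedPrimes_eq_compl_nonZeroDivisors] at this
    obtain ⟨p, hp, hle⟩ := (Ideal.subset_union_prime_finite
      ((associatedPrimes.finite R R).insert _) (maximalIdeal R ^ 2) (maximalIdeal R ^ 2)
      (by
        rintro i (rfl | hi) h1 -
        · exact (h1 rfl).elim
        · exact hi.isPrime)).mp hsub
    rcases hp with rfl | hp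
    · apply hR
      refine Submodule.eq_bot_of_le_smul_of_le_jacobson_bot (maximalIdeal R) _
        (IsNoetherian.noetherian _) ?_ (IsLocalRing.maximalIdeal_le_jacobson _)
      rw [smul_eq_mul, ← pow_two]
      exact hle
    · apply hass
      have : maximalIdeal R = p := (maximalIdeal.isMaximal R).eq_of_le hp.isPrime.ne_top hle
      rw [this]
      exact hp
  obtain ⟨y, rfl⟩ := hφ x
  have hnt : Nontrivial (R ⧸ Ideal.span {φ y}) := Ideal.Quotient.nontrivial_iff.mpr (by
    intro htop
    rw [Ideal.span_singleton_eq_top] at htop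
    exact hx htop)
  have : IsLocalRing (R ⧸ Ideal.span {φ y}) :=
    IsLocalRing.of_surjective' (Ideal.Quotient.mk _) Ideal.Quotient.mk_surjective
  have hstep := pd_step (φ y) hx hx2 hx0 h
  have hker : RingHom.ker ((Ideal.Quotient.mk (Ideal.span {φ y})).comp φ) = J ⊔ Ideal.span {y} := by
    ext z
    rw [RingHom.mem_ker, RingHom.comp_apply, Ideal.Quotient.eq_zero_iff_mem,
      Ideal.mem_span_singleton', Submodule.mem_sup]
    constructor
    · rintro ⟨a, ha⟩
      obtain ⟨a, rfl⟩ := hφ a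
      refine ⟨z - a * y, ?_, a * y, Ideal.mem_span_singleton'.mpr ⟨a, rfl⟩, by ring⟩
      rw [← hJ, RingHom.mem_ker, map_sub, map_mul, ha, sub_self]
    · rintro ⟨b, hb, c, hc, rfl⟩
      obtain ⟨a, rfl⟩ := Ideal.mem_span_singleton'.mp hc
      rw [← hJ, RingHom.mem_ker] at hb
      exact ⟨φ a, by rw [map_add, hb, map_mul, zero_add]⟩
  have hyJ : y ∉ J := by
    intro hy
    rw [← hJ, RingHom.mem_ker] at hy
    exact nonZeroDivisors.ne_zero hx0 hy
  have hlt : J ⊔ Ideal.span {y} > J := by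
    refine lt_of_le_of_ne le_sup_left fun heq => hyJ ?_
    rw [heq]
    exact Ideal.mem_sup_right (Ideal.mem_span_singleton_self y)
  have key := ih _ hlt _ ((Ideal.Quotient.mk (Ideal.span {φ y})).comp φ)
    (Ideal.Quotient.mk_surjective.comp hφ) hker n hstep
  rintro a ⟨haJ, ha2⟩
  have ha := key ⟨Ideal.mem_sup_left haJ, ha2⟩
  rw [Ideal.mul_sup, Submodule.mem_sup] at ha
  obtain ⟨b, hb, c, hc, rfl⟩ := ha
  obtain ⟨s, hs, rfl⟩ := Ideal.mem_mul_span_singleton.mp hc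
  refine Ideal.add_mem _ hb ?_
  have hsJ : s ∈ J := by
    have hle : maximalIdeal S * J ≤ J := Ideal.mul_le_right
    have hbJ : b ∈ J := hle hb
    rw [SetLike.mem_coe] at haJ
    rw [← hJ, RingHom.mem_ker] at haJ hbJ ⊢
    rw [map_add, hbJ, zero_add, map_mul] at haJ
    exact (mul_right_mem_nonZeroDivisors_eq_zero_iff hx0).mp haJ
  rw [mul_comm s y]
  refine Ideal.mul_mem_mul ?_ hsJ
  rw [← hcomap]
  exact hx

end Serre2

section LocalSmooth

open IsLocalRing KaehlerDifferential

lemma local_smooth {K P B : Type u} [Field K] [CommRing P] [CommRing B] [IsLocalRing P]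
    [IsLocalRing B] [IsNoetherianRing P] [Algebra K P] [Algebra K B] [Algebra P B]
    [IsScalarTower K P B] [Algebra.FormallySmooth K P] [Module.Free P Ω[P⁄K]]
    [Module.Finite P Ω[P⁄K]] (hsurj : Function.Surjective (algebraMap P B))
    [Algebra.FormallySmooth K (ResidueField B)] {n : ℕ}
    (h : ProjDimLE B n (B ⧸ maximalIdeal B)) : Algebra.FormallySmooth K B := by
  rw [Algebra.FormallySmooth.iff_injective_cotangentComplexBaseChange_residueField (P := P) hsurj
    (IsNoetherian.noetherian _)]
  have hsurjκ : Function.Surjective (algebraMap P (ResidueField B)) := by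
    rw [IsScalarTower.algebraMap_eq P B (ResidueField B)]
    exact (residue_surjective).comp hsurj
  have hker : RingHom.ker (algebraMap P (ResidueField B)) = maximalIdeal P := by
    refine IsLocalRing.eq_maximalIdeal ?_
    exact RingHom.ker_isMaximal_of_surjective _ hsurjκ
  have hinj := (Algebra.FormallySmooth.kerCotangentToTensor_injective_iff (R := K) hsurjκ).mpr
    inferInstance
  have hserre := serre (RingHom.ker (algebraMap P B)) B (algebraMap P B) hsurj rfl n h
  rw [injective_iff_map_eq_zero]
  intro t ht
  obtain ⟨f, rfl⟩ := TensorProduct.mk_surjective P _ (ResidueField B) hsurjκ t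
  rw [TensorProduct.mk_apply] at ht ⊢
  rw [cotangentComplexBaseChange_tmul, one_smul] at ht
  rw [kerToTensor_apply, ← kerCotangentToTensor_toCotangent, map_eq_zero_iff _ hinj,
    Ideal.toCotangent_eq_zero] at ht
  have h1 : f.1 ∈ RingHom.ker (algebraMap P (ResidueField B)) ^ 2 := ht
  rw [hker] at h1
  have h2 := hserre ⟨f.2, h1⟩
  have h3 : f ∈ maximalIdeal P • (⊤ : Submodule P (RingHom.ker (algebraMap P B))) := by
    rw [Submodule.mem_smul_top_iff]
    exact h2
  refine Submodule.smul_induction_on h3 ?_ ?_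
  · intro r hr v _
    rw [← TensorProduct.smul_tmul, Algebra.smul_def, mul_one]
    rw [← hker, RingHom.mem_ker] at hr
    rw [hr, TensorProduct.zero_tmul]
  · intro a b ha hb
    rw [TensorProduct.tmul_add, ha, hb, add_zero]

lemma smoothAt_of_pd {K A : Type u} [Field K] [PerfectField K] [CommRing A] [Algebra K A]
    [Algebra.FiniteType K A] (p : Ideal A) [p.IsPrime] {n : ℕ}
    (h : ProjDimLE (Localization.AtPrime p) n
      (Localization.AtPrime p ⧸ maximalIdeal (Localization.AtPrime p))) :
    Algebra.IsSmoothAt K p := by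
  obtain ⟨d, f₀, hf₀⟩ := Algebra.FiniteType.iff_quotient_mvPolynomial''.mp
    (inferInstance : Algebra.FiniteType K A)
  let S := Localization.AtPrime p
  let q : Ideal (MvPolynomial (Fin d) K) := p.comap f₀
  have : q.IsPrime := Ideal.comap_isPrime _ _
  let P' := Localization.AtPrime q
  let fP : P' →ₐ[K] S := IsLocalization.liftAlgHom (M := q.primeCompl)
      (f := (IsScalarTower.toAlgHom K A S).comp f₀) fun x ↦ by
    simpa using IsLocalization.map_units (M := p.primeCompl) S ⟨f₀ x.1, x.2⟩
  have hf₁ : Function.Surjective fP := by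
    intro x
    obtain ⟨x, ⟨s, hs⟩, rfl⟩ := IsLocalization.exists_mk'_eq p.primeCompl x
    obtain ⟨x, rfl⟩ := hf₀ x
    obtain ⟨s, rfl⟩ := hf₀ s
    refine ⟨IsLocalization.mk' (M := q.primeCompl) _ x ⟨s, hs⟩, ?_⟩
    simp [fP, IsLocalization.lift_mk', Units.mul_inv_eq_iff_eq_mul, IsUnit.liftRight, S]
  algebraize [fP.toRingHom]
  have : Algebra.FormallyEtale (MvPolynomial (Fin d) K) P' := .of_isLocalization q.primeCompl
  have : Algebra.FormallySmooth K P' := .comp _ (MvPolynomial (Fin d) K) _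
  let e := KaehlerDifferential.tensorKaehlerEquivOfFormallyEtale K (MvPolynomial (Fin d) K) P'
  have : Module.Free P' Ω[P'⁄K] := .of_equiv e
  have : Module.Finite P' Ω[P'⁄K] := .equiv e
  have : IsNoetherianRing P' := IsLocalization.isNoetherianRing q.primeCompl _ inferInstance
  have : Algebra.EssFiniteType K S := .comp K A S
  have : Algebra.EssFiniteType S (ResidueField S) := inferInstance
  have : Algebra.EssFiniteType K (ResidueField S) := .comp K S _
  exact local_smooth (P := P') (B := S) hf₁ h

end LocalSmooth

section Global

open IsLocalRing

lemma baseChange_pushout {R A K B M : Type u} [CommRing R] [CommRing A] [CommRing K] [CommRing B]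
    [Algebra R A] [Algebra R K] [Algebra R B] [Algebra A B] [Algebra K B] [IsScalarTower R A B]
    [IsScalarTower R K B] [Module.Free R A] [Algebra.IsPushout R K A B] [AddCommGroup M]
    [Module A M] [Module R M] [IsScalarTower R A M] [Module.Projective R M] {n : ℕ}
    (h : ProjDimLE A n M) : ProjDimLE B n (B ⊗[A] M) := by
  refine ProjDimLE.baseChange B (fun M _ _ => ∃ _ : Module R M,
    IsScalarTower R A M ∧ Module.Projective R M) ?_ h ⟨inferInstance, inferInstance, inferInstance⟩
  rintro P M _ _ _ _ f hP hf ⟨_, _, _⟩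
  let _ : Module R P := Module.compHom P (algebraMap R A)
  have hst : IsScalarTower R A P := ⟨fun r a x => by
    rw [Algebra.smul_def, mul_smul]; rfl⟩
  have hPR : Module.Projective R P := by
    obtain ⟨s, hs⟩ := Module.projective_def'.mp hP
    refine Module.Projective.of_split (s.restrictScalars R)
      ((Finsupp.linearCombination A id).restrictScalars R) ?_
    ext x
    exact LinearMap.congr_fun hs x
  obtain ⟨g, hg⟩ := Module.projective_lifting_property (f.restrictScalars R) LinearMap.id hf
  have hg' : ∀ m, f (g m) = m := fun m => LinearMap.congr_fun hg m
  let l : P →ₗ[R] LinearMap.ker f :=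
    LinearMap.codRestrict ((LinearMap.ker f).restrictScalars R)
      (LinearMap.id - g ∘ₗ f.restrictScalars R) (fun x => by
        simp [hg'])
  have hl : l ∘ₗ (LinearMap.ker f).subtype.restrictScalars R = LinearMap.id := by
    apply LinearMap.ext
    intro x
    apply Subtype.ext
    change x.1 - g (f x.1) = x.1
    rw [show f x.1 = 0 from x.2, map_zero, sub_zero]
  refine ⟨⟨inferInstance, inferInstance, Module.Projective.of_split _ l hl⟩, ?_⟩
  have hinj : Function.Injective
      (((LinearMap.ker f).subtype.restrictScalars R).lTensor K) := by
    have : l.lTensor K ∘ₗ (((LinearMap.ker f).subtype.restrictScalars R).lTensor K) =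
        LinearMap.id := by
      rw [← LinearMap.lTensor_comp, hl, LinearMap.lTensor_id]
    exact Function.HasLeftInverse.injective ⟨_, LinearMap.congr_fun this⟩
  let e₁ := Algebra.IsPushout.cancelBaseChange R K A B (LinearMap.ker f)
  let e₂ := Algebra.IsPushout.cancelBaseChange R K A B P
  have hcomm : ∀ t, ((LinearMap.ker f).subtype.lTensor B) (e₁.symm t) =
      e₂.symm (((LinearMap.ker f).subtype.restrictScalars R).lTensor K t) := by
    intro t
    induction t with
    | zero => simp
    | add a b ha hb => simp only [map_add, ha, hb]
    | tmul a b => simp [e₁, e₂]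
  intro a b hab
  apply e₁.injective
  apply hinj
  apply e₂.symm.injective
  rw [← hcomm, ← hcomm]
  simpa using hab

section
attribute [local instance] Algebra.TensorProduct.rightAlgebra

lemma pushout_aux (k R₁ R₂ K : Type u) [CommRing k] [CommRing R₁] [CommRing R₂] [CommRing K]
    [Algebra k R₁] [Algebra k R₂] [Algebra k K] [Algebra R₁ K] [IsScalarTower k R₁ K]
    [Algebra (R₁ ⊗[k] R₂) (K ⊗[k] R₂)]
    (hmap : ∀ a b, algebraMap (R₁ ⊗[k] R₂) (K ⊗[k] R₂) (a ⊗ₜ b) = algebraMap R₁ K a ⊗ₜ b)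
    [IsScalarTower R₁ (R₁ ⊗[k] R₂) (K ⊗[k] R₂)] :
    Algebra.IsPushout R₁ K (R₁ ⊗[k] R₂) (K ⊗[k] R₂) := by
  have : IsScalarTower R₂ (R₁ ⊗[k] R₂) (K ⊗[k] R₂) := .of_algebraMap_eq fun x => by
    change _ = algebraMap (R₁ ⊗[k] R₂) (K ⊗[k] R₂) (1 ⊗ₜ x)
    rw [hmap, map_one]
    rfl
  have : IsScalarTower k (R₁ ⊗[k] R₂) (K ⊗[k] R₂) := .of_algebraMap_eq fun x => by
    change _ = algebraMap (R₁ ⊗[k] R₂) (K ⊗[k] R₂) (algebraMap k R₁ x ⊗ₜ 1)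
    rw [hmap, ← IsScalarTower.algebraMap_apply]
    rfl
  exact (Algebra.IsPushout.comp_iff k R₁ R₂ (R₁ ⊗[k] R₂)).mp inferInstance
end

end Global

section Global2

open IsLocalRing

lemma resid_pd (k R K : Type u) [Field k] [CommRing R] [Field K]
    [Algebra k R] [Algebra k K] [Algebra R K] [IsScalarTower k R K]
    [Algebra (R ⊗[k] R) R] (hmul : ∀ a b : R, algebraMap (R ⊗[k] R) R (a ⊗ₜ b) = a * b)
    [Algebra (R ⊗[k] R) (K ⊗[k] R)]
    (hmap : ∀ a b, algebraMap (R ⊗[k] R) (K ⊗[k] R) (a ⊗ₜ b) = algebraMap R K a ⊗ₜ b)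
    (σ : K ⊗[k] R →ₐ[K] K) (hσ : ∀ r : R, σ (1 ⊗ₜ r) = algebraMap R K r) {n : ℕ}
    (h : ProjDimLE (R ⊗[k] R) n R) :
    ProjDimLE (K ⊗[k] R) n (K ⊗[k] R ⧸ RingHom.ker σ) := by
  have : IsScalarTower R (R ⊗[k] R) (K ⊗[k] R) := .of_algebraMap_eq fun x => by
    change _ = algebraMap (R ⊗[k] R) (K ⊗[k] R) (x ⊗ₜ 1)
    rw [hmap]
    rfl
  have : IsScalarTower R (R ⊗[k] R) R := .of_algebraMap_eq fun x => by
    change _ = algebraMap (R ⊗[k] R) R (x ⊗ₜ 1)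
    rw [hmul, mul_one]
    rfl
  have := pushout_aux k R R K hmap
  have hB := baseChange_pushout (R := R) (K := K) (B := K ⊗[k] R) h
  have hmv : ∀ (b : K ⊗[k] R) (a c r : R), (b * (algebraMap R K a ⊗ₜ c)) ⊗ₜ[R ⊗[k] R] r =
      b ⊗ₜ[R ⊗[k] R] (a * c * r) := by
    intro b a c r
    rw [← hmap, mul_comm, ← Algebra.smul_def, TensorProduct.smul_tmul, Algebra.smul_def, hmul]
  have key : ∀ b : K ⊗[k] R, b ⊗ₜ[R ⊗[k] R] (1 : R) = (σ b ⊗ₜ 1) ⊗ₜ[R ⊗[k] R] (1 : R) := by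
    intro b
    induction b with
    | zero => simp
    | add x y hx hy => rw [TensorProduct.add_tmul, hx, hy, map_add, TensorProduct.add_tmul,
        TensorProduct.add_tmul]
    | tmul c r =>
      have h1 := hmv (c ⊗ₜ 1) 1 r 1
      have h2 := hmv (c ⊗ₜ 1) r 1 1
      have h3 : σ (c ⊗ₜ r) = c * algebraMap R K r := by
        rw [← hσ, show c ⊗ₜ[k] r = c • ((1 : K) ⊗ₜ[k] r) by rw [TensorProduct.smul_tmul']; simp,
          map_smul, smul_eq_mul]
      simp only [Algebra.TensorProduct.tmul_mul_tmul, mul_one, one_mul, map_one] at h1 h2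
      rw [h3, h1, h2]
  refine ProjDimLE.of_retract hB
    (Submodule.liftQ _ (LinearMap.toSpanSingleton _ _ (1 ⊗ₜ 1)) ?_)
    (LinearMap.liftBaseChange (K ⊗[k] R) ?_) ?_
  · intro x hx
    rw [RingHom.mem_ker] at hx
    rw [LinearMap.mem_ker, LinearMap.toSpanSingleton_apply, TensorProduct.smul_tmul', smul_eq_mul,
      mul_one, key, hx, TensorProduct.zero_tmul, TensorProduct.zero_tmul]
  · refine { toFun := fun r => Ideal.Quotient.mk _ (1 ⊗ₜ r), map_add' := ?_, map_smul' := ?_ }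
    · intro x y
      rw [TensorProduct.tmul_add, map_add]
    · intro a x
      rw [RingHom.id_apply, Algebra.smul_def, Algebra.smul_def, 
        IsScalarTower.algebraMap_apply (R ⊗[k] R) (K ⊗[k] R) (K ⊗[k] R ⧸ RingHom.ker σ)]
      rw [Ideal.Quotient.algebraMap_eq, ← map_mul, Ideal.Quotient.mk_eq_mk_iff_sub_mem,
        RingHom.mem_ker, map_sub, sub_eq_zero, map_mul, hσ, map_mul, hσ]
      congr 1
      induction a with
      | zero => simp
      | add x y hx hy => simp only [map_add, hx, hy]
      | tmul a b =>
        rw [hmul, hmap, map_mul]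
        rw [← hσ b, ← smul_eq_mul, ← map_smul, TensorProduct.smul_tmul']
        simp
  · apply LinearMap.ext
    intro x
    obtain ⟨x, rfl⟩ := Ideal.Quotient.mk_surjective x
    rw [LinearMap.comp_apply]
    erw [Submodule.liftQ_apply]
    rw [LinearMap.toSpanSingleton_apply, map_smul, LinearMap.liftBaseChange_tmul, one_smul]
    change x • Ideal.Quotient.mk _ (1 ⊗ₜ 1) = _
    rw [← Algebra.TensorProduct.one_def, map_one, Algebra.smul_def, mul_one]
    rfl

lemma main_local (k R K : Type u) [Field k] [CommRing R] [Field K] [IsAlgClosed K]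
    [Algebra k R] [Algebra k K] [Algebra.FiniteType k R]
    [Algebra (R ⊗[k] R) R] (hmul : ∀ a b : R, algebraMap (R ⊗[k] R) R (a ⊗ₜ b) = a * b)
    (m : Ideal (K ⊗[k] R)) [hm : m.IsMaximal] {n : ℕ}
    (h : ProjDimLE (R ⊗[k] R) n R) : Algebra.IsSmoothAt K m := by
  let _ : Field (K ⊗[k] R ⧸ m) := Ideal.Quotient.field m
  have : Algebra.FiniteType K (K ⊗[k] R ⧸ m) := .of_surjective (Ideal.Quotient.mkₐ K m)
    (Ideal.Quotient.mkₐ_surjective K m)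
  have : Module.Finite K (K ⊗[k] R ⧸ m) := finite_of_finite_type_of_isJacobsonRing _ _
  have hbij := IsAlgClosed.algebraMap_bijective_of_isIntegral (k := K) (K := K ⊗[k] R ⧸ m)
  let e : K ≃ₐ[K] (K ⊗[k] R ⧸ m) := AlgEquiv.ofBijective (Algebra.ofId _ _) hbij
  let σ : K ⊗[k] R →ₐ[K] K := e.symm.toAlgHom.comp (Ideal.Quotient.mkₐ K m)
  have hker : RingHom.ker σ = m := by
    ext x
    rw [RingHom.mem_ker]
    change e.symm _ = 0 ↔ _
    rw [EmbeddingLike.map_eq_zero_iff]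
    exact Ideal.Quotient.eq_zero_iff_mem
  let ρ : R →ₐ[k] K := (σ.restrictScalars k).comp Algebra.TensorProduct.includeRight
  let _ : Algebra R K := ρ.toRingHom.toAlgebra
  have : IsScalarTower k R K := .of_algebraMap_eq fun x => (ρ.commutes x).symm
  let _ : Algebra (R ⊗[k] R) (K ⊗[k] R) :=
    (Algebra.TensorProduct.map ρ (AlgHom.id k R)).toRingHom.toAlgebra
  have h1 := resid_pd k R K hmul (fun a b => rfl) σ (fun r => rfl) h
  rw [hker] at h1
  have h2 := ProjDimLE.baseChange_flat (Localization.AtPrime m) h1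
  have h3 := ProjDimLE.of_equiv h2 (Ideal.qoutMapEquivTensorQout (Localization.AtPrime m)).symm
  rw [Localization.AtPrime.map_eq_maximalIdeal] at h3
  exact smoothAt_of_pd m h3

lemma smooth_of_pd (k R : Type u) [Field k] [CommRing R]
    [Algebra k R] [Algebra.FiniteType k R]
    [Algebra (R ⊗[k] R) R] (hmul : ∀ a b : R, algebraMap (R ⊗[k] R) R (a ⊗ₜ b) = a * b)
    {n : ℕ} (h : ProjDimLE (R ⊗[k] R) n R) : Algebra.Smooth k R := by
  let K := AlgebraicClosure k
  have : Algebra.FinitePresentation k R := Algebra.FinitePresentation.of_finiteType.mp inferInstance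
  have hfs : Algebra.FormallySmooth K (K ⊗[k] R) := by
    rw [← Algebra.smoothLocus_eq_univ_iff, Set.eq_univ_iff_forall]
    intro p
    obtain ⟨m, hm, hpm⟩ := Ideal.exists_le_maximal p.asIdeal p.2.ne_top
    have h1 : (⟨m, hm.isPrime⟩ : PrimeSpectrum (K ⊗[k] R)) ∈ Algebra.smoothLocus K (K ⊗[k] R) :=
      main_local k R K hmul m h
    exact Specializes.mem_open ((PrimeSpectrum.le_iff_specializes _ _).mp hpm)
      Algebra.isOpen_smoothLocus h1
  have : Algebra.Smooth K (K ⊗[k] R) := ⟨hfs, inferInstance⟩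
  exact Algebra.Smooth.of_smooth_tensorProduct_of_faithfullyFlat K

end Global2

section Hilbert

open Polynomial

/-- every module has projective dimension at most n -/
def GD (T : Type u) [CommRing T] (n : ℕ) : Prop :=
  ∀ (M : Type u) [AddCommGroup M] [Module T M], ProjDimLE T n M

lemma GD.of_ringEquiv {T T' : Type u} [CommRing T] [CommRing T'] (e : T ≃+* T') {n : ℕ}
    (h : GD T n) : GD T' n := by
  intro M _ _
  let _ : Algebra T T' := e.toRingHom.toAlgebra
  let _ : Module T M := Module.compHom M e.toRingHom
  have hst : IsScalarTower T T' M := ⟨fun r a x => by rw [Algebra.smul_def, mul_smul]; rfl⟩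
  have : Module.Flat T T' := by
    let e' : T ≃ₗ[T] T' := LinearEquiv.ofBijective (Algebra.linearMap T T') e.bijective
    exact Module.Flat.of_linearEquiv e'.symm
  have h1 := ProjDimLE.baseChange_flat T' (h M)
  refine ProjDimLE.of_retract h1
    { toFun := fun m => 1 ⊗ₜ m, map_add' := ?_, map_smul' := ?_ }
    (LinearMap.liftBaseChange T' LinearMap.id) ?_
  · intro x y
    rw [TensorProduct.tmul_add]
  · intro t m
    obtain ⟨t, rfl⟩ := e.surjective t
    have : (e t) • m = t • m := rfl
    rw [this, RingHom.id_apply, TensorProduct.smul_tmul', ← TensorProduct.smul_tmul, smul_eq_mul,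
      Algebra.smul_def]
    rfl
  · ext m
    simp

variable {T : Type u} [CommRing T] {M : Type u} [AddCommGroup M] [Module T[X] M] [Module T M]
  [IsScalarTower T T[X] M]

noncomputable def xm : M →ₗ[T] M := (LinearMap.lsmul T[X] M X).restrictScalars T

lemma xm_apply (m : M) : xm (T := T) m = (X : T[X]) • m := rfl

noncomputable def dd : ℕ → (M →ₗ[T] T[X] ⊗[T] M)
  | 0 => 0
  | n + 1 => TensorProduct.mk T T[X] M (X ^ n) + dd n ∘ₗ xm

noncomputable def psi : T[X] ⊗[T] M →ₗ[T] T[X] ⊗[T] M :=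
  TensorProduct.lift ((Polynomial.basisMonomials T).constr T dd)

lemma psi_apply (n : ℕ) (m : M) : psi ((X ^ n : T[X]) ⊗ₜ[T] m) = dd n m := by
  have : (X ^ n : T[X]) = Polynomial.basisMonomials T n := by
    rw [Polynomial.coe_basisMonomials]
    exact (Polynomial.monomial_one_right_eq_X_pow n).symm
  rw [psi, TensorProduct.lift.tmul, this, Module.Basis.constr_basis]

noncomputable def phi : T[X] ⊗[T] M →ₗ[T[X]] T[X] ⊗[T] M :=
  LinearMap.liftBaseChange T[X] (TensorProduct.mk T T[X] M X - TensorProduct.mk T T[X] M 1 ∘ₗ xm)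

lemma phi_apply (p : T[X]) (m : M) :
    phi (p ⊗ₜ[T] m) = (p * X) ⊗ₜ m - p ⊗ₜ ((X : T[X]) • m) := by
  rw [phi, LinearMap.liftBaseChange_tmul]
  simp [smul_sub, TensorProduct.smul_tmul', xm_apply]

lemma tens_ind {N : Type u} [AddCommGroup N] [Module T N] (f g : T[X] ⊗[T] M →ₗ[T] N)
    (h : ∀ (n : ℕ) (m : M), f ((X ^ n : T[X]) ⊗ₜ[T] m) = g ((X ^ n : T[X]) ⊗ₜ[T] m)) : f = g := by
  apply TensorProduct.ext
  apply (Polynomial.basisMonomials T).ext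
  intro n
  ext m
  have := h n m
  simpa [Polynomial.monomial_one_right_eq_X_pow] using this

lemma psi_phi (z : T[X] ⊗[T] M) : psi (phi z) = z := by
  have : psi ∘ₗ (phi (T := T) (M := M)).restrictScalars T = LinearMap.id := by
    apply tens_ind
    intro n m
    rw [LinearMap.comp_apply, LinearMap.restrictScalars_apply, phi_apply, ← pow_succ, map_sub,
      psi_apply, psi_apply, dd]
    simp [xm_apply]
  exact LinearMap.congr_fun this z

noncomputable def mulm : T[X] ⊗[T] M →ₗ[T[X]] M := LinearMap.liftBaseChange T[X] LinearMap.id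

lemma mulm_apply (p : T[X]) (m : M) : mulm (p ⊗ₜ[T] m) = p • m := by
  rw [mulm, LinearMap.liftBaseChange_tmul, LinearMap.id_apply]

lemma phi_dd (n : ℕ) (m : M) :
    phi (dd n m) = (X ^ n : T[X]) ⊗ₜ[T] m - 1 ⊗ₜ ((X ^ n : T[X]) • m) := by
  induction n generalizing m with
  | zero => simp [dd]
  | succ n ih =>
    rw [dd, LinearMap.add_apply, map_add, LinearMap.comp_apply, ih, TensorProduct.mk_apply,
      phi_apply, xm_apply, pow_succ, mul_smul]
    abel

lemma phi_psi (z : T[X] ⊗[T] M) : phi (psi z) = z - 1 ⊗ₜ mulm z := by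
  have : (phi (T := T) (M := M)).restrictScalars T ∘ₗ psi =
      LinearMap.id - TensorProduct.mk T T[X] M 1 ∘ₗ mulm.restrictScalars T := by
    apply tens_ind
    intro n m
    rw [LinearMap.comp_apply, LinearMap.restrictScalars_apply, psi_apply, phi_dd]
    simp [mulm_apply]
  exact LinearMap.congr_fun this z

lemma mulm_phi (z : T[X] ⊗[T] M) : mulm (phi z) = 0 := by
  induction z with
  | zero => simp
  | add a b ha hb => rw [map_add, map_add, ha, hb, add_zero]
  | tmul p m => rw [phi_apply, map_sub, mulm_apply, mulm_apply, mul_smul, sub_self]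

lemma GD.polynomial {n : ℕ} (h : GD T n) : GD T[X] (n + 1) := by
  intro M _ _
  let _ : Module T M := Module.compHom M (algebraMap T T[X])
  have hst : IsScalarTower T T[X] M := ⟨fun r a x => by rw [Algebra.smul_def, mul_smul]; rfl⟩
  have h1 := ProjDimLE.baseChange_flat T[X] (h M)
  refine ProjDimLE.of_ses (mulm (T := T) (M := M)) (fun m => ⟨1 ⊗ₜ m, by rw [mulm_apply, one_smul]⟩)
    (ProjDimLE.mono h1 (Nat.le_succ n)) ?_
  refine ProjDimLE.of_equiv h1 (LinearEquiv.ofBijective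
    (phi.codRestrict (LinearMap.ker mulm) mulm_phi) ⟨?_, ?_⟩)
  · intro a b hab
    have : phi a = phi b := congrArg Subtype.val hab
    rw [← psi_phi a, this, psi_phi]
  · rintro ⟨z, hz⟩
    refine ⟨psi z, Subtype.ext ?_⟩
    change phi (psi z) = z
    rw [phi_psi, LinearMap.mem_ker.mp hz, TensorProduct.tmul_zero, sub_zero]

lemma GD.field (k : Type u) [Field k] : GD k 0 := fun _ _ _ => ProjDimLE.of_projective

lemma GD.mvPolynomial {T : Type u} [CommRing T] {n : ℕ} (h : GD T n) (d : ℕ) :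
    GD (MvPolynomial (Fin d) T) (n + d) := by
  induction d with
  | zero => exact GD.of_ringEquiv (MvPolynomial.isEmptyAlgEquiv T (Fin 0)).symm.toRingEquiv h
  | succ d ih =>
    exact GD.of_ringEquiv (MvPolynomial.finSuccEquiv T d).symm.toRingEquiv (GD.polynomial ih)

lemma GD.mvTensor (k : Type u) [Field k] (d : ℕ) :
    GD (MvPolynomial (Fin d) k ⊗[k] MvPolynomial (Fin d) k) (0 + d + d) :=
  GD.of_ringEquiv
    (MvPolynomial.algebraTensorAlgEquiv k (MvPolynomial (Fin d) k)).symm.toRingEquiv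
    (GD.mvPolynomial (GD.mvPolynomial (GD.field k) d) d)

end Hilbert

section EtaleStep

lemma etale_step (k P Q : Type u) [Field k] [CommRing P] [CommRing Q] [Algebra k P] [Algebra k Q]
    [Algebra P Q] [IsScalarTower k P Q] [Algebra.FormallyUnramified P Q]
    [Algebra.FiniteType P Q] [Module.Flat P Q] [Algebra (Q ⊗[k] Q) Q]
    (hmul : ∀ a b : Q, algebraMap (Q ⊗[k] Q) Q (a ⊗ₜ b) = a * b) {n : ℕ} (h : GD (P ⊗[k] P) n) :
    ProjDimLE (Q ⊗[k] Q) n Q := by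
  let g : P →ₐ[k] Q := IsScalarTower.toAlgHom k P Q
  let _ : Algebra (P ⊗[k] P) P := (Algebra.TensorProduct.lmul' k (S := P)).toRingHom.toAlgebra
  let _ : Algebra (P ⊗[k] P) (Q ⊗[k] Q) := (Algebra.TensorProduct.map g g).toRingHom.toAlgebra
  have hmap : ∀ a b : P, algebraMap (P ⊗[k] P) (Q ⊗[k] Q) (a ⊗ₜ b) =
    algebraMap P Q a ⊗ₜ algebraMap P Q b := fun a b => rfl
  have hmulP : ∀ a b : P, algebraMap (P ⊗[k] P) P (a ⊗ₜ b) = a * b := fun a b => rfl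
  have hflatg : g.toRingHom.Flat := by
    change (algebraMap P Q).Flat
    rw [RingHom.flat_algebraMap_iff]
    infer_instance
  have hflat : Module.Flat (P ⊗[k] P) (Q ⊗[k] Q) := by
    rw [← RingHom.flat_algebraMap_iff]
    exact RingHom.Flat.tensorProductMap (f := g) (g := g) hflatg hflatg
  have hE := ProjDimLE.baseChange_flat (Q ⊗[k] Q) (h P)
  let E := (Q ⊗[k] Q) ⊗[P ⊗[k] P] P
  have hmv : ∀ (b : Q ⊗[k] Q) (a c r : P),
      (b * (algebraMap P Q a ⊗ₜ algebraMap P Q c)) ⊗ₜ[P ⊗[k] P] r =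
      b ⊗ₜ[P ⊗[k] P] (a * c * r) := by
    intro b a c r
    rw [← hmap, mul_comm, ← Algebra.smul_def, TensorProduct.smul_tmul, Algebra.smul_def, hmulP]
  let j₀ : Q → Q →+ E := fun x => AddMonoidHom.mk'
    (fun y : Q => ((x ⊗ₜ[k] y) ⊗ₜ[P ⊗[k] P] (1 : P) : E))
    (fun y z => by rw [TensorProduct.tmul_add, TensorProduct.add_tmul])
  have hj₀ : ∀ x y, j₀ x y = (x ⊗ₜ[k] y) ⊗ₜ[P ⊗[k] P] (1 : P) := fun x y => rfl
  let j₁ : Q →+ Q →+ E := AddMonoidHom.mk' j₀ (fun x z => by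
    refine AddMonoidHom.ext fun y => ?_
    rw [AddMonoidHom.add_apply, hj₀, hj₀, hj₀, TensorProduct.add_tmul, TensorProduct.add_tmul])
  let j : Q ⊗[P] Q →+ E := TensorProduct.liftAddHom j₁
    (fun r x y => by
      change ((r • x) ⊗ₜ[k] y) ⊗ₜ[P ⊗[k] P] (1 : P) = (x ⊗ₜ[k] (r • y)) ⊗ₜ[P ⊗[k] P] (1 : P)
      have h1 := hmv (x ⊗ₜ y) r 1 1
      have h2 := hmv (x ⊗ₜ y) 1 r 1
      simp only [Algebra.TensorProduct.tmul_mul_tmul, map_one, mul_one, one_mul] at h1 h2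
      rw [Algebra.smul_def, Algebra.smul_def, mul_comm _ x, mul_comm _ y, h1, h2])
  have hj : ∀ x y : Q, j (x ⊗ₜ y) = (x ⊗ₜ[k] y) ⊗ₜ[P ⊗[k] P] (1 : P) := fun x y => rfl
  have hsm : ∀ (c d : Q ⊗[k] Q) (a : P), c • (d ⊗ₜ[P ⊗[k] P] a : E) = (c * d) ⊗ₜ[P ⊗[k] P] a :=
    fun _ _ _ => rfl
  have hjs : ∀ (x y : Q) (z : Q ⊗[P] Q), j ((x ⊗ₜ y) * z) = (x ⊗ₜ[k] y) • j z := by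
    intro x y z
    induction z with
    | zero => simp
    | add a b ha hb => rw [mul_add, map_add, map_add, ha, hb, smul_add]
    | tmul a b =>
      rw [Algebra.TensorProduct.tmul_mul_tmul, hj, hj, hsm, Algebra.TensorProduct.tmul_mul_tmul]
  let t : E := j (Algebra.FormallyUnramified.elem P Q)
  have ht : ∀ q : Q, ((1 : Q) ⊗ₜ[k] q) • t = (q ⊗ₜ[k] (1 : Q)) • t := by
    intro q
    rw [← hjs, ← hjs, Algebra.FormallyUnramified.one_tmul_mul_elem]
  have ht' : ∀ c : Q ⊗[k] Q, c • t = (algebraMap (Q ⊗[k] Q) Q c ⊗ₜ[k] (1 : Q)) • t := by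
    intro c
    induction c with
    | zero => simp
    | add a b ha hb => rw [map_add, TensorProduct.add_tmul, add_smul, add_smul, ha, hb]
    | tmul a b =>
      rw [hmul, ← mul_one a, ← one_mul b, ← Algebra.TensorProduct.tmul_mul_tmul, mul_smul, ht,
        ← mul_smul, Algebra.TensorProduct.tmul_mul_tmul]
      simp
  let _ : Module (P ⊗[k] P) Q := Module.compHom Q (algebraMap (P ⊗[k] P) (Q ⊗[k] Q))
  have hst : IsScalarTower (P ⊗[k] P) (Q ⊗[k] Q) Q :=
    ⟨fun r a x => by rw [Algebra.smul_def r a, mul_smul]; rfl⟩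
  let p : E →ₗ[Q ⊗[k] Q] Q := LinearMap.liftBaseChange (Q ⊗[k] Q)
    { toFun := fun a => algebraMap P Q a
      map_add' := map_add _
      map_smul' := fun c a => by
        rw [RingHom.id_apply, Algebra.smul_def, map_mul]
        change _ = (algebraMap (P ⊗[k] P) (Q ⊗[k] Q) c) • algebraMap P Q a
        rw [Algebra.smul_def]
        congr 1
        induction c with
        | zero => simp
        | add a b ha hb => simp only [map_add, ha, hb]
        | tmul a b => rw [hmap, hmul, hmulP, map_mul] }
  have hp : ∀ z : Q ⊗[P] Q, p (j z) = Algebra.TensorProduct.lmul' P z := by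
    intro z
    induction z with
    | zero => simp
    | add a b ha hb => rw [map_add, map_add, map_add, ha, hb]
    | tmul a b =>
      rw [hj, Algebra.TensorProduct.lmul'_apply_tmul]
      change p _ = _
      rw [LinearMap.liftBaseChange_tmul]
      change _ • algebraMap P Q 1 = _
      rw [map_one, Algebra.smul_def, hmul, mul_one]
  refine ProjDimLE.of_retract hE
    { toFun := fun q => (q ⊗ₜ[k] (1 : Q)) • t, map_add' := ?_, map_smul' := ?_ } p ?_
  · intro x y
    rw [TensorProduct.add_tmul, add_smul]
  · intro c x
    rw [RingHom.id_apply, ← mul_smul, ht' (c * _), map_mul, hmul, mul_one, Algebra.smul_def c x]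
  · ext q
    change p ((q ⊗ₜ[k] (1 : Q)) • t) = q
    rw [map_smul, hp, Algebra.FormallyUnramified.lmul_elem, Algebra.smul_def, hmul, mul_one,
      mul_one]

lemma standard_step (k Q : Type u) [Field k] [CommRing Q] [Algebra k Q]
    [Algebra.IsStandardSmooth k Q] [Algebra (Q ⊗[k] Q) Q]
    (hmul : ∀ a b : Q, algebraMap (Q ⊗[k] Q) Q (a ⊗ₜ b) = a * b) :
    ∃ n, ProjDimLE (Q ⊗[k] Q) n Q := by
  obtain ⟨d, hd⟩ : ∃ d, Algebra.IsStandardSmoothOfRelativeDimension d k Q := by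
    obtain ⟨ι, σ, _, _, ⟨P⟩⟩ := (inferInstance : Algebra.IsStandardSmooth k Q)
    exact ⟨P.dimension, ⟨ι, σ, inferInstance, inferInstance, P, rfl⟩⟩
  obtain ⟨g, hg⟩ := Algebra.IsStandardSmoothOfRelativeDimension.exists_etale_mvPolynomial
    (n := d) (R := k) (S := Q)
  let _ : Algebra (MvPolynomial (Fin d) k) Q := g.toRingHom.toAlgebra
  have : IsScalarTower k (MvPolynomial (Fin d) k) Q := .of_algebraMap_eq fun x =>
    (g.commutes x).symm
  have : Algebra.Etale (MvPolynomial (Fin d) k) Q := hg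
  exact ⟨_, etale_step k (MvPolynomial (Fin d) k) Q hmul (GD.mvTensor k d)⟩

end EtaleStep

section Glue

lemma glue {A : Type u} [CommRing A] [IsNoetherianRing A] {ι : Type u} (g : ι → A)
    (hs : Ideal.span (Set.range g) = ⊤) (C : ι → Type u) [∀ i, CommRing (C i)]
    [∀ i, Algebra A (C i)] [∀ i, IsLocalization.Away (g i) (C i)] {n : ℕ}
    (M : Type u) [AddCommGroup M] [Module A M] [Module.Finite A M]
    (h : ∀ i, ProjDimLE (C i) n (C i ⊗[A] M)) : ProjDimLE A n M := by
  have hfl : ∀ i, Module.Flat A (C i) := fun i => IsLocalization.flat _ (Submonoid.powers (g i))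
  induction n generalizing M with
  | zero =>
    simp only [ProjDimLE] at h ⊢
    have : Module.FinitePresentation A M := Module.finitePresentation_of_finite A M
    choose e he using fun r : Set.range g => r.2
    have (r : Set.range g) : IsLocalizedModule.Away r.1 (TensorProduct.mk A (C (e r)) M 1) := by
      have : IsLocalization.Away r.1 (C (e r)) := by
        rw [← he r]; infer_instance
      infer_instance
    have : Module.Flat A M := by
      refine Module.flat_of_isLocalized_span A M (Set.range g) hs (fun r => C (e r) ⊗[A] M)
        (fun r => TensorProduct.mk A (C (e r)) M 1) (fun r => ?_)
      have := h (e r)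
      exact Module.Flat.trans A (C (e r)) _
    exact Module.Flat.projective_of_finitePresentation
  | succ n ih =>
    obtain ⟨d, f, hf⟩ := Module.Finite.exists_fin' A M
    have : Module.Free A (ULift.{u} (Fin d) → A) := inferInstance
    let e : (ULift.{u} (Fin d) → A) ≃ₗ[A] (Fin d → A) :=
      LinearEquiv.funCongrLeft A A Equiv.ulift.symm
    have hf' : Function.Surjective (f ∘ₗ e.toLinearMap) := hf.comp e.surjective
    refine ProjDimLE.of_ses (f ∘ₗ e.toLinearMap) hf' ProjDimLE.of_projective (ih _ fun i => ?_)
    generalize f ∘ₗ e.toLinearMap = f' at *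
    have hex : Function.Exact ((LinearMap.ker f').subtype.baseChange (C i)) (f'.baseChange (C i)) :=
      lTensor_exact (C i) (LinearMap.exact_subtype_ker_map f') hf'
    have hinj : Function.Injective ((LinearMap.ker f').subtype.baseChange (C i)) :=
      Module.Flat.lTensor_preserves_injective_linearMap _ (Submodule.injective_subtype _)
    have hk := ProjDimLE.ker (f'.baseChange (C i)) (LinearMap.lTensor_surjective (C i) hf') (h i)
    exact ProjDimLE.of_equiv hk ((LinearEquiv.ofInjective
      ((LinearMap.ker f').subtype.baseChange (C i)) hinj).trans
        (LinearEquiv.ofEq _ _ hex.linearMap_ker_eq.symm)).symm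

lemma away_tensor (k R Q : Type u) [CommRing k] [CommRing R] [CommRing Q] [Algebra k R]
    [Algebra k Q] [Algebra R Q] [IsScalarTower k R Q] (f : R) [IsLocalization.Away f Q]
    [Algebra (R ⊗[k] R) (Q ⊗[k] Q)]
    (hmap : ∀ a b : R, algebraMap (R ⊗[k] R) (Q ⊗[k] Q) (a ⊗ₜ b) =
      algebraMap R Q a ⊗ₜ algebraMap R Q b) :
    IsLocalization.Away (f ⊗ₜ[k] f) (Q ⊗[k] Q) := by
  let g : R →ₐ[k] Q := IsScalarTower.toAlgHom k R Q
  let _ : Algebra (R ⊗[k] R) (Q ⊗[k] R) :=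
    (Algebra.TensorProduct.map g (AlgHom.id k R)).toRingHom.toAlgebra
  let _ : Algebra (Q ⊗[k] R) (Q ⊗[k] Q) :=
    (Algebra.TensorProduct.map (AlgHom.id k Q) g).toRingHom.toAlgebra
  have h1 : ∀ a b : R, algebraMap (R ⊗[k] R) (Q ⊗[k] R) (a ⊗ₜ b) = algebraMap R Q a ⊗ₜ b :=
    fun a b => rfl
  have h2 : ∀ (a : Q) (b : R), algebraMap (Q ⊗[k] R) (Q ⊗[k] Q) (a ⊗ₜ b) = a ⊗ₜ algebraMap R Q b :=
    fun a b => rfl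
  have : IsScalarTower (R ⊗[k] R) (Q ⊗[k] R) (Q ⊗[k] Q) := .of_algebraMap_eq fun x => by
    induction x with
    | zero => simp
    | add a b ha hb => simp only [map_add, ha, hb]
    | tmul a b => rw [hmap, h1, h2]
  have : IsScalarTower R (R ⊗[k] R) (Q ⊗[k] R) := .of_algebraMap_eq fun x => by
    change _ = algebraMap (R ⊗[k] R) (Q ⊗[k] R) (x ⊗ₜ 1)
    rw [h1]
    rfl
  have : IsScalarTower Q (Q ⊗[k] R) (Q ⊗[k] Q) := .of_algebraMap_eq fun x => by
    change _ = algebraMap (Q ⊗[k] R) (Q ⊗[k] Q) (x ⊗ₜ 1)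
    rw [h2, map_one]
    rfl
  have l1 := IsLocalization.tensorProduct_tensorProduct k R (A := R) (Submonoid.powers f) Q
    (by ext x; change algebraMap (R ⊗[k] R) (Q ⊗[k] R) (1 ⊗ₜ x) = 1 ⊗ₜ x; rw [h1, map_one])
  have l2 := IsLocalization.tensorProduct_tensorProduct_right k Q (A := R) (Submonoid.powers f) Q
    (by ext x; rfl)
  rw [Algebra.algebraMapSubmonoid, Submonoid.map_powers] at l1
  rw [Submonoid.map_powers] at l2
  have l1' : IsLocalization.Away (f ⊗ₜ[k] (1 : R)) (Q ⊗[k] R) := l1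
  have l2' : IsLocalization.Away (algebraMap (R ⊗[k] R) (Q ⊗[k] R) ((1 : R) ⊗ₜ[k] f))
      (Q ⊗[k] Q) := by
    rw [h1, map_one]
    exact l2
  have := IsLocalization.Away.mul' (Q ⊗[k] R) (Q ⊗[k] Q) (f ⊗ₜ[k] (1 : R)) ((1 : R) ⊗ₜ[k] f)
  rwa [Algebra.TensorProduct.tmul_mul_tmul, mul_one, one_mul] at this

lemma loc_step (k R Q : Type u) [Field k] [CommRing R] [CommRing Q] [Algebra k R]
    [Algebra k Q] [Algebra R Q] [IsScalarTower k R Q] (f : R) [IsLocalization.Away f Q]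
    [Algebra (R ⊗[k] R) (Q ⊗[k] Q)]
    (hmap : ∀ a b : R, algebraMap (R ⊗[k] R) (Q ⊗[k] Q) (a ⊗ₜ b) =
      algebraMap R Q a ⊗ₜ algebraMap R Q b)
    [Algebra (R ⊗[k] R) R] (hmulR : ∀ a b : R, algebraMap (R ⊗[k] R) R (a ⊗ₜ b) = a * b)
    [Algebra.IsStandardSmooth k Q] :
    ∃ n, ProjDimLE (Q ⊗[k] Q) n ((Q ⊗[k] Q) ⊗[R ⊗[k] R] R) := by
  let _ : Algebra (Q ⊗[k] Q) Q := (Algebra.TensorProduct.lmul' k (S := Q)).toRingHom.toAlgebra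
  have hmul : ∀ a b : Q, algebraMap (Q ⊗[k] Q) Q (a ⊗ₜ b) = a * b := fun a b => rfl
  obtain ⟨n, hn⟩ := standard_step k Q hmul
  refine ⟨n, ?_⟩
  let E := (Q ⊗[k] Q) ⊗[R ⊗[k] R] R
  have hmv : ∀ (b : Q ⊗[k] Q) (a c r : R),
      (b * (algebraMap R Q a ⊗ₜ algebraMap R Q c)) ⊗ₜ[R ⊗[k] R] r =
      b ⊗ₜ[R ⊗[k] R] (a * c * r) := by
    intro b a c r
    rw [← hmap, mul_comm, ← Algebra.smul_def, TensorProduct.smul_tmul, Algebra.smul_def, hmulR]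
  let t : E := (1 : Q ⊗[k] Q) ⊗ₜ[R ⊗[k] R] (1 : R)
  have htc : ∀ c : Q ⊗[k] Q, c • t = c ⊗ₜ[R ⊗[k] R] (1 : R) := by
    intro c
    change (c * 1) ⊗ₜ[R ⊗[k] R] (1 : R) = _
    rw [mul_one]
  have hau := away_tensor k R Q f hmap
  have ht : ∀ q : Q, ((1 : Q) ⊗ₜ[k] q) • t = (q ⊗ₜ[k] (1 : Q)) • t := by
    intro q
    obtain ⟨m, r, hr⟩ := IsLocalization.Away.surj f q
    have hu : IsUnit (algebraMap R Q f ⊗ₜ[k] algebraMap R Q f) := by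
      rw [← hmap]
      exact IsLocalization.Away.algebraMap_isUnit (S := Q ⊗[k] Q) (f ⊗ₜ[k] f)
    apply (hu.pow m).smul_left_cancel.mp
    have e1 := hmv 1 (f ^ m) r 1
    have e2 := hmv 1 r (f ^ m) 1
    rw [one_mul, map_pow, ← hr] at e1 e2
    rw [← mul_smul, ← mul_smul, htc, htc, Algebra.TensorProduct.tmul_pow,
      Algebra.TensorProduct.tmul_mul_tmul, Algebra.TensorProduct.tmul_mul_tmul, mul_one,
      mul_comm _ q, e1, e2, mul_comm r]
  have ht' : ∀ c : Q ⊗[k] Q, c • t = (algebraMap (Q ⊗[k] Q) Q c ⊗ₜ[k] (1 : Q)) • t := by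
    intro c
    induction c with
    | zero => simp
    | add a b ha hb => rw [map_add, TensorProduct.add_tmul, add_smul, add_smul, ha, hb]
    | tmul a b =>
      rw [hmul, ← mul_one a, ← one_mul b, ← Algebra.TensorProduct.tmul_mul_tmul, mul_smul, ht,
        ← mul_smul, Algebra.TensorProduct.tmul_mul_tmul]
      simp
  let _ : Module (R ⊗[k] R) Q := Module.compHom Q (algebraMap (R ⊗[k] R) (Q ⊗[k] Q))
  have hst : IsScalarTower (R ⊗[k] R) (Q ⊗[k] Q) Q :=
    ⟨fun r a x => by rw [Algebra.smul_def r a, mul_smul]; rfl⟩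
  let p : E →ₗ[Q ⊗[k] Q] Q := LinearMap.liftBaseChange (Q ⊗[k] Q)
    { toFun := fun a => algebraMap R Q a
      map_add' := map_add _
      map_smul' := fun c a => by
        rw [RingHom.id_apply, Algebra.smul_def, map_mul]
        change _ = (algebraMap (R ⊗[k] R) (Q ⊗[k] Q) c) • algebraMap R Q a
        rw [Algebra.smul_def]
        congr 1
        induction c with
        | zero => simp
        | add a b ha hb => simp only [map_add, ha, hb]
        | tmul a b => rw [hmap, hmul, hmulR, map_mul] }
  let i : Q →ₗ[Q ⊗[k] Q] E :=
    { toFun := fun q => (q ⊗ₜ[k] (1 : Q)) • t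
      map_add' := fun x y => by rw [TensorProduct.add_tmul, add_smul]
      map_smul' := fun c x => by
        rw [RingHom.id_apply, ← mul_smul, ht' (c * _), map_mul, hmul, mul_one,
          Algebra.smul_def c x] }
  refine ProjDimLE.of_retract hn p i ?_
  apply LinearMap.ext
  intro z
  rw [LinearMap.comp_apply, LinearMap.id_apply]
  induction z with
  | zero => simp
  | add a b ha hb => rw [map_add, map_add, ha, hb]
  | tmul c r =>
    have hp : p (c ⊗ₜ r) = c • algebraMap R Q r := LinearMap.liftBaseChange_tmul _ _ _ _
    rw [hp, map_smul]
    change c • ((algebraMap R Q r ⊗ₜ[k] (1 : Q)) • t) = _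
    have e1 := hmv c r 1 1
    rw [map_one, mul_one, mul_one] at e1
    rw [← mul_smul, htc, e1]

lemma diag_step {A R C : Type u} [CommRing A] [CommRing R] [CommRing C] [Algebra A R]
    [Algebra A C] (g : A) (hg : algebraMap A R g = 0) [IsLocalization.Away g C] (n : ℕ) :
    ProjDimLE C n (C ⊗[A] R) := by
  have hu := IsLocalization.Away.algebraMap_isUnit (S := C) g
  have : Subsingleton (C ⊗[A] R) := by
    refine subsingleton_of_forall_eq 0 fun z => ?_
    induction z with
    | zero => rfl
    | add a b ha hb => rw [ha, hb, add_zero]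
    | tmul c r =>
      obtain ⟨u, hu⟩ := hu
      have : c = g • ((↑u⁻¹ : C) * c) := by
        rw [Algebra.smul_def, ← hu, Units.mul_inv_cancel_left]
      rw [this, TensorProduct.smul_tmul, Algebra.smul_def, hg, zero_mul, TensorProduct.tmul_zero]
  exact ProjDimLE.of_projective

lemma loc_alg (k R Q : Type u) [Field k] [CommRing R] [CommRing Q] [Algebra k R]
    [Algebra k Q] [Algebra R Q] [IsScalarTower k R Q] (f : R) [IsLocalization.Away f Q]
    [Algebra (R ⊗[k] R) R] (hmulR : ∀ a b : R, algebraMap (R ⊗[k] R) R (a ⊗ₜ b) = a * b)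
    [Algebra.IsStandardSmooth k Q] :
    ∃ (n : ℕ) (C : CommAlgCat.{u} (R ⊗[k] R)), IsLocalization.Away (f ⊗ₜ[k] f) C ∧
      ProjDimLE C n (C ⊗[R ⊗[k] R] R) := by
  let _ : Algebra (R ⊗[k] R) (Q ⊗[k] Q) :=
    (Algebra.TensorProduct.map (IsScalarTower.toAlgHom k R Q)
      (IsScalarTower.toAlgHom k R Q)).toRingHom.toAlgebra
  obtain ⟨n, hn⟩ := loc_step k R Q f (fun a b => rfl) hmulR
  exact ⟨n, CommAlgCat.of (R ⊗[k] R) (Q ⊗[k] Q), away_tensor k R Q f (fun a b => rfl), hn⟩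

lemma pd_of_smooth (k R : Type u) [Field k] [CommRing R] [Algebra k R] [Algebra.Smooth k R]
    [Algebra (R ⊗[k] R) R] (hmul : ∀ a b : R, algebraMap (R ⊗[k] R) R (a ⊗ₜ b) = a * b) :
    ∃ n, ProjDimLE (R ⊗[k] R) n R := by
  obtain ⟨s, hs, hstd⟩ := Algebra.Smooth.exists_span_eq_top_isStandardSmooth k R
  obtain ⟨s', hs's, hs'⟩ := (Ideal.span_eq_top_iff_finite s).mp hs
  have : Algebra.FiniteType k (R ⊗[k] R) := Algebra.FiniteType.trans (S := R) inferInstance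
    inferInstance
  have : IsNoetherianRing (R ⊗[k] R) := Algebra.FiniteType.isNoetherianRing k _
  have hsurj : Function.Surjective (algebraMap (R ⊗[k] R) R) := fun r =>
    ⟨r ⊗ₜ 1, by rw [hmul, mul_one]⟩
  have : Module.Finite (R ⊗[k] R) R := Module.Finite.of_surjective
    (Algebra.linearMap (R ⊗[k] R) R) hsurj
  have hloc : ∀ f : s', ∃ (n : ℕ) (C : CommAlgCat.{u} (R ⊗[k] R)),
      IsLocalization.Away (f.1 ⊗ₜ[k] f.1) C ∧ ProjDimLE C n (C ⊗[R ⊗[k] R] R) := by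
    intro f
    have := hstd f.1 (hs's f.2)
    exact loc_alg k R (Localization.Away f.1) f.1 hmul
  choose N D hD hN using hloc
  let n := Finset.univ.sup N
  refine ⟨n, ?_⟩
  let ι := s' ⊕ RingHom.ker (algebraMap (R ⊗[k] R) R)
  let g : ι → R ⊗[k] R := Sum.elim (fun f => f.1 ⊗ₜ f.1) (fun g => g.1)
  let C : ι → CommAlgCat.{u} (R ⊗[k] R) := Sum.elim D
    (fun g => CommAlgCat.of (R ⊗[k] R) (Localization.Away g.1))
  have hC : ∀ i, IsLocalization.Away (g i) (C i) := by
    rintro (f | x)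
    · exact hD f
    · change IsLocalization.Away x.1 (Localization.Away x.1)
      infer_instance
  refine glue g ?_ (fun i => C i) R ?_
  · set J := Ideal.span (Set.range g) with hJ
    have hker : RingHom.ker (algebraMap (R ⊗[k] R) R) ≤ J := fun x hx =>
      Ideal.subset_span ⟨Sum.inr ⟨x, hx⟩, rfl⟩
    have hmapJ : J.map (algebraMap (R ⊗[k] R) R) = ⊤ := by
      rw [eq_top_iff, ← Ideal.span_pow_eq_top (s' : Set R) hs' 2, Ideal.span_le]
      rintro _ ⟨f, hf, rfl⟩
      have := Ideal.mem_map_of_mem (algebraMap (R ⊗[k] R) R)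
        (Ideal.subset_span ⟨Sum.inl ⟨f, hf⟩, rfl⟩ : g (Sum.inl ⟨f, hf⟩) ∈ J)
      have h2 : algebraMap (R ⊗[k] R) R (g (Sum.inl ⟨f, hf⟩)) = f ^ 2 := by
        change algebraMap (R ⊗[k] R) R (f ⊗ₜ f) = _
        rw [hmul, sq]
      rw [h2] at this
      exact this
    have h3 := Ideal.comap_map_of_surjective' (algebraMap (R ⊗[k] R) R) hsurj J
    rw [hmapJ, Ideal.comap_top, sup_eq_left.mpr hker] at h3
    exact h3.symm
  · rintro (f | x)
    · exact ProjDimLE.mono (hN f) (Finset.le_sup (Finset.mem_univ f))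
    · exact diag_step (C := Localization.Away x.1) x.1 x.2 n

end Glue

end SmoothPD

/-- Let `k` be a field and `R` a finitely generated commutative `k`-algebra. Then `R` is
smooth over `k` if and only if `R`, regarded as a module over `R ⊗[k] R` via the
multiplication map, has finite projective dimension. -/
theorem smooth_iff_finite_projDim_over_enveloping
    (k : Type u) (R : Type u) [Field k] [CommRing R] [Algebra k R]
    (hfg : Algebra.FiniteType k R) :
    Algebra.Smooth k R ↔
      ∃ n : ℕ, @ProjDimLE (R ⊗[k] R) _ n R _
        ((Algebra.TensorProduct.lmul' k (S := R)).toRingHom.toModule) := by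
  letI : Algebra (R ⊗[k] R) R := (Algebra.TensorProduct.lmul' k (S := R)).toRingHom.toAlgebra
  constructor
  · intro h
    exact SmoothPD.pd_of_smooth k R (fun a b => rfl)
  · rintro ⟨n, hn⟩
    exact SmoothPD.smooth_of_pd k R (fun a b => rfl) hn
end

section
/- Let k be a field and R a finitely generated commutative k-algebra that is smooth over k. Then R, regarded as a module over R ⊗_k R via the multiplication map, admits a finite resolution 0 → P_n → ⋯ → P_0 → R → 0 in which every P_i is a finitely generated projective R ⊗_k R-module. -/
universe u v

open TensorProduct

/-- `FGProjDimLE S n M` means that the `S`-module `M` admits a resolution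
`0 → P_n → ⋯ → P_0 → M → 0` of length `n` in which every `P_i` is a finitely
generated projective `S`-module. -/
def FGProjDimLE (S : Type v) [Ring S] : ℕ → ∀ (M : Type u) [AddCommGroup M] [Module S M], Prop
  | 0, M, _, _ => Module.Finite S M ∧ Module.Projective S M
  | n + 1, M, _, _ =>
      ∃ (P : Type u) (_ : AddCommGroup P) (_ : Module S P) (f : P →ₗ[S] M),
        Module.Finite S P ∧ Module.Projective S P ∧ Function.Surjective f ∧
          FGProjDimLE S n (LinearMap.ker f)

namespace SmoothRes
open CategoryTheory

/-- projective dimension at most `n`, unbundled -/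
abbrev PD (S : Type u) [CommRing S] (n : ℕ) (M : Type u) [AddCommGroup M] [Module S M] : Prop :=
  HasProjectiveDimensionLE (ModuleCat.of S M) n

section
variable {S : Type u} [CommRing S] {M N P : Type u} [AddCommGroup M] [Module S M]
  [AddCommGroup N] [Module S N] [AddCommGroup P] [Module S P]

lemma pd_zero_iff : PD S 0 M ↔ Module.Projective S M := by
  rw [PD, ← projective_iff_hasProjectiveDimensionLE_zero]
  exact (IsProjective.iff_projective (R := S) M).symm

lemma pd_mono {n m : ℕ} (h : n ≤ m) (H : PD S n M) : PD S m M :=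
  hasProjectiveDimensionLT_of_ge _ (n + 1) (m + 1) (by omega)

lemma pd_equiv (e : M ≃ₗ[S] N) {n : ℕ} (H : PD S n M) : PD S n N :=
  hasProjectiveDimensionLT_of_iso e.toModuleIso (n + 1)

lemma pd_retract {n : ℕ} (i : M →ₗ[S] N) (r : N →ₗ[S] M) (h : ∀ x, r (i x) = x)
    (H : PD S n N) : PD S n M := by
  have : Retract (ModuleCat.of S M) (ModuleCat.of S N) :=
    ⟨ModuleCat.ofHom i, ModuleCat.ofHom r, by ext x; exact h x⟩
  exact this.hasProjectiveDimensionLT (n + 1)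

/-- the short exact sequence -/
lemma shortExact_aux (f : M →ₗ[S] N) (g : N →ₗ[S] P) (hf : Function.Injective f)
    (hg : Function.Surjective g) (h : Function.Exact f g) :
    (ModuleCat.shortComplexOfCompEqZero f g h.linearMap_comp_eq_zero).ShortExact where
  exact := ModuleCat.shortComplex_exact _ h
  mono_f := by simpa [ModuleCat.mono_iff_injective] using! hf
  epi_g := by simpa [ModuleCat.epi_iff_surjective] using! hg

lemma pd_succ_of_exact {n : ℕ} (f : M →ₗ[S] N) (g : N →ₗ[S] P) (hf : Function.Injective f)
    (hg : Function.Surjective g) (h : Function.Exact f g) (h1 : PD S n M) (h2 : PD S n N) :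
    PD S (n + 1) P :=
  (shortExact_aux f g hf hg h).hasProjectiveDimensionLT_X₃ (n + 1) h1
    (pd_mono (Nat.le_succ n) h2)

lemma pd_succ_iff {n : ℕ} (f : M →ₗ[S] N) (g : N →ₗ[S] P) (hf : Function.Injective f)
    (hg : Function.Surjective g) (h : Function.Exact f g) [Module.Projective S N] :
    PD S (n + 1) P ↔ PD S n M :=
  (shortExact_aux f g hf hg h).hasProjectiveDimensionLT_X₃_iff n
    ((IsProjective.iff_projective (R := S) N).mp inferInstance)

lemma pd_ker_iff {n : ℕ} (g : N →ₗ[S] P) (hg : Function.Surjective g) [Module.Projective S N] :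
    PD S (n + 1) P ↔ PD S n (LinearMap.ker g) :=
  pd_succ_iff (LinearMap.ker g).subtype g Subtype.val_injective hg
    (LinearMap.exact_subtype_ker_map g)

end

/-- from finite projective dimension to finite resolutions -/
lemma fg_of_pd {S : Type u} [CommRing S] [IsNoetherianRing S] (n : ℕ) :
    ∀ (M : Type u) [AddCommGroup M] [Module S M] [Module.Finite S M], PD S n M →
      FGProjDimLE S n M := by
  induction n with
  | zero => intro M _ _ _ h; exact ⟨inferInstance, pd_zero_iff.mp h⟩
  | succ n ih =>
    intro M _ _ _ h
    obtain ⟨P, _, _, _, _, f, hf⟩ := Module.exists_finite_presentation S M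
    refine ⟨P, inferInstance, inferInstance, f, inferInstance, inferInstance, hf, ?_⟩
    exact ih _ ((pd_ker_iff f hf).mp h)

lemma exact_aux {T : Type u} (U : Type u) [CommRing T] [CommRing U] [Algebra T U]
    {N P : Type u} [AddCommGroup N] [Module T N] [AddCommGroup P] [Module T P]
    (g : N →ₗ[T] P) (hg : Function.Surjective g) :
    Function.Exact ((LinearMap.ker g).subtype.baseChange U) (g.baseChange U) := by
  have h : Function.Exact (LinearMap.ker g).subtype g := LinearMap.exact_subtype_ker_map g
  exact lTensor_exact U h hg

/-- flat base change -/
lemma pd_baseChange {T U : Type u} [CommRing T] [CommRing U] [Algebra T U] [Module.Flat T U]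
    (n : ℕ) : ∀ (M : Type u) [AddCommGroup M] [Module T M], PD T n M → PD U n (U ⊗[T] M) := by
  induction n with
  | zero =>
    intro M _ _ h
    have := pd_zero_iff.mp h
    exact pd_zero_iff.mpr inferInstance
  | succ n ih =>
    intro M _ _ h
    let f : (M →₀ T) →ₗ[T] M := Finsupp.linearCombination T id
    have hf : Function.Surjective f := Finsupp.linearCombination_id_surjective T M
    have h' := ih _ ((pd_ker_iff f hf).mp h)
    refine (pd_succ_iff ((LinearMap.ker f).subtype.baseChange U) (f.baseChange U) ?_ ?_ ?_).mpr h'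
    · exact Module.Flat.lTensor_preserves_injective_linearMap (M := U) _ Subtype.val_injective
    · exact LinearMap.lTensor_surjective U hf
    · exact exact_aux U f hf

/-- projective dimension of a ring hom target -/
def PDR {S W : Type u} [CommRing S] [CommRing W] (φ : S →+* W) (n : ℕ) : Prop :=
  @PD S _ n W _ φ.toModule

section
variable {S W W' : Type u} [CommRing S] [CommRing W] [CommRing W']

lemma pdr_step (φ : S →+* W) (ψ : W →+* W') (hψ : Function.Surjective ψ) (x : W)
    (hx : ∀ y, x * y = 0 → y = 0) (hk : ∀ y, ψ y = 0 ↔ ∃ z, x * z = y) {n : ℕ}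
    (h : PDR φ n) : PDR (ψ.comp φ) (n + 1) := by
  let := φ.toModule
  let := (ψ.comp φ).toModule
  let f : W →ₗ[S] W :=
    { toFun := fun y ↦ x * y
      map_add' := mul_add x
      map_smul' := fun s y ↦ by
        change x * (φ s * y) = φ s * (x * y); ring }
  let g : W →ₗ[S] W' :=
    { toFun := ψ
      map_add' := map_add ψ
      map_smul' := fun s y ↦ by
        change ψ (φ s * y) = ψ (φ s) * ψ y; simp }
  exact pd_succ_of_exact f g ((injective_iff_map_eq_zero f).mpr hx) hψ (fun y ↦ hk y) h h

lemma pdr_retract (φ : S →+* W) (ψ : W →+* W') (hφ : Function.Surjective (ψ.comp φ))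
    (t : W) (ht : ψ t = 1) (h0 : ∀ s, ψ (φ s) = 0 → φ s * t = 0)
    {n : ℕ} (h : PDR φ n) : PDR (ψ.comp φ) n := by
  let := φ.toModule
  let := (ψ.comp φ).toModule
  let g : W →ₗ[S] W' :=
    { toFun := ψ
      map_add' := map_add ψ
      map_smul' := fun s y ↦ by
        change ψ (φ s * y) = ψ (φ s) * ψ y; simp }
  choose σ hσ using hφ
  have key : ∀ s, φ s * t = φ (σ (ψ (φ s))) * t := fun s ↦ by
    have := h0 (s - σ (ψ (φ s))) (by
      have := hσ (ψ (φ s)); simp only [RingHom.comp_apply] at this; simp [this])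
    rw [map_sub, sub_mul, sub_eq_zero] at this
    exact this
  have hσ' : ∀ w, ψ (φ (σ w)) = w := hσ
  let i : W' →ₗ[S] W :=
    { toFun := fun w ↦ φ (σ w) * t
      map_add' := fun a b ↦ by
        rw [← add_mul, ← map_add, key (σ a + σ b)]
        simp [hσ']
      map_smul' := fun s y ↦ by
        change φ (σ (ψ (φ s) * y)) * t = φ s * (φ (σ y) * t)
        rw [← mul_assoc, ← map_mul, key (s * σ y)]
        simp [hσ'] }
  refine pd_retract i g (fun w ↦ ?_) h
  change ψ (φ (σ w) * t) = w
  simp [hσ', ht]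

lemma pdr_zero_of_bijective (φ : S →+* W) (hφ : Function.Bijective φ) : PDR φ 0 := by
  let := φ.toModule
  let e : S →ₗ[S] W :=
    { toFun := φ
      map_add' := map_add φ
      map_smul' := fun s y ↦ map_mul φ s y }
  exact pd_zero_iff.mpr (Module.Projective.of_equiv (LinearEquiv.ofBijective e hφ))
end

end SmoothRes

namespace SmoothRes
open CategoryTheory

section
variable (k A R : Type u) [CommRing k] [CommRing A] [CommRing R] [Algebra k A] [Algebra k R]
  [Algebra A R] [IsScalarTower k A R]

/-- the map `R ⊗[k] R → R ⊗[A] R` -/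
noncomputable def δ : R ⊗[k] R →+* R ⊗[A] R :=
  (Algebra.TensorProduct.mapOfCompatibleSMul A k k R R).toRingHom

@[simp] lemma δ_tmul (a b : R) : δ k A R (a ⊗ₜ b) = a ⊗ₜ b := rfl

lemma δ_surjective : Function.Surjective (δ k A R) :=
  Algebra.TensorProduct.mapOfCompatibleSMul_surjective A k k R R

lemma ringHom_ext_tmul {W : Type u} [CommRing W] {f g : R ⊗[k] R →+* W}
    (h1 : ∀ a : R, f (a ⊗ₜ 1) = g (a ⊗ₜ 1)) (h2 : ∀ a : R, f (1 ⊗ₜ a) = g (1 ⊗ₜ a)) : f = g := by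
  apply RingHom.ext
  intro x
  induction x with
  | zero => simp
  | add x y hx hy => simp [hx, hy]
  | tmul a b =>
    have : a ⊗ₜ[k] b = (a ⊗ₜ 1) * (1 ⊗ₜ b) := by simp
    rw [this, map_mul, map_mul, h1, h2]

lemma δ_ker_aux {Q : Type u} [CommRing Q] (q : R ⊗[k] R →+* Q)
    (hq : ∀ a : A, q ((algebraMap A R a) ⊗ₜ[k] (1 : R)) = q ((1 : R) ⊗ₜ[k] (algebraMap A R a))) :
    ∀ y, δ k A R y = 0 → q y = 0 := by
  let l : R →+* Q := q.comp (Algebra.TensorProduct.includeLeftRingHom)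
  let r : R →+* Q := q.comp (Algebra.TensorProduct.includeRight (R := k) (A := R)).toRingHom
  let : Algebra A Q := (l.comp (algebraMap A R)).toAlgebra
  let l' : R →ₐ[A] Q := { l with commutes' := fun a ↦ rfl }
  let r' : R →ₐ[A] Q := { r with commutes' := fun a ↦ (hq a).symm }
  let L : R ⊗[A] R →ₐ[A] Q :=
    Algebra.TensorProduct.lift l' r' (fun _ _ ↦ Commute.all _ _)
  have key : L.toRingHom.comp (δ k A R) = q := by
    apply ringHom_ext_tmul
    · intro a
      change L (a ⊗ₜ 1) = _
      simp [L]; rfl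
    · intro a
      change L (1 ⊗ₜ a) = _
      simp [L]; rfl
  intro y hy
  rw [← key, RingHom.comp_apply, hy, map_zero]

lemma δ_ker (J : Ideal (R ⊗[k] R))
    (hJ : ∀ a : A, (algebraMap A R a) ⊗ₜ[k] (1 : R) - (1 : R) ⊗ₜ[k] (algebraMap A R a) ∈ J) :
    ∀ y, δ k A R y = 0 → y ∈ J := fun y hy ↦
  Ideal.Quotient.eq_zero_iff_mem.mp
    (δ_ker_aux k A R (Ideal.Quotient.mk J) (fun a ↦ Ideal.Quotient.eq.mpr (hJ a)) y hy)

end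

section step
variable {C A R : Type u} [CommRing C] [CommRing A] [CommRing R] [Algebra C A] [Algebra C R]
  [Algebra A R] [IsScalarTower C A R]

lemma nzd_aux (e : Polynomial C ≃ₐ[C] A) (r : R) (y : A ⊗[C] R)
    (h : (e Polynomial.X ⊗ₜ[C] 1 - 1 ⊗ₜ[C] r) * y = 0) : y = 0 := by
  let E : A ⊗[C] R ≃ₐ[C] Polynomial R :=
    ((Algebra.TensorProduct.comm C A R).trans
      (Algebra.TensorProduct.congr (AlgEquiv.refl (R := C) (A₁ := R)) e.symm)).trans
      (polyEquivTensor C R).symm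
  have h1 : E (e Polynomial.X ⊗ₜ[C] 1 - 1 ⊗ₜ[C] r) = Polynomial.X - Polynomial.C r := by
    rw [map_sub]
    congr 1
    · simp [E]
    · simp [E, Polynomial.smul_eq_C_mul]
  have h2 := congrArg E h
  rw [map_mul, h1, map_zero] at h2
  have h3 := (Polynomial.monic_X_sub_C r).isRegular.left
  have h4 : E y = 0 := h3 (by simpa using h2)
  simpa using h4

lemma nzd (e : Polynomial C ≃ₐ[C] A) [Module.Flat A R] (y : R ⊗[C] R)
    (h : (algebraMap A R (e Polynomial.X) ⊗ₜ[C] 1 - 1 ⊗ₜ[C] algebraMap A R (e Polynomial.X)) * y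
      = 0) : y = 0 := by
  set x := e Polynomial.X
  let m : A ⊗[C] R →ₗ[A] A ⊗[C] R :=
    LinearMap.mulLeft A (x ⊗ₜ[C] 1 - 1 ⊗ₜ[C] algebraMap A R x)
  have hm : Function.Injective m := (injective_iff_map_eq_zero m).mpr (nzd_aux e _)
  have hM := Module.Flat.lTensor_preserves_injective_linearMap (M := R) m hm
  let c := TensorProduct.AlgebraTensorModule.cancelBaseChange C A A R R
  have key : ∀ z : R ⊗[A] (A ⊗[C] R), c (m.lTensor R z) =
      (algebraMap A R x ⊗ₜ[C] 1 - 1 ⊗ₜ[C] algebraMap A R x) * c z := by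
    intro z
    induction z with
    | zero => simp
    | add a b ha hb => rw [map_add, map_add, map_add, mul_add, ha, hb]
    | tmul a b =>
      induction b with
      | zero => simp
      | add b d hb hd => rw [tmul_add, map_add, map_add, map_add, mul_add, hb, hd]
      | tmul b d =>
        simp only [m, c, LinearMap.lTensor_tmul, LinearMap.mulLeft_apply, sub_mul, tmul_sub,
          map_sub, Algebra.TensorProduct.tmul_mul_tmul, one_mul,
          TensorProduct.AlgebraTensorModule.cancelBaseChange_tmul, Algebra.smul_def, map_mul]
        simp only [Algebra.TensorProduct.tmul_mul_tmul, one_mul, mul_assoc]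
  obtain ⟨z, rfl⟩ := c.surjective y
  rw [← key] at h
  have : m.lTensor R z = 0 := by simpa using h
  rw [hM (this.trans (map_zero _).symm), map_zero]

variable (k : Type u) [CommRing k] [Algebra k C] [Algebra k A] [Algebra k R]
  [IsScalarTower k C R] [IsScalarTower k A R]

lemma pdr_poly_step (e : Polynomial C ≃ₐ[C] A) [Module.Flat A R] {n : ℕ}
    (h : PDR (δ k C R) n) : PDR (δ k A R) (n + 1) := by
  have hc : (δ C A R).comp (δ k C R) = δ k A R := by
    apply ringHom_ext_tmul <;> intro a <;> simp
  rw [← hc]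
  set x := algebraMap A R (e Polynomial.X) with hx
  refine pdr_step _ _ (δ_surjective C A R) (x ⊗ₜ 1 - 1 ⊗ₜ x) (nzd e) (fun y ↦ ⟨fun hy ↦ ?_, ?_⟩) h
  · have := δ_ker C A R (Ideal.span {x ⊗ₜ 1 - 1 ⊗ₜ x}) ?_ y hy
    · obtain ⟨z, hz⟩ := Ideal.mem_span_singleton.mp this
      exact ⟨z, hz.symm⟩
    · set J := Ideal.span {x ⊗ₜ[C] (1 : R) - 1 ⊗ₜ x}
      let l : A →ₐ[C] (R ⊗[C] R) ⧸ J := (Ideal.Quotient.mkₐ C J).comp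
        ((Algebra.TensorProduct.includeLeft (R := C) (S := C) (A := R) (B := R)).comp
          (IsScalarTower.toAlgHom C A R))
      let r : A →ₐ[C] (R ⊗[C] R) ⧸ J := (Ideal.Quotient.mkₐ C J).comp
        ((Algebra.TensorProduct.includeRight (R := C) (A := R) (B := R)).comp
          (IsScalarTower.toAlgHom C A R))
      have hlr : l.comp e.toAlgHom = r.comp e.toAlgHom := by
        apply Polynomial.algHom_ext
        change (Ideal.Quotient.mk J) (x ⊗ₜ[C] (1 : R)) = (Ideal.Quotient.mk J) ((1 : R) ⊗ₜ[C] x)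
        exact Ideal.Quotient.eq.mpr (Ideal.subset_span rfl)
      intro a
      have := DFunLike.congr_fun hlr (e.symm a)
      simp only [AlgHom.comp_apply] at this
      change l (e (e.symm a)) = r (e (e.symm a)) at this
      rw [AlgEquiv.apply_symm_apply] at this
      exact Ideal.Quotient.eq.mp this
  · rintro ⟨z, rfl⟩
    rw [map_mul, map_sub, δ_tmul, δ_tmul]
    have : x ⊗ₜ[A] (1 : R) = 1 ⊗ₜ x := by
      rw [hx, Algebra.algebraMap_eq_smul_one, smul_tmul]
    rw [this, sub_self, zero_mul]

end step

lemma pdr_mvPoly (k : Type u) [CommRing k] (n : ℕ) : ∀ (R : Type u) [CommRing R] [Algebra k R]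
    [Algebra (MvPolynomial (Fin n) k) R] [IsScalarTower k (MvPolynomial (Fin n) k) R]
    [Module.Flat (MvPolynomial (Fin n) k) R], PDR (δ k (MvPolynomial (Fin n) k) R) n := by
  induction n with
  | zero =>
    intro R _ _ _ _ _
    refine pdr_zero_of_bijective _ ⟨(injective_iff_map_eq_zero _).mpr fun y hy ↦ ?_,
      δ_surjective _ _ _⟩
    refine δ_ker k (MvPolynomial (Fin 0) k) R ⊥ (fun a ↦ ?_) y hy
    obtain ⟨c, rfl⟩ := MvPolynomial.C_surjective (Fin 0) a
    rw [← MvPolynomial.algebraMap_eq, ← IsScalarTower.algebraMap_apply,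
      Algebra.algebraMap_eq_smul_one, smul_tmul, sub_self]
    exact zero_mem _
  | succ n ih =>
    intro R _ _ _ _ _
    let e' := MvPolynomial.finSuccEquiv k n
    let : Algebra (MvPolynomial (Fin n) k) (MvPolynomial (Fin (n + 1)) k) :=
      (e'.symm.toRingEquiv.toRingHom.comp Polynomial.C).toAlgebra
    let : Algebra (MvPolynomial (Fin n) k) R :=
      ((algebraMap (MvPolynomial (Fin (n + 1)) k) R).comp
        (algebraMap (MvPolynomial (Fin n) k) (MvPolynomial (Fin (n + 1)) k))).toAlgebra
    have : IsScalarTower (MvPolynomial (Fin n) k) (MvPolynomial (Fin (n + 1)) k) R :=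
      .of_algebraMap_eq' rfl
    have : IsScalarTower k (MvPolynomial (Fin n) k) (MvPolynomial (Fin (n + 1)) k) :=
      .of_algebraMap_eq fun c ↦ (e'.symm.commutes c).symm
    have : IsScalarTower k (MvPolynomial (Fin n) k) R :=
      .of_algebraMap_eq fun c ↦ by
        rw [IsScalarTower.algebraMap_apply (MvPolynomial (Fin n) k)
          (MvPolynomial (Fin (n + 1)) k) R, ← IsScalarTower.algebraMap_apply k,
          ← IsScalarTower.algebraMap_apply k]
    let e : Polynomial (MvPolynomial (Fin n) k) ≃ₐ[MvPolynomial (Fin n) k]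
        MvPolynomial (Fin (n + 1)) k :=
      { e'.symm with commutes' := fun c ↦ rfl }
    have : Module.Flat (MvPolynomial (Fin n) k) (MvPolynomial (Fin (n + 1)) k) :=
      Module.Flat.of_linearEquiv e.symm.toLinearEquiv
    have : Module.Flat (MvPolynomial (Fin n) k) R :=
      Module.Flat.trans _ (MvPolynomial (Fin (n + 1)) k) _
    exact pdr_poly_step k e (ih R)

lemma pdr_etale (k : Type u) [CommRing k] (n : ℕ) (R : Type u) [CommRing R] [Algebra k R]
    [Algebra (MvPolynomial (Fin n) k) R] [IsScalarTower k (MvPolynomial (Fin n) k) R]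
    [Algebra.Etale (MvPolynomial (Fin n) k) R] :
    PDR (Algebra.TensorProduct.lmul' k (S := R)).toRingHom n := by
  have h := pdr_mvPoly k n R
  set A := MvPolynomial (Fin n) k
  let ψ : R ⊗[A] R →+* R := (Algebra.TensorProduct.lmul' A (S := R)).toRingHom
  have hc : ψ.comp (δ k A R) = (Algebra.TensorProduct.lmul' k (S := R)).toRingHom := by
    apply ringHom_ext_tmul <;> intro a <;> simp [ψ]
  rw [← hc]
  refine pdr_retract _ _ ?_ (Algebra.FormallyUnramified.elem A R)
    (Algebra.FormallyUnramified.lmul_elem) ?_ h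
  · intro r
    exact ⟨r ⊗ₜ 1, by simp [ψ]⟩
  · intro s hs
    have hs' : δ k A R s ∈ KaehlerDifferential.ideal A R := hs
    rw [← KaehlerDifferential.span_range_eq_ideal] at hs'
    generalize δ k A R s = w at hs'
    induction hs' using Submodule.span_induction with
    | mem x hx =>
      obtain ⟨r, rfl⟩ := hx
      exact Algebra.FormallyUnramified.one_tmul_sub_tmul_one_mul_elem r
    | zero => simp
    | add x y _ _ hx hy => rw [add_mul, hx, hy, add_zero]
    | smul a x _ hx => rw [smul_eq_mul, mul_assoc, hx, mul_zero]

end SmoothRes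

namespace SmoothRes
open CategoryTheory

section glue
variable {S T R R' : Type u} [CommRing S] [CommRing T] [CommRing R] [CommRing R']
  [Algebra S T] [Algebra S R] [Algebra S R'] [Algebra T R'] [Algebra R R']
  [IsScalarTower S T R'] [IsScalarTower S R R']

lemma pd_localized (g : S) [IsLocalization.Away g T] [IsLocalization.Away (algebraMap S R g) R']
    (m : Ideal S) [m.IsPrime] (hg : g ∉ m) {n : ℕ} (h : PD T n R') :
    HasProjectiveDimensionLE ((ModuleCat.of S R).localizedModule m.primeCompl) n := by
  have hle : Submonoid.powers g ≤ m.primeCompl := by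
    rw [Submonoid.powers_le]; exact hg
  let U := Localization m.primeCompl
  have hu : IsUnit (algebraMap S U g) := IsLocalization.map_units U (⟨g, hg⟩ : m.primeCompl)
  let : Algebra T U := (IsLocalization.Away.lift g hu).toAlgebra
  have : IsScalarTower S T U :=
    .of_algebraMap_eq fun s ↦ (IsLocalization.Away.lift_eq g hu s).symm
  have : IsLocalization (m.primeCompl.map (algebraMap S T)) U :=
    IsLocalization.isLocalization_of_submonoid_le T U _ _ hle
  have : Module.Flat T U := IsLocalization.flat U (m.primeCompl.map (algebraMap S T))
  have h1 : PD U n (U ⊗[T] R') := pd_baseChange n _ h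
  have hloc : IsLocalizedModule (Submonoid.powers g) (IsScalarTower.toAlgHom S R R').toLinearMap := by
    rw [isLocalizedModule_iff_isLocalization]
    have : Algebra.algebraMapSubmonoid R (Submonoid.powers g) =
        Submonoid.powers (algebraMap S R g) := by
      rw [Algebra.algebraMapSubmonoid, Submonoid.map_powers]
    rw [this]; infer_instance
  have hb1 : IsBaseChange T (IsScalarTower.toAlgHom S R R').toLinearMap :=
    (isLocalizedModule_iff_isBaseChange (Submonoid.powers g) T _).mp hloc
  have hb2 : IsBaseChange U (TensorProduct.mk T U R' 1) := TensorProduct.isBaseChange T R' U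
  have hb3 := hb1.comp hb2
  have hb4 : IsBaseChange U ((ModuleCat.of S R).localizedModuleMkLinearMap m.primeCompl) :=
    (isLocalizedModule_iff_isBaseChange m.primeCompl U _).mp
      (ModuleCat.localizedModule_isLocalizedModule (ModuleCat.of S R) m.primeCompl)
  exact pd_equiv (hb3.equiv.symm.trans hb4.equiv) h1

lemma pd_localized_zero (m : Ideal S) [m.IsPrime] (g : S) (hg : g ∉ m) (hg0 : algebraMap S R g = 0)
    (n : ℕ) : HasProjectiveDimensionLE ((ModuleCat.of S R).localizedModule m.primeCompl) n := by
  have : Subsingleton (LocalizedModule m.primeCompl R) := by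
    rw [LocalizedModule.subsingleton_iff]
    intro r
    exact ⟨g, hg, by rw [Algebra.smul_def, hg0, zero_mul]⟩
  have : Subsingleton ((ModuleCat.of S R).localizedModule m.primeCompl) :=
    (equivShrink (LocalizedModule m.primeCompl R)).symm.subsingleton
  have : HasProjectiveDimensionLT ((ModuleCat.of S R).localizedModule m.primeCompl) 0 :=
    (ModuleCat.isZero_of_subsingleton _).hasProjectiveDimensionLT_zero
  exact hasProjectiveDimensionLT_of_ge _ 0 (n + 1) (by omega)

end glue

lemma away_tensor (k R R' : Type u) [CommRing k] [CommRing R] [CommRing R'] [Algebra k R]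
    [Algebra k R'] [Algebra R R'] [IsScalarTower k R R'] (f : R) [IsLocalization.Away f R']
    [Algebra (R ⊗[k] R) (R' ⊗[k] R')]
    (H : algebraMap (R ⊗[k] R) (R' ⊗[k] R') = (Algebra.TensorProduct.map
      (IsScalarTower.toAlgHom k R R') (IsScalarTower.toAlgHom k R R')).toRingHom) :
    IsLocalization.Away ((f ⊗ₜ 1 : R ⊗[k] R) * (1 ⊗ₜ f : R ⊗[k] R)) (R' ⊗[k] R') := by
  let : Algebra (R ⊗[k] R) (R' ⊗[k] R) := (Algebra.TensorProduct.map
      (IsScalarTower.toAlgHom k R R') (AlgHom.id k R)).toRingHom.toAlgebra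
  let : Algebra (R' ⊗[k] R) (R' ⊗[k] R') := (Algebra.TensorProduct.map
      (AlgHom.id k R') (IsScalarTower.toAlgHom k R R')).toRingHom.toAlgebra
  have : IsScalarTower (R ⊗[k] R) (R' ⊗[k] R) (R' ⊗[k] R') := by
    refine .of_algebraMap_eq' ?_
    rw [H]
    apply ringHom_ext_tmul <;> intro a <;> simp [RingHom.algebraMap_toAlgebra]
  have : IsScalarTower R (R ⊗[k] R) (R' ⊗[k] R) := by
    refine .of_algebraMap_eq fun a ↦ ?_
    simp [RingHom.algebraMap_toAlgebra, Algebra.TensorProduct.algebraMap_apply]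
  have : IsScalarTower R' (R' ⊗[k] R) (R' ⊗[k] R') := by
    refine .of_algebraMap_eq fun a ↦ ?_
    simp [RingHom.algebraMap_toAlgebra, Algebra.TensorProduct.algebraMap_apply]
  have h1 : IsLocalization.Away (f ⊗ₜ 1 : R ⊗[k] R) (R' ⊗[k] R) := by
    have := IsLocalization.tensorProduct_tensorProduct k R (Submonoid.powers f) R' (by
      ext a; simp [RingHom.algebraMap_toAlgebra])
    rw [Algebra.algebraMapSubmonoid, Submonoid.map_powers] at this
    exact this
  have h2 : IsLocalization.Away (algebraMap (R ⊗[k] R) (R' ⊗[k] R) (1 ⊗ₜ f)) (R' ⊗[k] R') := by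
    have := IsLocalization.tensorProduct_tensorProduct_right k R' (Submonoid.powers f) R' (by
      ext a; simp [RingHom.algebraMap_toAlgebra])
    rw [Submonoid.map_powers] at this
    have e : algebraMap (R ⊗[k] R) (R' ⊗[k] R) (1 ⊗ₜ f) = 1 ⊗ₜ f := by
      simp [RingHom.algebraMap_toAlgebra]
    rw [e]
    exact this
  exact IsLocalization.Away.mul' (R' ⊗[k] R) _ _ _

/-- the local statement -/
lemma exists_local (k R : Type u) [Field k] [CommRing R] [Algebra k R] [Algebra.Smooth k R]
    (p : Ideal R) [p.IsPrime] :
    ∃ f ∉ p, ∃ n : ℕ,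
      PDR (Algebra.TensorProduct.lmul' k (S := Localization.Away f)).toRingHom n := by
  obtain ⟨f, hf, n, _, _, _⟩ := Algebra.IsSmoothAt.exists_isStandardEtale_mvPolynomial
    (R := k) (S := R) (p := p)
  exact ⟨f, hf, n, pdr_etale k n _⟩

lemma local_step (k R R' : Type u) [Field k] [CommRing R] [CommRing R'] [Algebra k R]
    [Algebra k R'] [Algebra R R'] [IsScalarTower k R R'] [Algebra (R ⊗[k] R) R]
    (H : algebraMap (R ⊗[k] R) R = (Algebra.TensorProduct.lmul' k (S := R)).toRingHom)
    (x : R) [IsLocalization.Away x R'] (m : Ideal (R ⊗[k] R)) [hmp : m.IsPrime]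
    (hxm : (x ⊗ₜ 1 : R ⊗[k] R) ∉ m) (hxm' : (1 ⊗ₜ x : R ⊗[k] R) ∉ m) {n : ℕ}
    (hn' : PDR (Algebra.TensorProduct.lmul' k (S := R')).toRingHom n) :
    HasProjectiveDimensionLE ((ModuleCat.of (R ⊗[k] R) R).localizedModule m.primeCompl) n := by
  let : Algebra (R ⊗[k] R) (R' ⊗[k] R') := (Algebra.TensorProduct.map
    (IsScalarTower.toAlgHom k R R') (IsScalarTower.toAlgHom k R R')).toRingHom.toAlgebra
  let : Algebra (R' ⊗[k] R') R' := (Algebra.TensorProduct.lmul' k (S := R')).toRingHom.toAlgebra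
  let : Algebra (R ⊗[k] R) R' :=
    ((algebraMap R R').comp (algebraMap (R ⊗[k] R) R)).toAlgebra
  have : IsScalarTower (R ⊗[k] R) R R' := .of_algebraMap_eq' rfl
  have hst : @IsScalarTower (R ⊗[k] R) (R' ⊗[k] R') R' Algebra.toSMul Algebra.toSMul
      Algebra.toSMul := by
    refine IsScalarTower.of_algebraMap_eq' (R := R ⊗[k] R) (S := R' ⊗[k] R') (A := R') ?_
    apply ringHom_ext_tmul <;> intro a <;> simp [RingHom.algebraMap_toAlgebra, H]
  have := away_tensor k R R' x rfl
  have : IsLocalization.Away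
      (algebraMap (R ⊗[k] R) R ((x ⊗ₜ 1 : R ⊗[k] R) * (1 ⊗ₜ x : R ⊗[k] R))) R' := by
    have e : algebraMap (R ⊗[k] R) R ((x ⊗ₜ 1 : R ⊗[k] R) * (1 ⊗ₜ x : R ⊗[k] R)) = x * x := by
      simp [RingHom.algebraMap_toAlgebra, H]
    rw [e]
    have : IsLocalization.Away (algebraMap R R' x) R' :=
      IsLocalization.away_of_isUnit_of_bijective _
        (IsLocalization.Away.algebraMap_isUnit x) Function.bijective_id
    exact IsLocalization.Away.mul' R' _ _ _
  exact pd_localized (T := R' ⊗[k] R') (R' := R') _ m (hmp.mul_notMem hxm hxm') hn'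

lemma main_pd (k R : Type u) [Field k] [CommRing R] [Algebra k R] [Algebra.Smooth k R]
    [IsNoetherianRing (R ⊗[k] R)] :
    ∃ n, PDR (Algebra.TensorProduct.lmul' k (S := R)).toRingHom n := by
  choose f hf n hn using fun p : PrimeSpectrum R ↦ exists_local k R p.asIdeal
  have hspan : Ideal.span (Set.range f) = ⊤ := by
    by_contra hne
    obtain ⟨M, hM, hle⟩ := Ideal.exists_le_maximal _ hne
    exact hf ⟨M, hM.isPrime⟩ (hle (Ideal.subset_span ⟨_, rfl⟩))
  obtain ⟨t, ht, ht'⟩ := (Ideal.span_eq_top_iff_finite _).mp hspan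
  classical
  have hex : ∀ x ∈ t, ∃ n : ℕ,
      PDR (Algebra.TensorProduct.lmul' k (S := Localization.Away x)).toRingHom n := by
    intro x hx
    obtain ⟨p, rfl⟩ := ht hx
    exact ⟨n p, hn p⟩
  choose! ν hν using hex
  refine ⟨t.sup ν, ?_⟩
  let : Algebra (R ⊗[k] R) R := (Algebra.TensorProduct.lmul' k (S := R)).toRingHom.toAlgebra
  have hsurj : Function.Surjective (algebraMap (R ⊗[k] R) R) := fun r ↦
    ⟨r ⊗ₜ 1, by simp [RingHom.algebraMap_toAlgebra]⟩
  have : Module.Finite (R ⊗[k] R) R := Module.Finite.of_surjective (Algebra.linearMap _ _) hsurj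
  change PD (R ⊗[k] R) _ R
  have : Module.Finite (R ⊗[k] R) (ModuleCat.of (R ⊗[k] R) R) := this
  rw [PD, ModuleCat.hasProjectiveDimensionLE_iff_forall_maximalSpectrum]
  intro m
  have hmp : m.asIdeal.IsPrime := m.isMaximal.isPrime
  by_cases hm : RingHom.ker (algebraMap (R ⊗[k] R) R) ≤ m.asIdeal
  · have hdiff : ∀ x : R, (x ⊗ₜ 1 - 1 ⊗ₜ x : R ⊗[k] R) ∈ m.asIdeal := fun x ↦
      hm (by simp [RingHom.mem_ker, RingHom.algebraMap_toAlgebra])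
    have hex : ∃ x ∈ t, (x ⊗ₜ 1 : R ⊗[k] R) ∉ m.asIdeal := by
      by_contra! hcon
      have hle : Ideal.span (t : Set R) ≤ m.asIdeal.comap
          (Algebra.TensorProduct.includeLeftRingHom : R →+* R ⊗[k] R) :=
        Ideal.span_le.mpr fun x hx ↦ hcon x hx
      rw [ht', top_le_iff, Ideal.comap_eq_top_iff] at hle
      exact hmp.ne_top hle
    obtain ⟨x, hx, hxm⟩ := hex
    have hxm' : (1 ⊗ₜ x : R ⊗[k] R) ∉ m.asIdeal := fun h ↦ hxm (by
      have := add_mem (hdiff x) h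
      rwa [sub_add_cancel] at this)
    have hn' := hν x hx
    suffices HasProjectiveDimensionLT
        ((ModuleCat.of (R ⊗[k] R) R).localizedModule m.asIdeal.primeCompl) (ν x + 1) from
      hasProjectiveDimensionLT_of_ge _ (ν x + 1) _ (Nat.succ_le_succ (Finset.le_sup hx))
    exact local_step k R (Localization.Away x) rfl x m.asIdeal hxm hxm' hn'
  · obtain ⟨g, hg, hgm⟩ := SetLike.not_le_iff_exists.mp hm
    exact pd_localized_zero m.asIdeal g hgm hg _

end SmoothRes

/-- Let `k` be a field and `R` a finitely generated commutative `k`-algebra that is smooth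
over `k`. Then `R`, regarded as a module over `R ⊗[k] R` via the multiplication map, admits
a finite resolution `0 → P_n → ⋯ → P_0 → R → 0` in which every `P_i` is a finitely generated
projective `R ⊗[k] R`-module. -/
theorem exists_fg_projective_resolution_of_smooth
    (k : Type u) (R : Type u) [Field k] [CommRing R] [Algebra k R]
    (hfg : Algebra.FiniteType k R) (hsm : Algebra.Smooth k R) :
    ∃ n : ℕ, @FGProjDimLE (R ⊗[k] R) _ n R _
      ((Algebra.TensorProduct.lmul' k (S := R)).toRingHom.toModule) := by
  have : Algebra.FiniteType k (R ⊗[k] R) := 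
    Algebra.FiniteType.trans hfg (inferInstance : Algebra.FiniteType R (R ⊗[k] R))
  have : IsNoetherianRing (R ⊗[k] R) := Algebra.FiniteType.isNoetherianRing k _
  obtain ⟨n, hn⟩ := SmoothRes.main_pd k R
  refine ⟨n, ?_⟩
  let := (Algebra.TensorProduct.lmul' k (S := R)).toRingHom.toModule
  have : Module.Finite (R ⊗[k] R) R := by
    let g : (R ⊗[k] R) →ₗ[R ⊗[k] R] R :=
      { toFun := Algebra.TensorProduct.lmul' k (S := R)
        map_add' := map_add _
        map_smul' := fun s y ↦ map_mul _ s y }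
    exact Module.Finite.of_surjective g fun r ↦ ⟨r ⊗ₜ 1, by simp [g]⟩
  exact SmoothRes.fg_of_pd n R hn
end

section
/- Let k be a field, R a commutative k-algebra, and n ∈ ℕ. If R, regarded as a module over R ⊗_k R via the multiplication map, has projective dimension at most n, then every R-module M has projective dimension at most n over R. -/
universe u v

open TensorProduct

theorem ProjDimLE.congr_equiv (S : Type v) [Ring S] : ∀ (n : ℕ) (M N : Type u) [AddCommGroup M]
    [AddCommGroup N] [Module S M] [Module S N] (_ : M ≃ₗ[S] N), ProjDimLE S n M → ProjDimLE S n N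
  | 0, M, N, _, _, _, _, e, h => by
      have h : Module.Projective S M := h
      exact Module.Projective.of_equiv e
  | n + 1, M, N, _, _, _, _, e, h => by
      obtain ⟨P, i1, i2, f, hP, hf, hk⟩ := h
      refine ⟨P, i1, i2, e.toLinearMap ∘ₗ f, hP, e.surjective.comp hf, ?_⟩
      refine ProjDimLE.congr_equiv S n _ _ (LinearEquiv.ofEq _ _ ?_) hk
      ext x; simp

theorem smulComm_aux (R S T X : Type u) [CommRing R] [CommRing S] [CommRing T] [Algebra R S]
    [Algebra T S] [AddCommGroup X] [Module S X] [Module R X] [Module T X] [IsScalarTower R S X]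
    [IsScalarTower T S X] : SMulCommClass R T X := by
  constructor
  intro r t x
  rw [← algebraMap_smul S r (t • x), ← algebraMap_smul S t x, ← algebraMap_smul S r x,
    ← algebraMap_smul S t, smul_comm]

theorem finsupp_proj_aux (T N X : Type u) [CommRing T] [AddCommGroup N] [Module T N]
    (h : Module.Projective T N) : Module.Projective T (X →₀ N) := by
  classical
  exact Module.Projective.of_equiv (finsuppLEquivDirectSum T N X).symm

theorem proj_aux (R S T M X : Type u) [CommRing R] [CommRing S] [CommRing T] [Algebra R S]
    [Algebra T S] [AddCommGroup M] [Module R M] [SMulCommClass R T S]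
    (hS : Module.Projective T (S ⊗[R] M))
    [AddCommGroup X] [Module S X] [Module R X] [Module T X] [IsScalarTower R S X]
    [IsScalarTower T S X] [SMulCommClass R T X] (h : Module.Projective S X) :
    Module.Projective T (X ⊗[R] M) := by
  obtain ⟨s, hs⟩ := h.out
  have hs' : ∀ x, Finsupp.linearCombination S id (s x) = x := hs
  classical
  let e : (X →₀ S) ⊗[R] M ≃ₗ[T] (X →₀ (S ⊗[R] M)) :=
    (TensorProduct.finsuppLeft R S S M X).restrictScalars T
  have : Module.Projective T (X →₀ (S ⊗[R] M)) := finsupp_proj_aux T _ X hS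
  have : Module.Projective T ((X →₀ S) ⊗[R] M) := Module.Projective.of_equiv e.symm
  have hsR : ∀ (r : R) (x : X), s (r • x) = r • s x := fun r x => by
    rw [← algebraMap_smul S r x, map_smul, algebraMap_smul]
  have hsT : ∀ (r : T) (x : X), s (r • x) = r • s x := fun r x => by
    rw [← algebraMap_smul S r x, map_smul, algebraMap_smul]
  let sR : X →ₗ[R] (X →₀ S) := s.restrictScalars R
  let pR : (X →₀ S) →ₗ[R] X := (Finsupp.linearCombination S id).restrictScalars R
  let i : X ⊗[R] M →ₗ[T] (X →₀ S) ⊗[R] M :=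
    { toFun := sR.rTensor M
      map_add' := map_add _
      map_smul' := by
        intro t x
        induction x with
        | zero => simp
        | add x y hx hy => rw [smul_add, map_add, hx, hy, map_add, smul_add]
        | tmul x m => simp [TensorProduct.smul_tmul', sR, hsT] }
  let p : (X →₀ S) ⊗[R] M →ₗ[T] X ⊗[R] M :=
    { toFun := pR.rTensor M
      map_add' := map_add _
      map_smul' := by
        intro t x
        induction x with
        | zero => simp
        | add x y hx hy => rw [smul_add, map_add, hx, hy, map_add, smul_add]
        | tmul x m =>
          have : pR (t • x) = t • pR x := by
            rw [← algebraMap_smul S t x]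
            change Finsupp.linearCombination S id _ = _
            rw [map_smul, algebraMap_smul]; rfl
          simp [TensorProduct.smul_tmul', this] }
  refine Module.Projective.of_split i p ?_
  ext x
  induction x with
  | zero => simp
  | add x y hx hy => rw [map_add, hx, hy, map_add]
  | tmul x m =>
    change (pR (sR x)) ⊗ₜ[R] m = x ⊗ₜ m
    congr 1
    exact hs' x

theorem main_aux (R S T M : Type u) [CommRing R] [CommRing S] [CommRing T] [Algebra R S]
    [Algebra T S] [AddCommGroup M] [Module R M] [SMulCommClass R T S]
    (hS : Module.Projective T (S ⊗[R] M)) (hSR : Module.Projective R S) :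
    ∀ (n : ℕ) (X : Type u)
    [AddCommGroup X] [Module S X] [Module R X] [Module T X] [IsScalarTower R S X]
    [IsScalarTower T S X] [SMulCommClass R T X] (_ : Module.Projective R X),
    ProjDimLE S n X → ProjDimLE T n (X ⊗[R] M) := by
  intro n
  induction n with
  | zero =>
    intro X _ _ _ _ _ _ _ _ h
    exact proj_aux R S T M X hS h
  | succ n ih =>
    intro X _ _ _ _ _ _ _ hX h
    obtain ⟨P, i1, i2, f, hP, hf, hk⟩ := h
    let : Module R P := Module.compHom P (algebraMap R S)
    let : Module T P := Module.compHom P (algebraMap T S)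
    have : IsScalarTower R S P := IsScalarTower.of_algebraMap_smul fun _ _ => rfl
    have : IsScalarTower T S P := IsScalarTower.of_algebraMap_smul fun _ _ => rfl
    have : SMulCommClass R T P := smulComm_aux R S T P
    have : SMulCommClass R T (LinearMap.ker f) := smulComm_aux R S T _
    have hPR : Module.Projective R P := by
      obtain ⟨s, hs⟩ := hP.out
      have : Module.Projective R (P →₀ S) := finsupp_proj_aux R _ P hSR
      refine Module.Projective.of_split (s.restrictScalars R)
        ((Finsupp.linearCombination S id).restrictScalars R) ?_
      ext x
      exact hs x
    let fR : P →ₗ[R] X := f.restrictScalars R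
    obtain ⟨g, hg⟩ := Module.projective_lifting_property fR LinearMap.id hf
    have hg' : ∀ x, f (g x) = x := fun x => LinearMap.congr_fun hg x
    let ι : LinearMap.ker f →ₗ[R] P := (LinearMap.ker f).subtype.restrictScalars R
    let ρ : P →ₗ[R] LinearMap.ker f :=
      { toFun := fun x => ⟨x - g (f x), by simp [hg']⟩
        map_add' := fun x y => by
          ext; simp; abel
        map_smul' := fun r x => by
          ext
          have : f (r • x) = r • f x := fR.map_smul r x
          simp [this, smul_sub] }
    have hρ : ρ ∘ₗ ι = LinearMap.id := by
      ext ⟨x, hx⟩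
      have hx' : f x = 0 := hx
      simp [ρ, ι, hx']
    have hK : Module.Projective R (LinearMap.ker f) := Module.Projective.of_split ι ρ hρ
    have hIH := ih (LinearMap.ker f) hK hk
    have hex : Function.Exact (ι.rTensor M) (fR.rTensor M) := by
      have h0 : Function.Exact ι fR := by
        intro x
        simp [fR, ι]
      exact rTensor_exact M h0 hf
    have hfT : ∀ (t : T) (x : P), f (t • x) = t • f x := fun t x => by
      rw [← algebraMap_smul S t x, map_smul, algebraMap_smul]
    let F : P ⊗[R] M →ₗ[T] X ⊗[R] M :=
      { toFun := fR.rTensor M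
        map_add' := map_add _
        map_smul' := by
          intro t x
          induction x with
          | zero => simp
          | add x y hx hy => rw [smul_add, map_add, hx, hy, map_add, smul_add]
          | tmul x m => simp [TensorProduct.smul_tmul', fR, hfT] }
    let I : LinearMap.ker f ⊗[R] M →ₗ[T] P ⊗[R] M :=
      { toFun := ι.rTensor M
        map_add' := map_add _
        map_smul' := by
          intro t x
          induction x with
          | zero => simp
          | add x y hx hy => rw [smul_add, map_add, hx, hy, map_add, smul_add]
          | tmul x m => simp [TensorProduct.smul_tmul', ι] }
    have hI : Function.Injective I := by
      apply Function.LeftInverse.injective (g := ρ.rTensor M)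
      intro x
      change ρ.rTensor M (ι.rTensor M x) = x
      rw [← LinearMap.comp_apply, ← LinearMap.rTensor_comp, hρ]
      simp
    refine ⟨P ⊗[R] M, inferInstance, inferInstance, F, proj_aux R S T M P hS hP,
      LinearMap.rTensor_surjective M hf, ?_⟩
    have hr : LinearMap.range I = LinearMap.ker F := by
      ext x
      exact (hex x).symm
    exact ProjDimLE.congr_equiv T n _ _ ((LinearEquiv.ofInjective I hI).trans
      (LinearEquiv.ofEq _ _ hr)) hIH

theorem env_aux (k R T M : Type u) [Field k] [CommRing R] [CommRing T] [Algebra k R] [Algebra k T]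
    [AddCommGroup M] [Module R M] :
    letI : Algebra T (R ⊗[k] T) := Algebra.TensorProduct.rightAlgebra
    ∃ _ : SMulCommClass R T (R ⊗[k] T), Module.Projective T ((R ⊗[k] T) ⊗[R] M) := by
  let : Algebra T (R ⊗[k] T) := Algebra.TensorProduct.rightAlgebra
  have : SMulCommClass R T (R ⊗[k] T) := smulComm_aux R (R ⊗[k] T) T (R ⊗[k] T)
  refine ⟨this, ?_⟩
  let : Module k M := Module.compHom M (algebraMap k R)
  have : IsScalarTower k R M := IsScalarTower.of_algebraMap_smul fun _ _ => rfl
  let e : (R ⊗[k] T) ⊗[R] M ≃+ T ⊗[k] M :=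
    ((TensorProduct.comm R (R ⊗[k] T) M).toAddEquiv.trans
      (TensorProduct.AlgebraTensorModule.cancelBaseChange k R R M T).toAddEquiv).trans
      (TensorProduct.comm k M T).toAddEquiv
  have he : ∀ r t m, e ((r ⊗ₜ t) ⊗ₜ m) = t ⊗ₜ (r • m) := fun r t m => by
    simp [e]
  let E : (R ⊗[k] T) ⊗[R] M ≃ₗ[T] T ⊗[k] M :=
    { e with
      map_smul' := by
        intro t x
        change e (t • x) = t • e x
        induction x with
        | zero => simp
        | add x y hx hy => rw [smul_add, map_add, hx, hy, map_add, smul_add]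
        | tmul x m =>
          induction x with
          | zero => simp
          | add x y hx hy =>
            rw [TensorProduct.add_tmul, smul_add, map_add, hx, hy, map_add, smul_add]
          | tmul r s =>
            have : t • (r ⊗ₜ[k] s) = r ⊗ₜ[k] (t * s) := by
              rw [Algebra.smul_def, Algebra.TensorProduct.right_algebraMap_apply]; simp
            rw [TensorProduct.smul_tmul', this, he, he, TensorProduct.smul_tmul', smul_eq_mul] }
  exact Module.Projective.of_equiv E.symm

/-- Let `k` be a field, `R` a commutative `k`-algebra, and `n ∈ ℕ`. If `R`, regarded as a
module over `R ⊗[k] R` via the multiplication map, has projective dimension at most `n`,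
then every `R`-module `M` has projective dimension at most `n` over `R`. -/
theorem projDimLE_of_projDimLE_over_enveloping
    (k : Type u) (R : Type u) [Field k] [CommRing R] [Algebra k R] (n : ℕ)
    (h : @ProjDimLE (R ⊗[k] R) _ n R _
      ((Algebra.TensorProduct.lmul' k (S := R)).toRingHom.toModule))
    (M : Type u) [AddCommGroup M] [Module R M] :
    ProjDimLE R n M := by
  obtain ⟨hc, hp⟩ := env_aux k R R M
  let mS : Module (R ⊗[k] R) R := (Algebra.TensorProduct.lmul' k (S := R)).toRingHom.toModule
  have hsm : ∀ (s : R ⊗[k] R) (x : R), s • x = Algebra.TensorProduct.lmul' k (S := R) s * x :=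
    fun _ _ => rfl
  have t1 : IsScalarTower R (R ⊗[k] R) R := IsScalarTower.of_algebraMap_smul fun r x => by
    rw [hsm]; simp
  have t2 : @IsScalarTower R (R ⊗[k] R) R
      (Algebra.TensorProduct.rightAlgebra (R := k) (A := R) (B := R)).toSMul _ _ :=
    @IsScalarTower.of_algebraMap_smul R (R ⊗[k] R) R _ _
      Algebra.TensorProduct.rightAlgebra _ _ fun r x => by
        rw [hsm, Algebra.TensorProduct.right_algebraMap_apply]; simp
  have := @main_aux R (R ⊗[k] R) R M _ _ _ _ Algebra.TensorProduct.rightAlgebra _ _ hc hp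
    inferInstance n R _ _ _ _ t1 t2 _ inferInstance h
  exact ProjDimLE.congr_equiv R n _ _ (TensorProduct.lid R M) this
end

section
/- Let k be a field and R a finitely generated commutative k-algebra. If R, regarded as a module over R ⊗_k R via the multiplication map, has finite projective dimension, then R is regular, i.e., for every prime ideal 𝔭 of R the localization R_𝔭 is a regular local ring. -/
universe u v

open TensorProduct

/-- A commutative ring is a regular local ring if it is Noetherian, local, and its maximal
ideal can be generated by `d` elements, where `d` is the Krull dimension of the ring. -/
def IsRegularLocal (A : Type u) [CommRing A] : Prop :=
  IsNoetherianRing A ∧ IsLocalRing A ∧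
    ∃ (s : Finset A) (_ : IsLocalRing A),
      Ideal.span (s : Set A) = IsLocalRing.maximalIdeal A ∧
        (s.card : WithBot ℕ∞) = ringKrullDim A

open IsLocalRing in
theorem aux_cover (A : Type u) [CommRing A] [IsLocalRing A] [IsNoetherianRing A]
    (a : A) (ham : ∀ b ∈ maximalIdeal A, a * b = 0)
    (M : Type u) [AddCommGroup M] [Module A M] [Module.Finite A M] :
    ∃ (F : Type u) (_ : AddCommGroup F) (_ : Module A F) (_ : Module.Free A F)
      (_ : Module.Finite A F) (g : F →ₗ[A] M),
      Function.Surjective g ∧ ∀ c ∈ LinearMap.ker g, a • c = 0 := by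
  let ι := Module.Free.ChooseBasisIndex (ResidueField A) (ResidueField A ⊗[A] M)
  let b : Module.Basis ι _ _ := Module.Free.chooseBasis (ResidueField A) (ResidueField A ⊗[A] M)
  have hs : ∀ y : ResidueField A ⊗[A] M, ∃ m : M, (1 : ResidueField A) ⊗ₜ[A] m = y :=
    TensorProduct.mk_surjective A M (ResidueField A) residue_surjective
  choose f hf using fun i => hs (b i)
  let F := ι →₀ A
  let g : F →ₗ[A] M := Finsupp.linearCombination A f
  have hg : Function.Surjective g := by
    rw [← LinearMap.range_eq_top, Finsupp.range_linearCombination]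
    exact span_eq_top_of_tmul_eq_basis f b hf
  have hk0 : ∀ c ∈ LinearMap.ker g, a • c = 0 := by
    intro c hc
    ext i
    simp only [Finsupp.smul_apply, smul_eq_mul, Finsupp.zero_apply]
    apply ham
    rw [← residue_eq_zero_iff]
    have hc' : Finsupp.linearCombination A f c = 0 := hc
    have h2 : (1 : ResidueField A) ⊗ₜ[A] (Finsupp.linearCombination A f c) = 0 := by
      rw [hc']; simp
    rw [Finsupp.linearCombination_apply, Finsupp.sum, TensorProduct.tmul_sum] at h2
    have h3 : ∑ j ∈ c.support, (residue A (c j)) • b j = 0 := by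
      rw [← h2]
      refine Finset.sum_congr rfl fun j _ => ?_
      rw [← hf, TensorProduct.tmul_smul]
      rfl
    by_cases hi : i ∈ c.support
    · exact linearIndependent_iff'.mp b.linearIndependent _ _ h3 i hi
    · simp [Finsupp.notMem_support_iff.mp hi]
  exact ⟨F, inferInstance, inferInstance, inferInstance, inferInstance, g, hg, hk0⟩

open CategoryTheory IsLocalRing in
theorem aux_free (A : Type u) [CommRing A] [IsLocalRing A] [IsNoetherianRing A]
    (a : A) (ha : a ≠ 0) (ham : ∀ b ∈ maximalIdeal A, a * b = 0) (n : ℕ)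
    (M : Type u) [AddCommGroup M] [Module A M] [Module.Finite A M]
    (h : HasProjectiveDimensionLE (ModuleCat.of A M) n) : Module.Free A M := by
  induction n generalizing M with
  | zero =>
    have : Projective (ModuleCat.of A M) := (projective_iff_hasProjectiveDimensionLE_zero _).mpr h
    have : Module.Projective A M := (IsProjective.iff_projective (R := A) M).mpr this
    exact Module.free_of_flat_of_isLocalRing
  | succ n ih =>
    obtain ⟨F, _, _, _, _, g, hg, hk0⟩ := aux_cover A a ham M
    have hS := LinearMap.shortExact_shortComplexKer hg
    have hp : Projective (ModuleCat.of A F) :=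
      (IsProjective.iff_projective (R := A) F).mp inferInstance
    have hK := (hS.hasProjectiveDimensionLT_X₃_iff n hp).mp h
    have hfree : Module.Free A (LinearMap.ker g) := ih _ hK
    have hsub : Subsingleton (LinearMap.ker g) := by
      by_contra hns
      have : Nontrivial (LinearMap.ker g) := not_subsingleton_iff_nontrivial.mp hns
      have hann : a ∈ Module.annihilator A (LinearMap.ker g) := by
        rw [Module.mem_annihilator]
        rintro ⟨c, hc⟩
        exact Subtype.ext (hk0 c hc)
      have hb : Module.annihilator A (LinearMap.ker g) = ⊥ := Module.annihilator_eq_bot.mpr inferInstance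
      rw [hb] at hann
      exact ha hann
    have hinj : Function.Injective g := by
      rw [← LinearMap.ker_eq_bot]
      exact Submodule.subsingleton_iff_eq_bot.mp hsub
    exact Module.Free.of_equiv (LinearEquiv.ofBijective g ⟨hinj, hg⟩)

open CategoryTheory IsLocalRing in
theorem aux_quot (A : Type u) [CommRing A] (x : A) (hx : IsSMulRegular A x) (n : ℕ)
    (M : Type u) [AddCommGroup M] [Module A M] (hM : IsSMulRegular M x)
    (h : HasProjectiveDimensionLE (ModuleCat.of A M) n) :
    HasProjectiveDimensionLE (ModuleCat.of (A ⧸ Ideal.span {x}) ((A ⧸ Ideal.span {x}) ⊗[A] M)) n := by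
  induction n generalizing M with
  | zero =>
    have : Projective (ModuleCat.of A M) := (projective_iff_hasProjectiveDimensionLE_zero _).mpr h
    have : Module.Projective A M := (IsProjective.iff_projective (R := A) M).mpr this
    exact (projective_iff_hasProjectiveDimensionLE_zero _).mp
      ((IsProjective.iff_projective _).mp inferInstance)
  | succ n ih =>
    obtain ⟨F, _, _, _, hF, g, hg⟩ : ∃ (F : Type u) (_ : AddCommGroup F) (_ : Module A F)
        (_ : Module.Free A F) (_ : IsSMulRegular F x) (g : F →ₗ[A] M), Function.Surjective g :=
      ⟨M →₀ A, inferInstance, inferInstance, inferInstance, by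
        intro c d hcd
        ext i
        exact hx (DFunLike.congr_fun hcd i),
        Finsupp.linearCombination A id, Finsupp.linearCombination_id_surjective A M⟩
    have hS := LinearMap.shortExact_shortComplexKer hg
    have hp : Projective (ModuleCat.of A F) :=
      (IsProjective.iff_projective (R := A) F).mp inferInstance
    have hK := (hS.hasProjectiveDimensionLT_X₃_iff n hp).mp h
    have hKr : IsSMulRegular (LinearMap.ker g) x := by
      intro c d hcd
      exact Subtype.ext (hF (congrArg Subtype.val hcd))
    have hB := ih (LinearMap.ker g) hKr hK
    let B := A ⧸ Ideal.span {x}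
    let f' : B ⊗[A] (LinearMap.ker g) →ₗ[B] B ⊗[A] F := (LinearMap.ker g).subtype.baseChange B
    let g' : B ⊗[A] F →ₗ[B] B ⊗[A] M := g.baseChange B
    have hg' : Function.Surjective g' := LinearMap.lTensor_surjective B hg
    have hex : Function.Exact f' g' := by
      have h0 : Function.Exact (LinearMap.ker g).subtype g := LinearMap.exact_subtype_ker_map g
      exact lTensor_exact B h0 hg
    have hinj : Function.Injective f' := by
      rw [injective_iff_map_eq_zero]
      intro z hz
      obtain ⟨⟨k, hk⟩, rfl⟩ := TensorProduct.mk_surjective A _ B Ideal.Quotient.mk_surjective z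
      have hz' : (1 : B) ⊗ₜ[A] k = 0 := hz
      have h1 := congrArg (TensorProduct.quotTensorEquivQuotSMul F (Ideal.span {x})) hz'
      have h2 : (1 : B) = Ideal.Quotient.mk _ (1 : A) := rfl
      rw [h2, map_zero, TensorProduct.quotTensorEquivQuotSMul_mk_tmul, one_smul,
        Submodule.Quotient.mk_eq_zero, Submodule.ideal_span_singleton_smul] at h1
      obtain ⟨p, -, hp⟩ := h1
      have hp' : x • p = k := hp
      have hpk : p ∈ LinearMap.ker g := by
        rw [LinearMap.mem_ker]
        apply hM
        simp only [smul_zero]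
        rw [← map_smul, hp']
        exact hk
      have : (⟨k, hk⟩ : LinearMap.ker g) = x • ⟨p, hpk⟩ := Subtype.ext hp'.symm
      rw [this]
      show (1 : B) ⊗ₜ[A] (x • (⟨p, hpk⟩ : LinearMap.ker g)) = 0
      rw [← TensorProduct.smul_tmul]
      have : x • (1 : B) = 0 := by
        rw [Algebra.smul_def, mul_one]
        exact Ideal.Quotient.eq_zero_iff_mem.mpr (Ideal.mem_span_singleton_self x)
      rw [this, TensorProduct.zero_tmul]
    let T : ShortComplex (ModuleCat.{u} B) := ShortComplex.mk (ModuleCat.ofHom f') (ModuleCat.ofHom g')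
      (by ext1; exact hex.linearMap_comp_eq_zero)
    have hT : T.ShortExact :=
      { exact := (ShortComplex.ShortExact.moduleCat_exact_iff_function_exact T).mpr hex
        mono_f := (ModuleCat.mono_iff_injective _).mpr hinj
        epi_g := (ModuleCat.epi_iff_surjective _).mpr hg' }
    have hp2 : Projective T.X₂ := (IsProjective.iff_projective (R := B) (B ⊗[A] F)).mp inferInstance
    exact (hT.hasProjectiveDimensionLT_X₃_iff n hp2).mpr hB


open CategoryTheory IsLocalRing in
theorem aux_step (A : Type u) [CommRing A] [IsLocalRing A] [IsNoetherianRing A]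
    (x : A) (hx : IsSMulRegular A x) (hxm : x ∈ maximalIdeal A) (hx2 : x ∉ maximalIdeal A ^ 2)
    [IsLocalRing (A ⧸ Ideal.span {x})] (n : ℕ)
    (h : HasProjectiveDimensionLE (ModuleCat.of A (A ⧸ maximalIdeal A)) n) :
    HasProjectiveDimensionLE (ModuleCat.of (A ⧸ Ideal.span {x})
      ((A ⧸ Ideal.span {x}) ⧸ maximalIdeal (A ⧸ Ideal.span {x}))) n := by
  let B := A ⧸ Ideal.span {x}
  let m := maximalIdeal A
  have hloc : IsLocalHom (algebraMap A B) :=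
    IsLocalHom.of_surjective (algebraMap A B) Ideal.Quotient.mk_surjective
  have hmm : ∀ a : A, a ∈ m ↔ algebraMap A B a ∈ maximalIdeal B := by
    intro a
    rw [mem_maximalIdeal, mem_maximalIdeal, mem_nonunits_iff, mem_nonunits_iff, isUnit_map_iff]
  have hm : HasProjectiveDimensionLE (ModuleCat.of A m) n := by
    have hsurj : Function.Surjective (Submodule.mkQ m) := Submodule.mkQ_surjective m
    let T : ShortComplex (ModuleCat.{u} A) := ShortComplex.mk (ModuleCat.ofHom m.subtype)
      (ModuleCat.ofHom (Submodule.mkQ m)) (by ext1; exact (LinearMap.exact_subtype_mkQ m).linearMap_comp_eq_zero)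
    have hT : T.ShortExact :=
      { exact := (ShortComplex.ShortExact.moduleCat_exact_iff_function_exact T).mpr (LinearMap.exact_subtype_mkQ m)
        mono_f := (ModuleCat.mono_iff_injective _).mpr m.subtype_injective
        epi_g := (ModuleCat.epi_iff_surjective _).mpr hsurj }
    have hp : Projective (ModuleCat.of A A) :=
      (IsProjective.iff_projective (R := A) A).mp inferInstance
    have h' : HasProjectiveDimensionLT (ModuleCat.of A (A ⧸ m)) (n + 1) := h
    refine hT.hasProjectiveDimensionLT_X₁ (n + 1) ?_ ?_
    · exact hasProjectiveDimensionLT_of_ge (ModuleCat.of A A) 1 (n + 1) (by omega)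
    · exact hasProjectiveDimensionLT_of_ge (ModuleCat.of A (A ⧸ m)) (n + 1) (n + 1 + 1) (by omega)
  have hmr : IsSMulRegular m x := by
    intro c d hcd
    exact Subtype.ext (hx (congrArg Subtype.val hcd))
  have hB := aux_quot A x hx n m hmr hm
  let X : m := ⟨x, hxm⟩
  -- the functional
  have hphi : ∃ φ : m →ₗ[A] (B ⧸ maximalIdeal B), φ X = 1 := by
    have hne : m.toCotangent X ≠ 0 := by
      rw [Ne, Ideal.toCotangent_eq_zero]
      exact hx2
    obtain ⟨f, hf⟩ := Module.Projective.exists_dual_eq_one (ResidueField A) (V := CotangentSpace A) hne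
    let ψ : (A ⧸ m) →ₗ[A] (B ⧸ maximalIdeal B) := Submodule.liftQ m
      (Algebra.linearMap A (B ⧸ maximalIdeal B)) (by
        intro a ha
        rw [LinearMap.mem_ker, Algebra.linearMap_apply, IsScalarTower.algebraMap_apply A B]
        exact Ideal.Quotient.eq_zero_iff_mem.mpr ((hmm a).mp ha))
    let f' : m.Cotangent →ₗ[A] (A ⧸ m) :=
      { toFun := fun c => f c
        map_add' := fun c d => map_add f c d
        map_smul' := fun a c => by
          have h1 : f ((residue A a) • c) = residue A a • f c := map_smul f _ _
          exact h1 }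
    refine ⟨ψ ∘ₗ f' ∘ₗ m.toCotangent, ?_⟩
    have h1 : f' (m.toCotangent X) = Submodule.Quotient.mk 1 := hf
    rw [LinearMap.comp_apply, LinearMap.comp_apply, h1, Submodule.liftQ_apply]
    simp
  obtain ⟨φ, hφ⟩ := hphi
  let r : B ⊗[A] m →ₗ[B] (B ⧸ maximalIdeal B) := LinearMap.liftBaseChange B φ
  let i : (B ⧸ maximalIdeal B) →ₗ[B] B ⊗[A] m := Submodule.liftQ (maximalIdeal B)
    (LinearMap.toSpanSingleton B _ ((1 : B) ⊗ₜ[A] X)) (by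
      intro b hb
      obtain ⟨a, rfl⟩ := Ideal.Quotient.mk_surjective b
      have ha : a ∈ m := (hmm a).mpr hb
      rw [LinearMap.mem_ker, LinearMap.toSpanSingleton_apply]
      have e1 : (Ideal.Quotient.mk (Ideal.span {x}) a) • ((1 : B) ⊗ₜ[A] X) = (a • (1 : B)) ⊗ₜ[A] X := by
        rw [TensorProduct.smul_tmul', Algebra.smul_def]
        rfl
      rw [e1, TensorProduct.smul_tmul]
      have e2 : a • X = x • (⟨a, ha⟩ : m) := Subtype.ext (mul_comm a x)
      rw [e2, ← TensorProduct.smul_tmul]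
      have : x • (1 : B) = 0 := by
        rw [Algebra.smul_def, mul_one]
        exact Ideal.Quotient.eq_zero_iff_mem.mpr (Ideal.mem_span_singleton_self x)
      rw [this, TensorProduct.zero_tmul])
  have hri : r ∘ₗ i = LinearMap.id := by
    apply Submodule.linearMap_qext
    apply LinearMap.ext_ring
    show r ((1 : B) • ((1 : B) ⊗ₜ[A] X)) = _
    rw [one_smul]
    show r ((1 : B) ⊗ₜ[A] X) = 1
    rw [LinearMap.liftBaseChange_tmul, one_smul, hφ]
  have ret : Retract (ModuleCat.of B (B ⧸ maximalIdeal B)) (ModuleCat.of B (B ⊗[A] m)) :=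
    { i := ModuleCat.ofHom i
      r := ModuleCat.ofHom r
      retract := by ext1; exact hri }
  have hB' : HasProjectiveDimensionLT (ModuleCat.of B (B ⊗[A] m)) (n + 1) := hB
  exact ret.hasProjectiveDimensionLT (n + 1)

open CategoryTheory IsLocalRing in
theorem aux_serre (d : ℕ) (A : Type u) [CommRing A] [IsLocalRing A] [IsNoetherianRing A]
    (hd : ringKrullDim A < d) (n : ℕ)
    (h : HasProjectiveDimensionLE (ModuleCat.of A (A ⧸ maximalIdeal A)) n) :
    IsRegularLocalRing A := by
  induction d generalizing A with
  | zero =>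
    exact absurd (ringKrullDim_nonneg_of_nontrivial (R := A)) (not_le.mpr hd)
  | succ d ih =>
    by_cases hm : maximalIdeal A = ⊥
    · apply IsRegularLocalRing.of_spanFinrank_maximalIdeal_le
      rw [hm, Submodule.spanFinrank_bot]
      exact ringKrullDim_nonneg_of_nontrivial (R := A)
    have hass : maximalIdeal A ∉ associatedPrimes A A := by
      intro hmem
      obtain ⟨-, a, ha⟩ := isAssociatedPrime_iff.mp hmem
      have ham : ∀ b ∈ maximalIdeal A, a * b = 0 := by
        intro b hb
        rw [ha, Submodule.mem_colon_singleton] at hb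
        simpa [mul_comm] using hb
      have ha0 : a ≠ 0 := by
        rintro rfl
        apply (maximalIdeal.isMaximal A).ne_top
        rw [ha, Ideal.eq_top_iff_one, Submodule.mem_colon_singleton]
        simp
      have hfree : Module.Free A (A ⧸ maximalIdeal A) := aux_free A a ha0 ham n _ h
      have hb : Module.annihilator A (A ⧸ maximalIdeal A) = ⊥ :=
        Module.annihilator_eq_bot.mpr inferInstance
      rw [Ideal.annihilator_quotient] at hb
      exact hm hb
    have hm2 : ¬ maximalIdeal A ≤ maximalIdeal A ^ 2 := by
      intro hle
      apply hm
      apply Submodule.eq_bot_of_le_smul_of_le_jacobson_bot (maximalIdeal A) _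
        (IsNoetherian.noetherian _)
      · rw [smul_eq_mul, ← sq]; exact hle
      · exact maximalIdeal_le_jacobson _
    obtain ⟨x, hxm, hx2, hxr⟩ : ∃ x ∈ maximalIdeal A, x ∉ maximalIdeal A ^ 2 ∧
        IsSMulRegular A x := by
      by_contra hcon
      push Not at hcon
      have hfin := associatedPrimes.finite A A
      classical
      have hsub : (maximalIdeal A : Set A) ⊆
          ⋃ i ∈ (↑(insert (maximalIdeal A ^ 2) hfin.toFinset) : Set (Ideal A)), (i : Set A) := by
        intro x hx
        by_cases hx2 : x ∈ maximalIdeal A ^ 2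
        · exact Set.mem_biUnion (by simp) hx2
        · have hnr : x ∈ ⋃ p ∈ associatedPrimes A A, (p : Set A) := by
            rw [biUnion_associatedPrimes_eq_compl_regular A A]
            exact hcon x hx hx2
          obtain ⟨p, hp, hxp⟩ := Set.mem_iUnion₂.mp hnr
          exact Set.mem_biUnion (by simp [hp]) hxp
      rw [Ideal.subset_union_prime (f := fun i => i) (maximalIdeal A ^ 2) (maximalIdeal A ^ 2)] at hsub
      · obtain ⟨p, hp, hle⟩ := hsub
        rcases Finset.mem_insert.mp hp with rfl | hp
        · exact hm2 hle
        · have hp' : p ∈ associatedPrimes A A := by simpa using hp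
          have hpp : p.IsPrime := hp'.isPrime
          have : p = maximalIdeal A := le_antisymm (le_maximalIdeal hpp.ne_top) hle
          exact hass (this ▸ hp')
      · intro i hi hne _
        rcases Finset.mem_insert.mp hi with rfl | hi
        · exact absurd rfl hne
        · have hp' : i ∈ associatedPrimes A A := by simpa using hi
          exact hp'.isPrime
    have hdim := ringKrullDim_quotient_span_singleton_succ_eq_ringKrullDim hxr hxm
    have hnt : Nontrivial (A ⧸ Ideal.span {x}) :=
      Ideal.Quotient.nontrivial_iff.mpr (ne_top_of_le_ne_top (maximalIdeal.isMaximal A).ne_top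
        ((Ideal.span_singleton_le_iff_mem _).mpr hxm))
    have hlocB : IsLocalRing (A ⧸ Ideal.span {x}) :=
      IsLocalRing.of_surjective' (Ideal.Quotient.mk _) Ideal.Quotient.mk_surjective
    have hregB : IsRegularLocalRing (A ⧸ Ideal.span {x}) := by
      apply ih
      · rw [← hdim] at hd
        push_cast at hd
        exact lt_of_add_lt_add_right hd
      · exact aux_step A x hxr hxm hx2 n h
    have hB := (isRegularLocalRing_iff _).mp hregB
    apply IsRegularLocalRing.of_spanFinrank_maximalIdeal_le
    rw [← hdim, ← hB]
    norm_cast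
    set B := A ⧸ Ideal.span {x}
    -- generators
    have hfg : (maximalIdeal B).FG := IsNoetherian.noetherian _
    have hgf := Submodule.FG.finite_generators hfg
    choose lift hlift using (Ideal.Quotient.mk_surjective (I := Ideal.span {x}))
    have hmax : maximalIdeal A = Ideal.span (insert x (lift '' (maximalIdeal B).generators)) := by
      have hloc : IsLocalHom (algebraMap A B) :=
        IsLocalHom.of_surjective (algebraMap A B) Ideal.Quotient.mk_surjective
      have hcm : (maximalIdeal B).comap (Ideal.Quotient.mk (Ideal.span {x})) = maximalIdeal A :=
        (eq_maximalIdeal (Ideal.comap_isMaximal_of_surjective _ Ideal.Quotient.mk_surjective))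
      have hmapp : (Ideal.span (lift '' (maximalIdeal B).generators)).map
          (Ideal.Quotient.mk (Ideal.span {x})) = maximalIdeal B := by
        rw [Ideal.map_span, ← Set.image_comp]
        have : (⇑(Ideal.Quotient.mk (Ideal.span {x})) ∘ lift) = id := funext hlift
        rw [this, Set.image_id]
        exact (maximalIdeal B).span_generators
      have h5 := Ideal.comap_map_of_surjective (Ideal.Quotient.mk (Ideal.span {x}))
        Ideal.Quotient.mk_surjective (Ideal.span (lift '' (maximalIdeal B).generators))
      rw [hmapp, hcm, ← RingHom.ker_eq_comap_bot, Ideal.mk_ker] at h5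
      rw [Ideal.span_insert, sup_comm]
      exact h5
    rw [hmax, ← Submodule.FG.generators_ncard hfg]
    refine (Submodule.spanFinrank_span_le_ncard_of_finite ((hgf.image _).insert _)).trans ?_
    refine (Set.ncard_insert_le _ _).trans ?_
    exact Nat.add_le_add_right (Set.ncard_image_le hgf) 1

theorem aux_mod (k L R M N : Type u) [Field k] [CommRing L] [CommRing R] [Algebra k L] [Algebra k R]
    [AddCommGroup M] [Module R M] [Module k M] [IsScalarTower k R M]
    [AddCommGroup N] [Module L N] [Module k N] [IsScalarTower k L N] :
    ∃ _ : Module (L ⊗[k] R) (M →ₗ[k] N), ∀ (l : L) (r : R) (h : M →ₗ[k] N) (m : M),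
      ((l ⊗ₜ[k] r : L ⊗[k] R) • h) m = l • h (r • m) := by
  let f : L →ₐ[k] Module.End k (M →ₗ[k] N) := AlgHom.ofLinearMap
    ((LinearMap.llcomp k M N N) ∘ₗ (Algebra.lsmul k k N).toLinearMap)
    (by ext; simp) (by intro x y; ext; simp [mul_smul])
  let g : R →ₐ[k] Module.End k (M →ₗ[k] N) := AlgHom.ofLinearMap
    { toFun := fun r => LinearMap.lcomp k N (Algebra.lsmul k k M r)
      map_add' := fun x y => by ext; simp [add_smul]
      map_smul' := fun c y => by ext; simp }
    (by ext; simp) (by intro x y; ext; simp [mul_smul, smul_comm x y])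
  let F : (L ⊗[k] R) →ₐ[k] Module.End k (M →ₗ[k] N) :=
    Algebra.TensorProduct.lift f g (by intro x y; ext; simp [f, g])
  refine ⟨Module.compHom _ F.toRingHom, ?_⟩
  intro l r h m
  show F (l ⊗ₜ r) h m = _
  have hF : F (l ⊗ₜ r) = f l * g r := Algebra.TensorProduct.lift_tmul _ _ _ _ _
  rw [hF]
  rfl

theorem aux_lift (k L R M N Q P : Type u) [Field k] [CommRing L] [CommRing R] [Algebra k L] [Algebra k R]
    [AddCommGroup M] [Module R M] [Module k M] [IsScalarTower k R M]
    [AddCommGroup N] [Module L N] [Module k N] [IsScalarTower k L N]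
    [AddCommGroup Q] [Module L Q] [Module k Q] [IsScalarTower k L Q]
    [AddCommGroup P] [Module (L ⊗[k] R) P] [Module.Projective (L ⊗[k] R) P]
    (f : N →ₗ[L] Q) (hf : Function.Surjective f)
    (β : P →+ M →+ Q) (hβ : ∀ l r p m, β ((l ⊗ₜ[k] r : L ⊗[k] R) • p) m = l • β p (r • m)) :
    ∃ γ : P →+ M →+ N, (∀ l r p m, γ ((l ⊗ₜ[k] r : L ⊗[k] R) • p) m = l • γ p (r • m)) ∧
      ∀ p m, f (γ p m) = β p m := by
  obtain ⟨iN, hN⟩ := aux_mod k L R M N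
  obtain ⟨iQ, hQ⟩ := aux_mod k L R M Q
  let f' : N →ₗ[k] Q := f.restrictScalars k
  have hf' : Function.Surjective f' := hf
  have hlin : ∀ (c : k) p m, β p (c • m) = c • β p m := by
    intro c p m
    have h1 := hβ 1 (algebraMap k R c) p m
    have h2 := hβ (algebraMap k L c) 1 p m
    have h3 : (1 : L) ⊗ₜ[k] (algebraMap k R c) = (algebraMap k L c) ⊗ₜ[k] (1 : R) := by
      rw [Algebra.algebraMap_eq_smul_one, Algebra.algebraMap_eq_smul_one, TensorProduct.smul_tmul]
    rw [h3, h2] at h1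
    simpa using h1.symm
  let b : P →ₗ[L ⊗[k] R] (M →ₗ[k] Q) :=
    { toFun := fun p => { toFun := β p, map_add' := map_add _, map_smul' := fun c m => hlin c p m }
      map_add' := fun p q => by ext m; simp
      map_smul' := fun s p => by
        induction s using TensorProduct.induction_on with
        | zero => ext m; simp
        | tmul l r => ext m; simp [hQ, hβ]
        | add s t hs ht =>
          ext m
          have hs' := LinearMap.congr_fun hs m
          have ht' := LinearMap.congr_fun ht m
          simp only [RingHom.id_apply, LinearMap.coe_mk, AddHom.coe_mk] at hs' ht' ⊢
          simp only [add_smul, map_add, AddMonoidHom.add_apply, LinearMap.add_apply, hs', ht'] }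
  let φ : (M →ₗ[k] N) →ₗ[L ⊗[k] R] (M →ₗ[k] Q) :=
    { toFun := fun h => f' ∘ₗ h
      map_add' := fun h h' => by ext m; simp
      map_smul' := fun s p => by
        induction s using TensorProduct.induction_on with
        | zero => ext m; simp
        | tmul l r => ext m; simp [hQ, hN, f']
        | add s t hs ht =>
          ext m
          have hs' := LinearMap.congr_fun hs m
          have ht' := LinearMap.congr_fun ht m
          simp only [RingHom.id_apply, LinearMap.comp_apply] at hs' ht' ⊢
          simp only [add_smul, map_add, LinearMap.add_apply, hs', ht'] }
  have hφ : Function.Surjective φ := by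
    intro h
    obtain ⟨s, hs⟩ := LinearMap.exists_rightInverse_of_surjective f' (LinearMap.range_eq_top.mpr hf')
    refine ⟨s ∘ₗ h, ?_⟩
    show f' ∘ₗ (s ∘ₗ h) = h
    rw [← LinearMap.comp_assoc, hs, LinearMap.id_comp]
  obtain ⟨c, hc⟩ := Module.projective_lifting_property φ b hφ
  refine ⟨(LinearMap.toAddMonoidHom' ).comp c.toAddMonoidHom, ?_, ?_⟩
  · intro l r p m
    show c ((l ⊗ₜ[k] r : L ⊗[k] R) • p) m = l • c p (r • m)
    rw [map_smul, hN]
  · intro p m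
    exact LinearMap.congr_fun (LinearMap.congr_fun hc p) m

theorem aux_proj (k L R M P : Type u) [Field k] [CommRing L] [CommRing R] [Algebra k L] [Algebra k R]
    [AddCommGroup M] [Module R M]
    [AddCommGroup P] [Module (L ⊗[k] R) P] [Module.Projective (L ⊗[k] R) P]
    [Module L P] [Module R P] [SMulCommClass R L P]
    (hL : ∀ (l : L) (p : P), l • p = (l ⊗ₜ[k] (1 : R) : L ⊗[k] R) • p)
    (hR : ∀ (r : R) (p : P), r • p = ((1 : L) ⊗ₜ[k] r : L ⊗[k] R) • p) :
    Module.Projective L (P ⊗[R] M) := by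
  apply Module.Projective.of_lifting_property''
  intro f hf
  let _ : Module k M := Module.compHom M (algebraMap k R)
  have : IsScalarTower k R M := ⟨fun a b m => by
    rw [Algebra.smul_def, mul_smul]; rfl⟩
  let _ : Module k (P ⊗[R] M) := Module.compHom _ (algebraMap k L)
  have : IsScalarTower k L (P ⊗[R] M) := ⟨fun a b m => by
    rw [Algebra.smul_def, mul_smul]; rfl⟩
  have hsplit : ∀ (l : L) (r : R) (p : P), (l ⊗ₜ[k] r : L ⊗[k] R) • p = l • r • p := by
    intro l r p
    rw [hL, hR, ← mul_smul, Algebra.TensorProduct.tmul_mul_tmul, mul_one, one_mul]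
  let β : P →+ M →+ (P ⊗[R] M) :=
    (LinearMap.toAddMonoidHom').comp (TensorProduct.mk R P M).toAddMonoidHom
  obtain ⟨γ, hγ, hγf⟩ := aux_lift k L R M _ _ P f hf β (by
    intro l r p m
    show ((l ⊗ₜ[k] r : L ⊗[k] R) • p) ⊗ₜ[R] m = l • (p ⊗ₜ[R] (r • m))
    rw [hsplit, TensorProduct.smul_tmul', TensorProduct.tmul_smul, TensorProduct.smul_tmul',
      smul_comm r l p])
  let g := TensorProduct.liftAddHom γ (by
    intro r p m
    rw [hR, hγ, one_smul])
  have hg : ∀ p m, g (p ⊗ₜ[R] m) = γ p m := fun p m => rfl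
  let g' : (P ⊗[R] M) →ₗ[L] ((P ⊗[R] M) →₀ L) :=
    { toFun := g
      map_add' := map_add g
      map_smul' := fun l z => by
        induction z using TensorProduct.induction_on with
        | zero => simp
        | tmul p m =>
          rw [TensorProduct.smul_tmul', hg, hg, hL, hγ, one_smul]; rfl
        | add s t hs ht => rw [smul_add, map_add, hs, ht, map_add, smul_add] }
  refine ⟨g', ?_⟩
  ext z
  show f (g z) = z
  induction z using TensorProduct.induction_on with
  | zero => simp
  | tmul p m => rw [hg, hγf]; rfl
  | add s t hs ht => rw [map_add, map_add, hs, ht]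

theorem aux_projR (k L R P : Type u) [Field k] [CommRing L] [CommRing R] [Algebra k L] [Algebra k R]
    [AddCommGroup P] [Module (L ⊗[k] R) P] [Module.Projective (L ⊗[k] R) P] [Module R P]
    (hR : ∀ (r : R) (p : P), r • p = ((1 : L) ⊗ₜ[k] r : L ⊗[k] R) • p) :
    Module.Projective R P := by
  let _ : Algebra R (L ⊗[k] R) := Algebra.TensorProduct.rightAlgebra
  have : IsScalarTower R (L ⊗[k] R) P := ⟨fun r s p => by
    rw [Algebra.smul_def, mul_smul, hR]; rfl⟩
  have : Module.Free R (L ⊗[k] R) :=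
    Module.Free.of_equiv (Algebra.TensorProduct.commRight k R L).toLinearEquiv
  obtain ⟨s, hs⟩ := Module.projective_def'.mp (inferInstance : Module.Projective (L ⊗[k] R) P)
  exact Module.Projective.of_split (M := P →₀ (L ⊗[k] R)) (s.restrictScalars R)
    ((Finsupp.linearCombination (L ⊗[k] R) id).restrictScalars R)
    (by ext p; exact LinearMap.congr_fun hs p)

theorem aux_map (L R M P Q : Type u) [CommRing L] [CommRing R]
    [AddCommGroup M] [Module R M]
    [AddCommGroup P] [Module L P] [Module R P] [SMulCommClass R L P]
    [AddCommGroup Q] [Module L Q] [Module R Q] [SMulCommClass R L Q]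
    (f : P →ₗ[R] Q) (hf : ∀ (l : L) (p : P), f (l • p) = l • f p) :
    ∃ F : P ⊗[R] M →ₗ[L] Q ⊗[R] M, ⇑F = ⇑(f.rTensor M) :=
  ⟨{ toFun := f.rTensor M
     map_add' := map_add _
     map_smul' := fun l z => by
        induction z using TensorProduct.induction_on with
        | zero => simp
        | tmul p m =>
          rw [TensorProduct.smul_tmul', LinearMap.rTensor_tmul, hf, RingHom.id_apply,
            LinearMap.rTensor_tmul, TensorProduct.smul_tmul']
        | add s t hs ht => rw [smul_add, map_add, hs, ht, map_add, smul_add] }, rfl⟩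

open CategoryTheory in
theorem aux_ses (L R M K P Q : Type u) [CommRing L] [CommRing R]
    [AddCommGroup M] [Module R M]
    [AddCommGroup K] [Module L K] [Module R K] [SMulCommClass R L K]
    [AddCommGroup P] [Module L P] [Module R P] [SMulCommClass R L P]
    [AddCommGroup Q] [Module L Q] [Module R Q] [SMulCommClass R L Q]
    (i : K →ₗ[R] P) (hi : ∀ (l : L) (p : K), i (l • p) = l • i p)
    (f : P →ₗ[R] Q) (hf : ∀ (l : L) (p : P), f (l • p) = l • f p)
    (r : P →ₗ[R] K) (hr : r ∘ₗ i = LinearMap.id) (hs : Function.Surjective f)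
    (hex : Function.Exact i f) (n : ℕ) (hP : Module.Projective L (P ⊗[R] M))
    (hK : HasProjectiveDimensionLE (ModuleCat.of L (K ⊗[R] M)) n) :
    HasProjectiveDimensionLE (ModuleCat.of L (Q ⊗[R] M)) (n + 1) := by
  obtain ⟨i', hi'⟩ := aux_map L R M K P i hi
  obtain ⟨f', hf'⟩ := aux_map L R M P Q f hf
  have hg' : Function.Surjective f' := by
    rw [hf']; exact LinearMap.rTensor_surjective M hs
  have hex' : Function.Exact i' f' := by
    rw [hf', hi']; exact rTensor_exact M hex hs
  have hinj : Function.Injective i' := by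
    rw [hi']
    apply Function.LeftInverse.injective (g := r.rTensor M)
    intro z
    rw [← LinearMap.comp_apply, ← LinearMap.rTensor_comp, hr, LinearMap.rTensor_id,
      LinearMap.id_apply]
  let T : ShortComplex (ModuleCat.{u} L) := ShortComplex.mk (ModuleCat.ofHom i') (ModuleCat.ofHom f')
    (by ext1; exact hex'.linearMap_comp_eq_zero)
  have hT : T.ShortExact :=
    { exact := (ShortComplex.ShortExact.moduleCat_exact_iff_function_exact T).mpr hex'
      mono_f := (ModuleCat.mono_iff_injective _).mpr hinj
      epi_g := (ModuleCat.epi_iff_surjective _).mpr hg' }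
  have hp2 : Projective T.X₂ := (IsProjective.iff_projective (R := L) (P ⊗[R] M)).mp hP
  exact (hT.hasProjectiveDimensionLT_X₃_iff n hp2).mpr hK

open CategoryTheory in
theorem aux_ind (k L R M : Type u) [Field k] [CommRing L] [CommRing R] [Algebra k L] [Algebra k R]
    [AddCommGroup M] [Module R M] (n : ℕ) : ∀ (Q : Type u)
    [AddCommGroup Q] [Module (L ⊗[k] R) Q]
    [Module L Q] [Module R Q] [SMulCommClass R L Q]
    (_ : ∀ (l : L) (p : Q), l • p = (l ⊗ₜ[k] (1 : R) : L ⊗[k] R) • p)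
    (_ : ∀ (r : R) (p : Q), r • p = ((1 : L) ⊗ₜ[k] r : L ⊗[k] R) • p)
    (_ : ProjDimLE (L ⊗[k] R) n Q) (_ : Module.Projective R Q),
    HasProjectiveDimensionLE (ModuleCat.of L (Q ⊗[R] M)) n := by
  induction n with
  | zero =>
    intro Q _ _ _ _ _ hL hR h _
    have : Module.Projective (L ⊗[k] R) Q := h
    have := aux_proj k L R M Q hL hR
    exact (projective_iff_hasProjectiveDimensionLE_zero _).mp
      ((IsProjective.iff_projective _).mp inferInstance)
  | succ n ih =>
    intro Q _ _ _ _ _ hL hR h hQ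
    obtain ⟨P, _, _, f, hP, hf, hK⟩ := h
    obtain ⟨K, _, _, i, hi, hex, hK⟩ : ∃ (K : Type u) (_ : AddCommGroup K)
      (_ : Module (L ⊗[k] R) K) (i : K →ₗ[L ⊗[k] R] P), Function.Injective i ∧
        Function.Exact i f ∧ ProjDimLE (L ⊗[k] R) n K :=
      ⟨LinearMap.ker f, inferInstance, inferInstance, (LinearMap.ker f).subtype,
        Subtype.val_injective, LinearMap.exact_subtype_ker_map f, hK⟩
    let _ : Module L P := Module.compHom P
      (Algebra.TensorProduct.includeLeft : L →ₐ[k] L ⊗[k] R).toRingHom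
    let _ : Module R P := Module.compHom P
      (Algebra.TensorProduct.includeRight : R →ₐ[k] L ⊗[k] R).toRingHom
    let _ : Module L K := Module.compHom K
      (Algebra.TensorProduct.includeLeft : L →ₐ[k] L ⊗[k] R).toRingHom
    let _ : Module R K := Module.compHom K
      (Algebra.TensorProduct.includeRight : R →ₐ[k] L ⊗[k] R).toRingHom
    have hLP : ∀ (l : L) (p : P), l • p = (l ⊗ₜ[k] (1 : R) : L ⊗[k] R) • p := fun _ _ => rfl
    have hRP : ∀ (r : R) (p : P), r • p = ((1 : L) ⊗ₜ[k] r : L ⊗[k] R) • p := fun _ _ => rfl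
    have hLK : ∀ (l : L) (p : K), l • p = (l ⊗ₜ[k] (1 : R) : L ⊗[k] R) • p :=
      fun _ _ => rfl
    have hRK : ∀ (r : R) (p : K), r • p = ((1 : L) ⊗ₜ[k] r : L ⊗[k] R) • p :=
      fun _ _ => rfl
    have : SMulCommClass R L P := ⟨fun r l p => by
      rw [hLP, hLP, hRP, hRP, smul_comm]⟩
    have : SMulCommClass R L K := ⟨fun r l p => by
      rw [hLK, hLK, hRK, hRK, smul_comm]⟩
    let iR : K →ₗ[R] P :=
      { toFun := i, map_add' := map_add i, map_smul' := fun r p => by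
          rw [hRK, map_smul, RingHom.id_apply, hRP] }
    let fR : P →ₗ[R] Q :=
      { toFun := f, map_add' := map_add f, map_smul' := fun r p => by
          rw [hRP, map_smul, RingHom.id_apply, hR] }
    obtain ⟨s, hs⟩ := Module.projective_lifting_property fR LinearMap.id hf
    have hs' : ∀ q, f (s q) = q := fun q => LinearMap.congr_fun hs q
    have hret : ∀ p, ∃ c, i c = p - s (fR p) := by
      intro p
      apply (hex _).mp
      rw [map_sub, hs']
      exact sub_self (f p)
    choose r hr using hret
    let rR : P →ₗ[R] K :=
      { toFun := r
        map_add' := fun p q => by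
          apply hi
          rw [map_add, hr, hr, hr, map_add, map_add]
          abel
        map_smul' := fun a p => by
          apply hi
          rw [RingHom.id_apply]
          show _ = iR (a • r p)
          rw [map_smul]
          show _ = a • i (r p)
          rw [hr, hr, map_smul, map_smul, smul_sub] }
    have hri : rR ∘ₗ iR = LinearMap.id := by
      ext c
      apply hi
      show i (r (i c)) = i c
      rw [hr]
      have : fR (i c) = 0 := (hex _).mpr ⟨c, rfl⟩
      rw [this, map_zero, sub_zero]
    have hPR := aux_projR k L R P hRP
    have hKR : Module.Projective R K := Module.Projective.of_split iR rR hri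
    exact aux_ses L R M K P Q iR (fun l p => by
        show i (l • p) = l • i p
        rw [hLK, map_smul, hLP]) fR (fun l p => by
        show f (l • p) = l • f p
        rw [hLP, map_smul, hL]) rR hri hf hex n (aux_proj k L R M P hLP hRP) (ih K hLK hRK hK hKR)

theorem aux_conv (A : Type u) [CommRing A] [IsLocalRing A] [IsNoetherianRing A]
    (h : IsRegularLocalRing A) : IsRegularLocal A := by
  have hB := (isRegularLocalRing_iff _).mp h
  have hfg : (IsLocalRing.maximalIdeal A).FG := IsNoetherian.noetherian _
  have hgf := Submodule.FG.finite_generators hfg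
  refine ⟨inferInstance, inferInstance, hgf.toFinset, inferInstance, ?_, ?_⟩
  · rw [Set.Finite.coe_toFinset]
    exact (IsLocalRing.maximalIdeal A).span_generators
  · rw [← hB, ← Submodule.FG.generators_ncard hfg, Set.ncard_eq_toFinset_card _ hgf]

open CategoryTheory in
theorem aux_loc (R : Type u) [CommRing R] (S : Submonoid R) (M : Type u) [AddCommGroup M]
    [Module R M] [Module (Localization S) M] [IsScalarTower R (Localization S) M] (n : ℕ)
    (h : HasProjectiveDimensionLE (ModuleCat.of R M) n) :
    HasProjectiveDimensionLE (ModuleCat.of (Localization S) M) n := by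
  have h3 := ModuleCat.localizedModule_hasProjectiveDimensionLE n S (ModuleCat.of R M)
  have h5 := ModuleCat.localizedModule_isLocalizedModule (ModuleCat.of R M) S
  generalize (ModuleCat.of R M).localizedModuleMkLinearMap S = f at h5
  have : IsLocalizedModule S (LinearMap.id : M →ₗ[R] M) :=
    isLocalizedModule_id S M (Localization S)
  let e : (ModuleCat.of R M).localizedModule S ≃ₗ[R] M := 
    @IsLocalizedModule.linearEquiv R _ S M _ _ _ _ _ _ _ _ f (LinearMap.id : M →ₗ[R] M) h5 _
  exact ModuleCat.hasProjectiveDimensionLE_of_linearEquiv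
    (N := ModuleCat.of (Localization S) M)
    (LinearEquiv.extendScalarsOfIsLocalization S (Localization S) e) n

open CategoryTheory in
theorem aux_main
    (k : Type u) (R : Type u) [Field k] [CommRing R] [Algebra k R]
    (hfg : Algebra.FiniteType k R)
    (h : ∃ n : ℕ, @ProjDimLE (R ⊗[k] R) _ n R _
      ((Algebra.TensorProduct.lmul' k (S := R)).toRingHom.toModule)) :
    ∀ (𝔭 : Ideal R) [𝔭.IsPrime], IsRegularLocal (Localization.AtPrime 𝔭) := by
  intro 𝔭 _
  obtain ⟨n, hn⟩ := h
  have : IsNoetherianRing R := Algebra.FiniteType.isNoetherianRing k R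
  have hA : IsNoetherianRing (Localization.AtPrime 𝔭) :=
    IsLocalization.isNoetherianRing 𝔭.primeCompl _ inferInstance
  apply aux_conv
  let A := Localization.AtPrime 𝔭
  let M := A ⧸ IsLocalRing.maximalIdeal A
  have h1 : HasProjectiveDimensionLE (ModuleCat.of R (R ⊗[R] M)) n :=
    @aux_ind k R R M _ _ _ _ _ _ _ n R _
      ((Algebra.TensorProduct.lmul' k (S := R)).toRingHom.toModule) _ _ _
      (fun l p => by
        show l * p = Algebra.TensorProduct.lmul' k (S := R) (l ⊗ₜ 1) * p
        simp) (fun l p => by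
        show l * p = Algebra.TensorProduct.lmul' k (S := R) (1 ⊗ₜ l) * p
        simp) hn inferInstance
  have h2 : HasProjectiveDimensionLE (ModuleCat.of R M) n :=
    ModuleCat.hasProjectiveDimensionLE_of_linearEquiv (M := ModuleCat.of R (R ⊗[R] M))
      (N := ModuleCat.of R M) (TensorProduct.lid R M) n
  have h4 : HasProjectiveDimensionLE (ModuleCat.of A M) n := aux_loc R 𝔭.primeCompl M n h2
  have hfin := ringKrullDim_le_spanFinrank_maximalIdeal (R := A)
  refine aux_serre ((IsLocalRing.maximalIdeal A).spanFinrank + 1) A (lt_of_le_of_lt hfin ?_) n h4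
  norm_cast
  exact Nat.lt_succ_self _

/-- Let `k` be a field and `R` a finitely generated commutative `k`-algebra. If `R`,
regarded as a module over `R ⊗[k] R` via the multiplication map, has finite projective
dimension, then `R` is regular, i.e. for every prime ideal `𝔭` of `R` the localization
`R_𝔭` is a regular local ring. -/
theorem regular_of_finite_projDim_over_enveloping
    (k : Type u) (R : Type u) [Field k] [CommRing R] [Algebra k R]
    (hfg : Algebra.FiniteType k R)
    (h : ∃ n : ℕ, @ProjDimLE (R ⊗[k] R) _ n R _
      ((Algebra.TensorProduct.lmul' k (S := R)).toRingHom.toModule)) :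
    ∀ (𝔭 : Ideal R) [𝔭.IsPrime], IsRegularLocal (Localization.AtPrime 𝔭) := by
  exact aux_main k R hfg h
end

section
/- Let A be a Noetherian integral domain with fraction field Q(A) whose integral closure in Q(A) is a finitely generated A-module (i.e., A is N-1). Let B be a subring of Q(A) with A ⊆ B and A ≠ B such that the induced morphism of affine schemes Spec B → Spec A is an open immersion. Then every A-module homomorphism f : B → A is zero. -/
universe u

open AlgebraicGeometry

set_option synthInstance.maxHeartbeats 1000000
set_option maxHeartbeats 1000000

/-- Let `A` be a Noetherian integral domain whose integral closure in its fraction field is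
a finitely generated `A`-module (i.e. `A` is N-1). Let `B` be an intermediate ring
`A ⊊ B ⊆ Q(A)` such that `Spec B → Spec A` is an open immersion. Then every `A`-module
homomorphism `f : B → A` is zero. -/
theorem linearMap_to_base_eq_zero_of_openImmersion
    (A : Type u) [CommRing A] [IsDomain A] [IsNoetherianRing A]
    (hN1 : (Subalgebra.toSubmodule (integralClosure A (FractionRing A))).FG)
    (B : Subalgebra A (FractionRing A)) (hB : B ≠ ⊥)
    (hopen : IsOpenImmersion (Spec.map (CommRingCat.ofHom (algebraMap A B))))
    (f : B →ₗ[A] A) : f = 0 := by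
  by_contra hf
  have key : ∀ b : B, ∃ p q : A, q ≠ 0 ∧ q * f b = p * f 1 ∧ (p = 0 → b = 0) := by
    intro b
    obtain ⟨p, q, hq, hpq⟩ := IsFractionRing.div_surjective (A := A) (b : FractionRing A)
    have hq0 : q ≠ 0 := nonZeroDivisors.ne_zero hq
    have hq1 : algebraMap A (FractionRing A) q ≠ 0 := by
      simpa using hq0
    have h : q • b = p • (1 : B) := by
      apply Subtype.ext
      change q • (b : FractionRing A) = p • (1 : FractionRing A)
      rw [Algebra.smul_def, Algebra.smul_def, mul_one]
      rw [← hpq]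
      field_simp
    refine ⟨p, q, hq0, ?_, ?_⟩
    · have := congrArg f h
      simpa [map_smul] using this
    · rintro rfl
      apply Subtype.ext
      rw [← hpq]
      simp
  have h1 : f 1 ≠ 0 := by
    intro h1
    apply hf
    ext b
    obtain ⟨p, q, hq, h, -⟩ := key b
    rw [h1, mul_zero] at h
    simpa [hq] using h
  have hinj : Function.Injective f := by
    rw [injective_iff_map_eq_zero]
    intro b hb
    obtain ⟨p, q, hq, h, h'⟩ := key b
    apply h'
    rw [hb, mul_zero] at h
    simpa [h1] using h.symm
  have hfin : Module.Finite A B := Module.Finite.of_injective f hinj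
  have hsurj : Surjective (Spec.map (CommRingCat.ofHom (algebraMap A B))) :=
    ⟨Algebra.IsIntegral.comap_surjective A B⟩
  have hiso := (isIso_iff_isOpenImmersion_and_surjective _).2 ⟨hopen, hsurj⟩
  rw [isIso_SpecMap_iff] at hiso
  apply hB
  rw [eq_bot_iff]
  intro x hx
  obtain ⟨a, ha⟩ := hiso.2 ⟨x, hx⟩
  exact Algebra.mem_bot.2 ⟨a, congrArg Subtype.val ha⟩
end

section
/- Let A be a Noetherian integrally closed integral domain with fraction field Q(A), and let B be a subring of Q(A) with A ⊆ B and A ≠ B. Then every A-module homomorphism f : B → A is zero. -/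
universe u

set_option synthInstance.maxHeartbeats 1000000
set_option maxHeartbeats 1000000

/-- Let `A` be a Noetherian integrally closed integral domain with fraction field `Q(A)`,
and let `B` be an intermediate ring `A ⊊ B ⊆ Q(A)`. Then every `A`-module homomorphism
`f : B → A` is zero. -/
theorem linearMap_to_base_eq_zero_of_integrallyClosed
    (A : Type u) [CommRing A] [IsDomain A] [IsNoetherianRing A] [IsIntegrallyClosed A]
    (B : Subalgebra A (FractionRing A)) (hB : B ≠ ⊥)
    (f : B →ₗ[A] A) : f = 0 := by
  by_contra hf
  apply hB
  have hinj : Function.Injective f := by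
    rw [injective_iff_map_eq_zero]
    intro b hb
    by_contra hb0
    apply hf
    ext c
    obtain ⟨p, q, hq, hpq⟩ := IsFractionRing.div_surjective (A := A) (b : FractionRing A)
    obtain ⟨r, s, hs, hrs⟩ := IsFractionRing.div_surjective (A := A) (c : FractionRing A)
    have hq0 : algebraMap A (FractionRing A) q ≠ 0 :=
      IsFractionRing.to_map_ne_zero_of_mem_nonZeroDivisors hq
    have hs0 : algebraMap A (FractionRing A) s ≠ 0 :=
      IsFractionRing.to_map_ne_zero_of_mem_nonZeroDivisors hs
    have hp0 : p ≠ 0 := by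
      rintro rfl
      apply hb0
      apply Subtype.ext
      rw [← hpq]
      simp
    have key : (p * s) • c = (r * q) • b := by
      apply Subtype.ext
      rw [Subalgebra.coe_smul, Subalgebra.coe_smul, Algebra.smul_def, Algebra.smul_def, ← hpq, ← hrs, map_mul, map_mul]
      field_simp
    have h2 := congrArg f key
    rw [map_smul, map_smul, hb, smul_zero, smul_eq_mul] at h2
    rcases mul_eq_zero.mp h2 with h | h
    · exact absurd h (mul_ne_zero hp0 (nonZeroDivisors.ne_zero hs))
    · simpa using h
  have hN : IsNoetherian A B := isNoetherian_of_injective f hinj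
  rw [eq_bot_iff]
  intro x hx
  have hi : IsIntegral A (⟨x, hx⟩ : B) := IsIntegral.of_finite A _
  have hi2 : IsIntegral A x := hi.map B.val
  obtain ⟨y, hy⟩ := IsIntegrallyClosed.algebraMap_eq_of_integral hi2
  exact Algebra.mem_bot.mpr ⟨y, hy⟩
end

section
/- Let A_0 ← A_1 ← A_2 ← ⋯ be an inverse system, indexed by the natural numbers, of cochain complexes of abelian groups such that every complex A_i is acyclic and every transition map A_{i+1} → A_i is surjective in each degree. Then the inverse limit complex lim_i A_i is also acyclic. -/
universe u

/-- Let `A 0 ← A 1 ← A 2 ← ⋯` be an inverse system of cochain complexes of abelian groups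
(with differentials `d` and transition chain maps `t`) such that every complex `A i` is
acyclic and every transition map is surjective in each degree. Then the inverse limit
complex (whose degree `n` part consists of the compatible families, with componentwise
differential) is also acyclic. -/
theorem limit_acyclic_of_surjective_inverse_system_of_acyclic
    (A : ℕ → ℤ → Type u) [∀ i n, AddCommGroup (A i n)]
    (d : ∀ i n, A i n →+ A i (n + 1))
    (hd : ∀ i n (x : A i n), d i (n + 1) (d i n x) = 0)
    (t : ∀ i n, A (i + 1) n →+ A i n)
    (ht : ∀ i n (x : A (i + 1) n), d i n (t i n x) = t i (n + 1) (d (i + 1) n x))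
    (hsurj : ∀ i n, Function.Surjective (t i n))
    (hacyclic : ∀ i n (x : A i (n + 1)), d i (n + 1) x = 0 → ∃ y : A i n, d i n y = x) :
    ∀ n (x : ∀ i, A i (n + 1)),
      (∀ i, t i (n + 1) (x (i + 1)) = x i) →
      (∀ i, d i (n + 1) (x i) = 0) →
      ∃ y : ∀ i, A i n, (∀ i, t i n (y (i + 1)) = y i) ∧ ∀ i, d i n (y i) = x i := by
  intro n x hx hdx
  obtain ⟨m, rfl⟩ : ∃ m, n = m + 1 := ⟨n - 1, by ring⟩
  have step : ∀ i (y : A i (m + 1)), d i (m + 1) y = x i →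
      ∃ y' : A (i + 1) (m + 1), d (i + 1) (m + 1) y' = x (i + 1) ∧ t i (m + 1) y' = y := by
    intro i y hy
    obtain ⟨z, hz⟩ := hacyclic (i + 1) _ _ (hdx (i + 1))
    obtain ⟨w, hw⟩ := hacyclic i m (t i (m + 1) z - y) (by
      rw [map_sub, ht, hz, hx, hy, sub_self])
    obtain ⟨w', rfl⟩ := hsurj i m w
    refine ⟨z - d (i + 1) m w', ?_, ?_⟩
    · rw [map_sub, hd, hz, sub_zero]
    · rw [map_sub, ← ht, hw, sub_sub_cancel]
  choose f hf1 hf2 using step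
  obtain ⟨y0, hy0⟩ := hacyclic 0 _ _ (hdx 0)
  let Y : ∀ i, {y : A i (m + 1) // d i (m + 1) y = x i} := fun i =>
    Nat.rec (motive := fun i => {y : A i (m + 1) // d i (m + 1) y = x i})
      ⟨y0, hy0⟩ (fun i p => ⟨f i p.1 p.2, hf1 i p.1 p.2⟩) i
  exact ⟨fun i => (Y i).1, fun i => hf2 i (Y i).1 (Y i).2, fun i => (Y i).2⟩
end

section
/- Let (X_i)_{i ∈ ℕ} and (Y_i)_{i ∈ ℕ} be inverse systems of cochain complexes of abelian groups whose transition maps are surjective in every degree, and let φ = (φ_i)_{i ∈ ℕ} : X → Y be a morphism of inverse systems such that each φ_i : X_i → Y_i is a quasi-isomorphism. Then the induced morphism lim_i φ_i : lim_i X_i → lim_i Y_i on the inverse limits is a quasi-isomorphism. -/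
universe u

theorem exists_compatible_lift {A B C : ℕ → Type u} [∀ i, AddCommGroup (A i)]
    [∀ i, AddCommGroup (B i)] [∀ i, AddCommGroup (C i)]
    (f : ∀ i, A i →+ B i) (g : ∀ i, B i →+ C i)
    (tA : ∀ i, A (i + 1) →+ A i) (tB : ∀ i, B (i + 1) →+ B i) (tC : ∀ i, C (i + 1) →+ C i)
    (hf : ∀ i a, f i (tA i a) = tB i (f (i + 1) a))
    (hg : ∀ i b, g i (tB i b) = tC i (g (i + 1) b))
    (hs : ∀ i, Function.Surjective (tA i))
    (hgf : ∀ i a, g i (f i a) = 0)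
    (hex : ∀ i b, g i b = 0 → ∃ a, f i a = b)
    (c : ∀ i, C i) (hc : ∀ i, tC i (c (i + 1)) = c i) (hcg : ∀ i, ∃ b, g i b = c i) :
    ∃ b : ∀ i, B i, (∀ i, tB i (b (i + 1)) = b i) ∧ ∀ i, g i (b i) = c i := by
  have step : ∀ i (b : {b : B i // g i b = c i}),
      ∃ b' : {b : B (i + 1) // g (i + 1) b = c (i + 1)}, tB i b'.1 = b.1 := by
    rintro i ⟨b, hb⟩
    obtain ⟨b', hb'⟩ := hcg (i + 1)
    obtain ⟨e, he⟩ := hex i (tB i b' - b) (by rw [map_sub, hg, hb', hc, hb, sub_self])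
    obtain ⟨e', rfl⟩ := hs i e
    refine ⟨⟨b' - f (i + 1) e', by rw [map_sub, hgf, hb', sub_zero]⟩, ?_⟩
    simp only [map_sub, ← hf, he]
    abel
  choose nxt hnxt using step
  let b0 : {b : B 0 // g 0 b = c 0} := ⟨(hcg 0).choose, (hcg 0).choose_spec⟩
  let b : ∀ i, {b : B i // g i b = c i} :=
    fun i => Nat.rec (motive := fun i => {b : B i // g i b = c i}) b0 (fun i p => nxt i p) i
  exact ⟨fun i => (b i).1, fun i => hnxt i (b i), fun i => (b i).2⟩

/-- Let `(X i)` and `(Y i)` be inverse systems of cochain complexes of abelian groups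
(differentials `dX`, `dY`, transition chain maps `tX`, `tY`) whose transition maps are
surjective in every degree, and let `φ = (φ i)` be a morphism of inverse systems such that
each `φ i` is a quasi-isomorphism.  Then the induced morphism on the inverse limit
complexes (degreewise given by compatible families, with componentwise differentials and
componentwise `φ`) is a quasi-isomorphism, i.e. it is injective and surjective on
cohomology. -/
theorem limMap_quasiIso_of_surjective_inverse_systems
    (X Y : ℕ → ℤ → Type u) [∀ i n, AddCommGroup (X i n)] [∀ i n, AddCommGroup (Y i n)]
    (dX : ∀ i n, X i n →+ X i (n + 1)) (dY : ∀ i n, Y i n →+ Y i (n + 1))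
    (hdX : ∀ i n (x : X i n), dX i (n + 1) (dX i n x) = 0)
    (hdY : ∀ i n (y : Y i n), dY i (n + 1) (dY i n y) = 0)
    (tX : ∀ i n, X (i + 1) n →+ X i n) (tY : ∀ i n, Y (i + 1) n →+ Y i n)
    (htX : ∀ i n (x : X (i + 1) n), dX i n (tX i n x) = tX i (n + 1) (dX (i + 1) n x))
    (htY : ∀ i n (y : Y (i + 1) n), dY i n (tY i n y) = tY i (n + 1) (dY (i + 1) n y))
    (hsurjX : ∀ i n, Function.Surjective (tX i n))
    (hsurjY : ∀ i n, Function.Surjective (tY i n))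
    (φ : ∀ i n, X i n →+ Y i n)
    (hφd : ∀ i n (x : X i n), φ i (n + 1) (dX i n x) = dY i n (φ i n x))
    (hφt : ∀ i n (x : X (i + 1) n), φ i n (tX i n x) = tY i n (φ (i + 1) n x))
    -- each `φ i` is injective on cohomology …
    (hφinj : ∀ i n (x : X i (n + 1)), dX i (n + 1) x = 0 →
      (∃ y : Y i n, dY i n y = φ i (n + 1) x) → ∃ x' : X i n, dX i n x' = x)
    -- … and surjective on cohomology, i.e. a quasi-isomorphism
    (hφsurj : ∀ i n (y : Y i (n + 1)), dY i (n + 1) y = 0 →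
      ∃ x : X i (n + 1), dX i (n + 1) x = 0 ∧ ∃ y' : Y i n, φ i (n + 1) x = y + dY i n y') :
    -- the induced map on limits is injective on cohomology …
    (∀ n (x : ∀ i, X i (n + 1)),
      (∀ i, tX i (n + 1) (x (i + 1)) = x i) →
      (∀ i, dX i (n + 1) (x i) = 0) →
      (∃ y : ∀ i, Y i n, (∀ i, tY i n (y (i + 1)) = y i) ∧
        ∀ i, dY i n (y i) = φ i (n + 1) (x i)) →
      ∃ x' : ∀ i, X i n, (∀ i, tX i n (x' (i + 1)) = x' i) ∧ ∀ i, dX i n (x' i) = x i) ∧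
    -- … and surjective on cohomology, i.e. a quasi-isomorphism
    (∀ n (y : ∀ i, Y i (n + 1)),
      (∀ i, tY i (n + 1) (y (i + 1)) = y i) →
      (∀ i, dY i (n + 1) (y i) = 0) →
      ∃ x : ∀ i, X i (n + 1), (∀ i, tX i (n + 1) (x (i + 1)) = x i) ∧
        (∀ i, dX i (n + 1) (x i) = 0) ∧
        ∃ y' : ∀ i, Y i n, (∀ i, tY i n (y' (i + 1)) = y' i) ∧
          ∀ i, φ i (n + 1) (x i) = y i + dY i n (y' i)) := by
  let D : ∀ i n, X i (n + 1) × Y i n →+ X i (n + 1 + 1) × Y i (n + 1) := fun i n =>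
    AddMonoidHom.prod (-((dX i (n + 1)).comp (AddMonoidHom.fst _ _)))
      ((φ i (n + 1)).comp (AddMonoidHom.fst _ _) + (dY i n).comp (AddMonoidHom.snd _ _))
  have hD : ∀ i n p, D i n p = (-(dX i (n + 1) p.1), φ i (n + 1) p.1 + dY i n p.2) :=
    fun i n p => rfl
  let T : ∀ i n, X (i + 1) (n + 1) × Y (i + 1) n →+ X i (n + 1) × Y i n := fun i n =>
    AddMonoidHom.prodMap (tX i (n + 1)) (tY i n)
  have hT : ∀ i n p, T i n p = (tX i (n + 1) p.1, tY i n p.2) := fun i n p => rfl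
  have hDT : ∀ i n p, D i n (T i n p) = T i (n + 1) (D (i + 1) n p) := by
    intro i n p
    simp only [hD, hT, htX, htY, hφt, map_neg, map_add]
  have hTs : ∀ i n, Function.Surjective (T i n) := fun i n =>
    Function.Surjective.prodMap (hsurjX i (n + 1)) (hsurjY i n)
  have hDD : ∀ i n p, D i (n + 1) (D i n p) = 0 := by
    intro i n p
    simp only [hD, map_neg, map_add, hdX, hdY, hφd]
    ext <;> simp
  have hex : ∀ i n p, D i (n + 1) p = 0 → ∃ a, D i n a = p := by
    rintro i n ⟨x, y⟩ h
    rw [hD, Prod.mk_eq_zero] at h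
    obtain ⟨h1, h2⟩ := h
    simp only [neg_eq_zero] at h1 h2
    obtain ⟨x1, hx1⟩ := hφinj i (n + 1) x h1 ⟨-y, by
      rw [map_neg]; exact (eq_neg_of_add_eq_zero_left h2).symm⟩
    obtain ⟨x2, hx2, y', hy'⟩ := hφsurj i n (φ i (n + 1) x1 + y) (by
      rw [map_add, ← hφd, hx1]; exact h2)
    refine ⟨(x2 - x1, -y'), ?_⟩
    rw [hD]
    ext
    · simp [hx1, hx2]
    · simp only [map_sub, map_neg, hy']
      abel
  have key : ∀ n (x : ∀ i, X i (n + 1 + 1 + 1)) (y : ∀ i, Y i (n + 1 + 1)),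
      (∀ i, tX i _ (x (i + 1)) = x i) → (∀ i, tY i _ (y (i + 1)) = y i) →
      (∀ i, dX i _ (x i) = 0) → (∀ i, φ i _ (x i) + dY i _ (y i) = 0) →
      ∃ (a : ∀ i, X i (n + 1 + 1)) (b : ∀ i, Y i (n + 1)),
        (∀ i, tX i _ (a (i + 1)) = a i) ∧ (∀ i, tY i _ (b (i + 1)) = b i) ∧
        (∀ i, -(dX i _ (a i)) = x i) ∧ (∀ i, φ i _ (a i) + dY i _ (b i) = y i) := by
    intro n x y hx hy hdx hdy
    obtain ⟨b, hb, hb'⟩ := exists_compatible_lift (fun i => D i n) (fun i => D i (n + 1))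
      (fun i => T i n) (fun i => T i (n + 1)) (fun i => T i (n + 1 + 1))
      (fun i => hDT i n) (fun i => hDT i (n + 1)) (fun i => hTs i n) (fun i => hDD i n)
      (fun i => hex i n) (fun i => (x i, y i)) (fun i => by rw [hT, hx, hy])
      (fun i => hex i (n + 1) _ (by rw [hD, hdx, hdy, neg_zero]; rfl))
    exact ⟨fun i => (b i).1, fun i => (b i).2, fun i => congrArg Prod.fst (hb i),
      fun i => congrArg Prod.snd (hb i), fun i => congrArg Prod.fst (hb' i),
      fun i => congrArg Prod.snd (hb' i)⟩
  constructor
  · intro n x hx hdx hy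
    obtain ⟨m, rfl⟩ : ∃ m : ℤ, n = m + 1 + 1 := ⟨n - 1 - 1, by ring⟩
    obtain ⟨y, hy, hdy⟩ := hy
    obtain ⟨a, b, ha, -, hda, -⟩ := key m x (fun i => -y i) hx
      (fun i => by rw [map_neg, hy]) hdx (fun i => by rw [map_neg, hdy, add_neg_cancel])
    exact ⟨fun i => -a i, fun i => by rw [map_neg, ha], fun i => by rw [map_neg, hda]⟩
  · intro n y hy hdy
    obtain ⟨m, rfl⟩ : ∃ m : ℤ, n = m + 1 := ⟨n - 1, by ring⟩
    obtain ⟨a, b, ha, hb, hda, hdb⟩ := key m (fun i => 0) y (fun i => map_zero _) hy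
      (fun i => map_zero _) (fun i => by rw [map_zero, hdy, add_zero])
    exact ⟨a, ha, fun i => neg_eq_zero.mp (hda i), fun i => -b i,
      fun i => by rw [map_neg, hb], fun i => by rw [map_neg, ← hdb]; abel⟩
end

section
/- Let A be a commutative Noetherian local ring which is not a regular local ring, and let κ = A/𝔪 be its residue field, regarded as an A-module. Then Ext^n_A(κ, κ) ≠ 0 for every natural number n. -/
universe u

open CategoryTheory Opposite

open IsLocalRing Module in
lemma exists_min_cover (R : Type u) [CommRing R] [IsLocalRing R] (M : Type u) [AddCommGroup M]
    [Module R M] [Module.Finite R M] :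
    ∃ (n : ℕ) (f : (Fin n → R) →ₗ[R] M), Function.Surjective f ∧
      ∀ c, f c = 0 → ∀ i, c i ∈ maximalIdeal R := by
  let k := ResidueField R
  let w := Module.finBasis k (TensorProduct R k M)
  have ⟨v, heq⟩ := (TensorProduct.mk_surjective R M k Ideal.Quotient.mk_surjective).comp_left w
  refine ⟨_, Fintype.linearCombination R v, ?_, ?_⟩
  · rw [← LinearMap.range_eq_top, Fintype.range_linearCombination]
    exact span_eq_top_of_tmul_eq_basis _ w (congr_fun heq)
  · intro c hc i
    have h1 : ∑ i, (residue R (c i)) • w i = 0 := by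
      have h2 := congrArg (TensorProduct.mk R k M 1) hc
      rw [Fintype.linearCombination_apply, map_sum, map_zero] at h2
      rw [← h2]
      refine Finset.sum_congr rfl fun j _ => ?_
      rw [map_smul, ← congr_fun heq j]
      exact algebraMap_smul k (c j) _
    have h3 := Fintype.linearIndependent_iff.mp w.linearIndependent _ h1 i
    exact (residue_eq_zero_iff _).mp h3

lemma ext_bridge (A : Type u) [CommRing A] (X Y : ModuleCat.{u} A) (n : ℕ)
    (h : Subsingleton (((Ext A (ModuleCat.{u} A) n).obj (op X)).obj Y)) :
    Subsingleton (Abelian.Ext X Y n) := by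
  let P := projectiveResolution X
  have hz : Limits.IsZero ((P.complex.linearYonedaObj A Y).homology n) :=
    (ModuleCat.isZero_of_subsingleton _).of_iso (P.isoExt (R := A) n Y).symm
  rw [← HomologicalComplex.exactAt_iff_isZero_homology] at hz
  refine subsingleton_of_forall_eq 0 fun α => ?_
  obtain ⟨f, hf, rfl⟩ := P.extMk_surjective α (n+1) rfl
  cases n with
  | zero =>
    have hz' := (HomologicalComplex.exactAt_iff' _ 0 0 1 (by simp) (by simp)).mp hz
    have := (ShortComplex.moduleCat_exact_iff _).mp hz' f hf
    obtain ⟨g, hg⟩ := this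
    have : f = 0 := by
      have hg' : P.complex.d 0 0 ≫ (show P.complex.X 0 ⟶ Y from g) = f := hg
      rw [← hg', P.complex.shape _ _ (by simp), Limits.zero_comp]
    subst this
    simp
  | succ n =>
    have hz' := (HomologicalComplex.exactAt_iff' _ n (n+1) (n+2) (by simp) (by simp)).mp hz
    have := (ShortComplex.moduleCat_exact_iff _).mp hz' f hf
    obtain ⟨g, hg⟩ := this
    rw [P.extMk_eq_zero_iff _ _ _ _ n rfl]
    exact ⟨g, hg⟩

open IsLocalRing in
lemma hom_residue_zero (R : Type u) [CommRing R] [IsLocalRing R] (M : Type u) [AddCommGroup M]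
    [Module R M] [Module.Finite R M] (h : ∀ f : M →ₗ[R] ResidueField R, f = 0) :
    Subsingleton M := by
  obtain ⟨n, f, hf, hk⟩ := exists_min_cover R M
  rcases Nat.eq_zero_or_pos n with rfl | hn
  · exact hf.subsingleton
  · exfalso
    let g : (Fin n → R) →ₗ[R] ResidueField R :=
      (Algebra.linearMap R (ResidueField R)) ∘ₗ (LinearMap.proj ⟨0, hn⟩)
    have hg : LinearMap.ker f ≤ LinearMap.ker g := by
      intro c hc
      exact (residue_eq_zero_iff _).mpr (hk c hc ⟨0, hn⟩)
    let e := f.quotKerEquivOfSurjective hf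
    have h0 := h ((LinearMap.ker f).liftQ g hg ∘ₗ e.symm.toLinearMap)
    have h1 := LinearMap.congr_fun h0 (f (fun _ => 1))
    have h2 : e.symm (f (fun _ => 1)) = Submodule.Quotient.mk (fun _ => 1) := by
      rw [LinearEquiv.symm_apply_eq]; rfl
    simp [h2] at h1
    simp [g] at h1

open IsLocalRing in
lemma pd_of_ext_zero (R : Type u) [CommRing R] [IsLocalRing R] [IsNoetherianRing R] (n : ℕ)
    (M : ModuleCat.{u} R) [Module.Finite R M]
    (h : Subsingleton (Abelian.Ext M (ModuleCat.of R (ResidueField R)) n)) :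
    HasProjectiveDimensionLT M n := by
  induction n generalizing M with
  | zero =>
    have h' : Subsingleton (M ⟶ ModuleCat.of R (ResidueField R)) :=
      Abelian.Ext.homEquiv₀.subsingleton_congr.mp h
    have : Subsingleton M := hom_residue_zero R M fun f =>
      congrArg ModuleCat.Hom.hom (h'.elim (ModuleCat.ofHom f) (ModuleCat.ofHom 0))
    exact (ModuleCat.isZero_of_subsingleton M).hasProjectiveDimensionLT_zero
  | succ n ih =>
    obtain ⟨d, f, hf, hk⟩ := exists_min_cover R M
    have hS := LinearMap.shortExact_shortComplexKer hf
    have hproj : Projective f.shortComplexKer.X₂ :=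
      inferInstanceAs (Projective (ModuleCat.of R (Fin d → R)))
    have hfin : Module.Finite R f.shortComplexKer.X₁ :=
      inferInstanceAs (Module.Finite R (LinearMap.ker f))
    have key : HasProjectiveDimensionLT f.shortComplexKer.X₁ n := by
      apply ih
      refine subsingleton_of_forall_eq 0 fun α => ?_
      obtain ⟨β, rfl⟩ := Abelian.Ext.contravariant_sequence_exact₁ hS _ α (add_comm 1 n)
        (h.elim _ _)
      cases n with
      | zero =>
        obtain ⟨g, rfl⟩ := (Abelian.Ext.mk₀_bijective _ _).2 β
        rw [Abelian.Ext.mk₀_comp_mk₀]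
        have : f.shortComplexKer.f ≫ g = 0 := by
          ext ⟨c, hc⟩
          let g' : (Fin d → R) →ₗ[R] ResidueField R := g.hom
          change g' c = 0
          rw [pi_eq_sum_univ' c, map_sum]
          refine Finset.sum_eq_zero fun i _ => ?_
          rw [map_smul, Algebra.smul_def]
          have : algebraMap R (ResidueField R) (c i) = 0 :=
            (residue_eq_zero_iff _).mpr (hk c hc i)
          rw [this, zero_mul]
        rw [this, Abelian.Ext.mk₀_zero]
      | succ n =>
        rw [Abelian.Ext.eq_zero_of_projective β, Abelian.Ext.comp_zero]
    exact hS.hasProjectiveDimensionLT_X₃ n key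
      (hasProjectiveDimensionLT_of_ge _ 1 (n+1) (by omega))

open IsLocalRing in
lemma free_of_pd (R : Type u) [CommRing R] [IsLocalRing R] [IsNoetherianRing R]
    (a : R) (ha : a ≠ 0) (ham : ∀ y ∈ maximalIdeal R, a * y = 0) (n : ℕ)
    (M : ModuleCat.{u} R) [Module.Finite R M]
    (h : HasProjectiveDimensionLT M n) : Module.Free R M := by
  induction n generalizing M with
  | zero =>
    have := ModuleCat.subsingleton_of_isZero (isZero_of_hasProjectiveDimensionLT_zero M)
    infer_instance
  | succ n ih =>
    cases n with
    | zero =>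
      have h1 : Projective M := projective_iff_hasProjectiveDimensionLT_one |>.mpr h
      rw [← IsProjective.iff_projective] at h1
      exact Module.free_of_flat_of_isLocalRing
    | succ n =>
      obtain ⟨d, f, hf, hk⟩ := exists_min_cover R M
      have hS := LinearMap.shortExact_shortComplexKer hf
      have hproj : Projective f.shortComplexKer.X₂ :=
        inferInstanceAs (Projective (ModuleCat.of R (Fin d → R)))
      have hfin : Module.Finite R f.shortComplexKer.X₁ :=
        inferInstanceAs (Module.Finite R (LinearMap.ker f))
      have hK : Module.Free R (LinearMap.ker f) :=
        ih f.shortComplexKer.X₁ ((hS.hasProjectiveDimensionLT_X₃_iff n hproj).mp h)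
      have hinj : Function.Injective f := by
        rw [← LinearMap.ker_eq_bot, ← Submodule.subsingleton_iff_eq_bot]
        by_contra hns
        rw [not_subsingleton_iff_nontrivial] at hns
        apply ha
        have hann : a ∈ Module.annihilator R (LinearMap.ker f) := by
          rw [Module.mem_annihilator]
          rintro ⟨c, hc⟩
          ext i
          exact ham _ (hk c hc i)
        rwa [Module.annihilator_eq_bot.mpr inferInstance] at hann
      exact Module.Free.of_equiv (LinearEquiv.ofBijective f ⟨hinj, hf⟩)

lemma pd_succ_of_exact {B : Type u} [CommRing B] {X Y Z : Type u} [AddCommGroup X] [Module B X]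
    [AddCommGroup Y] [Module B Y] [AddCommGroup Z] [Module B Z] [Module.Projective B Y]
    (i : X →ₗ[B] Y) (g : Y →ₗ[B] Z) (hi : Function.Injective i) (hex : Function.Exact i g)
    (hg : Function.Surjective g) (n : ℕ)
    (h : HasProjectiveDimensionLT (ModuleCat.of B X) (n + 1)) :
    HasProjectiveDimensionLT (ModuleCat.of B Z) (n + 2) := by
  let S : ShortComplex (ModuleCat.{u} B) :=
    { f := ModuleCat.ofHom i
      g := ModuleCat.ofHom g
      zero := by
        ext q
        exact hex.apply_apply_eq_zero q }
  have hSS : S.ShortExact :=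
    { exact := (ShortComplex.ShortExact.moduleCat_exact_iff_function_exact _).mpr hex
      mono_f := (ModuleCat.mono_iff_injective _).mpr hi
      epi_g := (ModuleCat.epi_iff_surjective _).mpr hg }
  have h2 : Projective S.X₂ := by
    rw [← IsProjective.iff_projective]
    exact inferInstanceAs (Module.Projective B Y)
  exact (hSS.hasProjectiveDimensionLT_X₃_iff n h2).mpr h

open Pointwise in
lemma map_ker_inj {R : Type u} [CommRing R] {F M : Type u} [AddCommGroup M] [Module R M]
    [AddCommGroup F] [Module R F] (x : R) (f : F →ₗ[R] M) (hx : IsSMulRegular M x) :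
    Function.Injective (QuotSMulTop.map x (LinearMap.ker f).subtype) := by
  rw [injective_iff_map_eq_zero]
  intro q hq
  obtain ⟨⟨c, hc⟩, rfl⟩ := Submodule.Quotient.mk_surjective _ q
  have hq' : c ∈ x • (⊤ : Submodule R F) :=
    (Submodule.Quotient.mk_eq_zero _).mp hq
  obtain ⟨y, -, hy⟩ := (Submodule.mem_smul_pointwise_iff_exists _ _ _).mp hq'
  have hy0 : f y = 0 := by
    apply hx.right_eq_zero_of_smul
    rw [← map_smul, hy]; exact hc
  rw [Submodule.Quotient.mk_eq_zero]
  refine (Submodule.mem_smul_pointwise_iff_exists _ _ _).mpr ⟨⟨y, hy0⟩, trivial, ?_⟩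
  ext1; exact hy

lemma pd_quot (R : Type u) [CommRing R] [IsLocalRing R] [IsNoetherianRing R]
    (x : R) (hxR : IsSMulRegular R x) (n : ℕ)
    (M : ModuleCat.{u} R) [Module.Finite R M] (hx : IsSMulRegular M x)
    (h : HasProjectiveDimensionLT M n) :
    HasProjectiveDimensionLT (ModuleCat.of (R ⧸ Ideal.span {x}) (QuotSMulTop x M)) n := by
  induction n generalizing M with
  | zero =>
    have := ModuleCat.subsingleton_of_isZero (isZero_of_hasProjectiveDimensionLT_zero M)
    have : Subsingleton (ModuleCat.of (R ⧸ Ideal.span {x}) (QuotSMulTop x M)) :=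
      inferInstanceAs (Subsingleton (QuotSMulTop x M))
    exact (ModuleCat.isZero_of_subsingleton _).hasProjectiveDimensionLT_zero
  | succ n ih =>
    cases n with
    | zero =>
      have h1 : Projective M := projective_iff_hasProjectiveDimensionLT_one |>.mpr h
      rw [← IsProjective.iff_projective] at h1
      have : Module.Free R M := Module.free_of_flat_of_isLocalRing
      have h2 : Projective (ModuleCat.of (R ⧸ Ideal.span {x}) (QuotSMulTop x M)) := by
        rw [← IsProjective.iff_projective]
        exact inferInstanceAs (Module.Projective (R ⧸ Ideal.span {x}) (QuotSMulTop x M))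
      exact projective_iff_hasProjectiveDimensionLT_one.mp h2
    | succ n =>
      obtain ⟨d, f, hf, -⟩ := exists_min_cover R M
      have hS := LinearMap.shortExact_shortComplexKer hf
      have hproj : Projective f.shortComplexKer.X₂ :=
        inferInstanceAs (Projective (ModuleCat.of R (Fin d → R)))
      have hfin : Module.Finite R f.shortComplexKer.X₁ :=
        inferInstanceAs (Module.Finite R (LinearMap.ker f))
      have hKreg : IsSMulRegular f.shortComplexKer.X₁ x := by
        rintro ⟨c, hc⟩ ⟨c', hc'⟩ hcc
        ext i
        exact hxR (congrFun (congrArg Subtype.val hcc) i)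
      have hK := ih f.shortComplexKer.X₁ hKreg ((hS.hasProjectiveDimensionLT_X₃_iff n hproj).mp h)
      let B := R ⧸ Ideal.span {x}
      have hsurj : Function.Surjective (algebraMap R B) := Ideal.Quotient.mk_surjective
      let i₀ := QuotSMulTop.map x (LinearMap.ker f).subtype
      let g₀ := QuotSMulTop.map x f
      have hex : Function.Exact i₀ g₀ :=
        QuotSMulTop.map_exact x (LinearMap.exact_subtype_ker_map f) hf
      have hg₀ : Function.Surjective g₀ := QuotSMulTop.map_surjective x hf
      have hi₀ : Function.Injective i₀ := map_ker_inj x f hx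
      exact pd_succ_of_exact (i₀.extendScalarsOfSurjective hsurj)
        (g₀.extendScalarsOfSurjective hsurj) hi₀ hex hg₀ n hK

open IsLocalRing in
lemma exists_good (R : Type u) [CommRing R] [IsLocalRing R] [IsNoetherianRing R]
    (hm : maximalIdeal R ≠ ⊥) (ha : ∀ a : R, (∀ y ∈ maximalIdeal R, a * y = 0) → a = 0) :
    ∃ x ∈ maximalIdeal R, x ∉ maximalIdeal R ^ 2 ∧ IsSMulRegular R x := by
  by_contra! hcon
  have hfin := associatedPrimes.finite R R
  have hsub : (maximalIdeal R : Set R) ⊆ (maximalIdeal R ^ 2 : Ideal R) ∪ (maximalIdeal R ^ 2 : Ideal R) ∪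
      ⋃ i ∈ (hfin.toFinset : Set (Ideal R)), (id i : Ideal R) := by
    intro x hx
    by_cases h2 : x ∈ maximalIdeal R ^ 2
    · exact Or.inl (Or.inl h2)
    · right
      have h3 : x ∈ ⋃ p ∈ associatedPrimes R R, (p : Set R) := by
        rw [biUnion_associatedPrimes_eq_compl_regular]
        exact hcon x hx h2
      simpa using h3
  have hpr : ∀ i ∈ hfin.toFinset, (id i : Ideal R).IsPrime := by
    intro i hi
    simp only [Set.Finite.mem_toFinset] at hi
    exact hi.isPrime
  have hle : ¬ maximalIdeal R ≤ maximalIdeal R ^ 2 := by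
    intro hle
    apply hm
    refine Submodule.eq_bot_of_le_smul_of_le_jacobson_bot (maximalIdeal R) _
      (IsNoetherian.noetherian _) ?_ (maximalIdeal_le_jacobson _)
    rwa [smul_eq_mul, ← pow_two]
  rcases (Ideal.subset_union_prime' (f := fun i : Option (Ideal R) =>
      i.elim (maximalIdeal R ^ 2) id) (a := none) (b := none)
      (s := hfin.toFinset.map Function.Embedding.some) (by simpa using hpr)).mp
      (by simpa using hsub) with h | h | ⟨i, hi, h⟩
  · exact hle h
  · exact hle h
  · simp only [Finset.mem_map, Set.Finite.mem_toFinset] at hi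
    obtain ⟨p, hp, rfl⟩ := hi
    obtain ⟨hpp, a, hpa⟩ := isAssociatedPrime_iff.mp hp
    change maximalIdeal R ≤ p at h
    have : a = 0 := ha a fun y hy => by
      have := h hy
      rw [hpa, Submodule.mem_colon_singleton] at this
      simpa [mul_comm] using this
    subst this
    apply hpp.ne_top
    rw [hpa, eq_top_iff]
    intro y _
    simp [Submodule.mem_colon_singleton]

open IsLocalRing in
lemma exists_functional (R : Type u) [CommRing R] [IsLocalRing R] (x : R)
    (hx : x ∈ maximalIdeal R) (hx2 : x ∉ maximalIdeal R ^ 2) :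
    ∃ φ : maximalIdeal R →ₗ[R] ResidueField R, φ ⟨x, hx⟩ = 1 := by
  have h0 : (maximalIdeal R).toCotangent ⟨x, hx⟩ ≠ 0 := by
    rw [Ne, Ideal.toCotangent_eq_zero]
    exact hx2
  let v : CotangentSpace R := (maximalIdeal R).toCotangent ⟨x, hx⟩
  have hv : v ≠ 0 := h0
  obtain ⟨l, hl⟩ : ∃ l : CotangentSpace R →ₗ[ResidueField R] ResidueField R, l v = 1 := by
    have hne : ¬ ∀ l : Module.Dual (ResidueField R) (CotangentSpace R), l v = 0 := by
      rw [Module.forall_dual_apply_eq_zero_iff]; exact hv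
    push Not at hne
    obtain ⟨l, hl⟩ := hne
    exact ⟨(l v)⁻¹ • l, by simp [hl]⟩
  exact ⟨(l.restrictScalars R) ∘ₗ (maximalIdeal R).toCotangent, hl⟩

open IsLocalRing Pointwise in
lemma pd_residue_quot (R : Type u) [CommRing R] [IsLocalRing R] (x : R)
    (hx : x ∈ maximalIdeal R) (hx2 : x ∉ maximalIdeal R ^ 2) [IsLocalRing (R ⧸ Ideal.span {x})]
    (n : ℕ) (h : HasProjectiveDimensionLT
      (ModuleCat.of (R ⧸ Ideal.span {x}) (QuotSMulTop x (maximalIdeal R))) n) :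
    HasProjectiveDimensionLT
      (ModuleCat.of (R ⧸ Ideal.span {x}) (ResidueField (R ⧸ Ideal.span {x}))) n := by
  obtain ⟨φ, hφ⟩ := exists_functional R x hx hx2
  let B := R ⧸ Ideal.span {x}
  have hsurj : Function.Surjective (algebraMap R B) := Ideal.Quotient.mk_surjective
  have hloc : IsLocalHom (algebraMap R B) := hsurj.isLocalHom
  let ψ : ResidueField R →ₗ[R] ResidueField B :=
    { toFun := ResidueField.map (algebraMap R B)
      map_add' := map_add _
      map_smul' := by
        intro r a
        rw [Algebra.smul_def, map_mul]
        rw [Algebra.smul_def]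
        rfl }
  let r₀ : QuotSMulTop x (maximalIdeal R) →ₗ[R] ResidueField B :=
    Submodule.liftQ _ (ψ ∘ₗ φ) (by
      intro y hy
      obtain ⟨z, -, rfl⟩ := (Submodule.mem_smul_pointwise_iff_exists _ _ _).mp hy
      rw [LinearMap.mem_ker, LinearMap.comp_apply, map_smul, Algebra.smul_def]
      have : algebraMap R (ResidueField R) x = 0 := (residue_eq_zero_iff _).mpr hx
      rw [this, zero_mul, map_zero])
  let r₁ : QuotSMulTop x (maximalIdeal R) →ₗ[B] ResidueField B :=
    r₀.extendScalarsOfSurjective hsurj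
  let xb : QuotSMulTop x (maximalIdeal R) := Submodule.Quotient.mk ⟨x, hx⟩
  have hr : r₁ xb = 1 := by
    change ψ (φ ⟨x, hx⟩) = 1
    rw [hφ]
    exact map_one (ResidueField.map (algebraMap R B))
  let s₁ : ResidueField B →ₗ[B] QuotSMulTop x (maximalIdeal R) :=
    Submodule.liftQ (maximalIdeal B) (LinearMap.toSpanSingleton B _ xb) (by
      intro b hb
      obtain ⟨a, rfl⟩ := hsurj b
      have ha : a ∈ maximalIdeal R := by
        rw [mem_maximalIdeal, mem_nonunits_iff] at hb ⊢
        exact fun hu => hb (hu.map _)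
      rw [LinearMap.mem_ker, LinearMap.toSpanSingleton_apply, algebraMap_smul]
      change Submodule.Quotient.mk (a • (⟨x, hx⟩ : maximalIdeal R)) = _
      rw [Submodule.Quotient.mk_eq_zero]
      refine (Submodule.mem_smul_pointwise_iff_exists _ _ _).mpr ⟨⟨a, ha⟩, trivial, ?_⟩
      ext
      exact mul_comm _ _)
  have hrs : r₁ ∘ₗ s₁ = LinearMap.id := by
    refine LinearMap.ext fun b => ?_
    obtain ⟨b, rfl⟩ := residue_surjective b
    change r₁ (b • xb) = residue B b
    rw [map_smul, hr, Algebra.smul_def, mul_one]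
    rfl
  have ret : Retract (ModuleCat.of B (ResidueField B))
      (ModuleCat.of B (QuotSMulTop x (maximalIdeal R))) :=
    { i := ModuleCat.ofHom s₁
      r := ModuleCat.ofHom r₁
      retract := by rw [← ModuleCat.ofHom_comp, hrs]; rfl }
  exact ret.hasProjectiveDimensionLT n

open IsLocalRing in
lemma serre (N : ℕ) : ∀ (R : Type u) [CommRing R] [IsLocalRing R] [IsNoetherianRing R] (n : ℕ)
    (_ : ringKrullDim R < N)
    (_ : HasProjectiveDimensionLT (ModuleCat.of R (ResidueField R)) n),
    ∃ s : Finset R, Ideal.span (s : Set R) = maximalIdeal R ∧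
      (s.card : WithBot ℕ∞) ≤ ringKrullDim R := by
  classical
  induction N with
  | zero =>
    intro R _ _ _ n hd _
    exact absurd (ringKrullDim_nonneg_of_nontrivial (R := R)) (by simpa using hd)
  | succ N ih =>
    intro R _ _ _ n hd h
    by_cases hm : maximalIdeal R = ⊥
    · exact ⟨∅, by simp [hm], by simpa using ringKrullDim_nonneg_of_nontrivial (R := R)⟩
    have hfin : Module.Finite R (ModuleCat.of R (ResidueField R)) :=
      inferInstanceAs (Module.Finite R (ResidueField R))
    have ha : ∀ a : R, (∀ y ∈ maximalIdeal R, a * y = 0) → a = 0 := by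
      intro a ham
      by_contra ha
      have hfree : Module.Free R (ResidueField R) := free_of_pd R a ha ham n _ h
      apply hm
      rw [eq_bot_iff, ← Module.annihilator_eq_bot.mpr
        (inferInstance : FaithfulSMul R (ResidueField R))]
      intro y hy
      rw [Module.mem_annihilator]
      intro z
      rw [Algebra.smul_def]
      have : algebraMap R (ResidueField R) y = 0 := (residue_eq_zero_iff _).mpr hy
      rw [this, zero_mul]
    obtain ⟨x, hx, hx2, hreg⟩ := exists_good R hm ha
    have hnt : Nontrivial (R ⧸ Ideal.span {x}) := by
      rw [Ideal.Quotient.nontrivial_iff]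
      intro htop
      rw [Ideal.span_singleton_eq_top] at htop
      exact hx htop
    have hsurj : Function.Surjective (Ideal.Quotient.mk (Ideal.span {x})) :=
      Ideal.Quotient.mk_surjective
    have hBl : IsLocalRing (R ⧸ Ideal.span {x}) := IsLocalRing.of_surjective' _ hsurj
    have hdim := ringKrullDim_quotient_span_singleton_succ_eq_ringKrullDim hreg hx
    have hpdm : HasProjectiveDimensionLT (ModuleCat.of R (maximalIdeal R)) (n + 1) := by
      have hS := LinearMap.shortExact_shortComplexKer
        (f := (Algebra.linearMap R (ResidueField R))) residue_surjective
      have hk : LinearMap.ker (Algebra.linearMap R (ResidueField R)) = maximalIdeal R := by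
        ext y
        exact residue_eq_zero_iff y
      have := hS.hasProjectiveDimensionLT_X₁ (n := n + 1)
        (hasProjectiveDimensionLT_of_ge (ModuleCat.of R R) 1 (n + 1) (by omega))
        (hasProjectiveDimensionLT_of_ge (ModuleCat.of R (ResidueField R)) n (n + 1 + 1) (by omega))
      exact hasProjectiveDimensionLT_of_iso (LinearEquiv.ofEq _ _ hk).toModuleIso (n + 1)
    have hfinm : Module.Finite R (ModuleCat.of R (maximalIdeal R)) :=
      inferInstanceAs (Module.Finite R (maximalIdeal R))
    have hmreg : IsSMulRegular (ModuleCat.of R (maximalIdeal R)) x := by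
      intro c c' hcc
      exact Subtype.ext (hreg (congrArg Subtype.val hcc))
    have hpB := pd_residue_quot R x hx hx2 (n + 1)
      (pd_quot R x hreg (n + 1) (ModuleCat.of R (maximalIdeal R)) hmreg hpdm)
    obtain ⟨s, hs, hc⟩ := ih (R ⧸ Ideal.span {x}) (n + 1) (by
      rw [← hdim] at hd
      push_cast at hd
      exact lt_of_add_lt_add_right hd) hpB
    choose g hg using hsurj
    refine ⟨insert x (s.image g), ?_, ?_⟩
    · have hmap : (Ideal.span (g '' (s : Set (R ⧸ Ideal.span {x})))).map
          (Ideal.Quotient.mk (Ideal.span {x})) = maximalIdeal (R ⧸ Ideal.span {x}) := by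
        rw [Ideal.map_span, ← hs, Set.image_image]
        simp [hg]
      have h1 := congrArg (Ideal.comap (Ideal.Quotient.mk (Ideal.span {x}))) hmap
      rw [Ideal.comap_map_of_surjective _ Ideal.Quotient.mk_surjective, ← RingHom.ker_eq_comap_bot,
        Ideal.mk_ker] at h1
      rw [Finset.coe_insert, Finset.coe_image, Ideal.span_insert, sup_comm, h1]
      have : IsLocalHom (Ideal.Quotient.mk (Ideal.span {x})) :=
        Function.Surjective.isLocalHom _ Ideal.Quotient.mk_surjective
      exact ((local_hom_TFAE (Ideal.Quotient.mk (Ideal.span {x}))).out 0 4).mp this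
    · rw [← hdim]
      calc ((insert x (s.image g)).card : WithBot ℕ∞) ≤ ((s.card + 1 : ℕ) : WithBot ℕ∞) := by
            have := (Finset.card_insert_le x (s.image g)).trans
              (Nat.add_le_add_right (Finset.card_image_le) 1)
            exact_mod_cast this
        _ = (s.card : WithBot ℕ∞) + 1 := by push_cast; rfl
        _ ≤ _ := by gcongr

/-- Let `A` be a commutative Noetherian local ring which is not a regular local ring and
let `κ = A/𝔪` be its residue field, regarded as an `A`-module. Then `Ext^n_A(κ, κ) ≠ 0`
for every natural number `n`. -/
theorem ext_residueField_self_ne_zero_of_not_regular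
    (A : Type u) [CommRing A] [IsNoetherianRing A] [IsLocalRing A]
    (hreg : ¬ IsRegularLocal A) (n : ℕ) :
    Nontrivial (((Ext A (ModuleCat.{u} A) n).obj
        (op (ModuleCat.of A (IsLocalRing.ResidueField A)))).obj
      (ModuleCat.of A (IsLocalRing.ResidueField A))) := by
  by_contra hcon
  rw [not_nontrivial_iff_subsingleton] at hcon
  apply hreg
  have hfin : Module.Finite A (ModuleCat.of A (IsLocalRing.ResidueField A)) :=
    inferInstanceAs (Module.Finite A (IsLocalRing.ResidueField A))
  have hpd := pd_of_ext_zero A n _ (ext_bridge A _ _ n hcon)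
  have hle := ringKrullDim_le_spanFinrank_maximalIdeal A
  obtain ⟨s, hs, hc⟩ := serre ((IsLocalRing.maximalIdeal A).spanFinrank + 1) A n
    (lt_of_le_of_lt hle (by exact_mod_cast Nat.lt_succ_self _)) hpd
  refine ⟨inferInstance, inferInstance, s, inferInstance, hs, le_antisymm hc (hle.trans ?_)⟩
  have h1 := Submodule.spanFinrank_span_le_ncard_of_finite (R := A) s.finite_toSet
  rw [Set.ncard_coe_finset] at h1
  have h2 : (IsLocalRing.maximalIdeal A).spanFinrank ≤ s.card := by rw [← hs]; exact h1
  exact_mod_cast h2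
end
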